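/- arXiv:2604.03965 — 2 statements merged into one kernel-verified Lean document; each statement's English description precedes it below -/
import Mathlib

section
/- Let V be an infinite-dimensional complex Banach space with an injective linear map ι : V → (ℂ → ℂ) such that ι(h) is entire for every h ∈ V and for every compact K ⊆ ℂ there is C ≥ 0 with sup_{z ∈ K} |ι(h)(z)| ≤ C·‖h‖ for all h ∈ V. Let f : ℂ → ℂ be entire and u : ℂ → ℂ entire and not identically zero, and suppose there exists a continuous linear operator T : V → V with ι(T h) = u · (ι(h) ∘ f) for all h ∈ V. Then there exist a, b ∈ ℂ with |a| ≤ 1 such that f(z) = a·z + b for all z ∈ ℂ. -/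
section EntireFunctions

open Set Filter Topology Metric

theorem ball_subset_image_of_deriv_le_two_mul {h : ℂ → ℂ} {c : ℂ} {t : ℝ} (ht : 0 < t)
    (hd : DifferentiableOn ℂ h (ball c t)) (h0 : deriv h c ≠ 0)
    (hb : ∀ z ∈ ball c t, ‖deriv h z‖ ≤ 2 * ‖deriv h c‖) :
    ball (h c) (t * ‖deriv h c‖ / 32) ⊆ h '' ball c t := by
  set a := ‖deriv h c‖ with ha
  have hapos : 0 < a := norm_pos_iff.2 h0
  have hdd : DifferentiableOn ℂ (deriv h) (ball c t) := hd.deriv isOpen_ball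
  have hmaps : MapsTo (deriv h) (ball c t) (closedBall (deriv h c) (3 * a)) := by
    intro z hz
    rw [mem_closedBall, dist_eq_norm]
    calc ‖deriv h z - deriv h c‖ ≤ ‖deriv h z‖ + ‖deriv h c‖ := norm_sub_le _ _
      _ ≤ 3 * a := by have := hb z hz; linarith
  have hsub : closedBall c (t / 8) ⊆ ball c t := closedBall_subset_ball (by linarith)
  have hS : ∀ z ∈ closedBall c (t / 8), ‖deriv h z - deriv h c‖ ≤ a / 2 := by
    intro z hz
    have h1 := Complex.dist_le_div_mul_dist_of_mapsTo_ball hdd hmaps (hsub hz)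
    rw [dist_eq_norm] at h1
    refine h1.trans ?_
    have h2 : dist z c ≤ t / 8 := hz
    calc 3 * a / t * dist z c ≤ 3 * a / t * (t / 8) := by gcongr
      _ = 3 * a / 8 := by field_simp
      _ ≤ a / 2 := by linarith
  have hlow : ∀ z ∈ sphere c (t / 8), a * (t / 8) / 2 ≤ ‖h z - h c‖ := by
    intro z hz
    have hzc : z ∈ closedBall c (t / 8) := sphere_subset_closedBall hz
    have key := (convex_closedBall c (t / 8)).norm_image_sub_le_of_norm_hasDerivWithin_le
      (f := fun w => h w - deriv h c * w) (f' := fun w => deriv h w - deriv h c)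
      (C := a / 2) (x := c) (y := z)
      (fun w hw => by
        have h1 := ((hd w (hsub hw)).differentiableAt (isOpen_ball.mem_nhds (hsub hw))).hasDerivAt
        have h2 : HasDerivAt (fun w => deriv h c * w) (deriv h c) w := by
          simpa using (hasDerivAt_id w).const_mul (deriv h c)
        exact (h1.sub h2).hasDerivWithinAt)
      hS (mem_closedBall_self (by linarith)) hzc
    have hz' : ‖z - c‖ = t / 8 := by simpa [dist_eq_norm] using hz
    rw [hz'] at key
    have e : h z - deriv h c * z - (h c - deriv h c * c)
      = (h z - h c) - deriv h c * (z - c) := by ring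
    rw [e] at key
    have h3 : ‖deriv h c * (z - c)‖ = a * (t / 8) := by rw [norm_mul, hz']
    have h4 := norm_sub_norm_le (deriv h c * (z - c)) (h z - h c)
    rw [norm_sub_rev (deriv h c * (z - c))] at h4
    linarith
  have hne : ∃ᶠ z in 𝓝 c, h z ≠ h c := by
    have hder := (hd.differentiableAt (ball_mem_nhds c ht)).hasDerivAt
    have := hder.eventually_ne (c := h c) h0
    exact this.frequently.filter_mono nhdsWithin_le_nhds
  have hdc : DiffContOnCl ℂ h (ball c (t / 8)) :=
    (hd.mono (by rw [closure_ball c (by positivity)]; exact hsub)).diffContOnCl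
  have := hdc.ball_subset_image_closedBall (by positivity) hlow hne
  have e : a * (t / 8) / 2 / 2 = t * a / 32 := by ring
  rw [e] at this
  exact this.trans (image_mono hsub)

/-- A form of Bloch's theorem with a non-optimal constant. -/
theorem exists_ball_subset_image_of_differentiableOn {h : ℂ → ℂ} {c : ℂ} {r : ℝ} (hr : 0 < r)
    (hd : DifferentiableOn ℂ h (ball c r)) :
    ∃ w, ball w (r * ‖deriv h c‖ / 128) ⊆ h '' ball c r := by
  by_cases h0 : deriv h c = 0
  · exact ⟨0, by simp [h0]⟩
  have hpos : 0 < ‖deriv h c‖ := norm_pos_iff.2 h0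
  have hdd : DifferentiableOn ℂ (deriv h) (ball c r) := hd.deriv isOpen_ball
  have hsub : closedBall c (r / 2) ⊆ ball c r := closedBall_subset_ball (by linarith)
  obtain ⟨z0, hz0, hmax⟩ := (isCompact_closedBall c (r / 2)).exists_isMaxOn
    ⟨c, mem_closedBall_self (by linarith)⟩
    (f := fun z => ‖deriv h z‖ * (r / 2 - dist z c))
    ((hdd.continuousOn.mono hsub).norm.mul (by fun_prop))
  have hmax' : ∀ z ∈ closedBall c (r / 2),
      ‖deriv h z‖ * (r / 2 - dist z c) ≤ ‖deriv h z0‖ * (r / 2 - dist z0 c) := hmax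
  have hc := hmax' c (mem_closedBall_self (by linarith))
  rw [dist_self, sub_zero] at hc
  set a := ‖deriv h z0‖ with ha
  set t := (r / 2 - dist z0 c) / 2 with ht
  have hz0' : dist z0 c ≤ r / 2 := hz0
  have h1 : ‖deriv h c‖ * (r / 2) ≤ a * (2 * t) := by rw [ht]; linarith [hc]
  have hprod : 0 < a * (2 * t) := lt_of_lt_of_le (by positivity) h1
  have ha0 : 0 ≤ a := norm_nonneg _
  have htn : 0 ≤ t := by rw [ht]; linarith
  have htpos : 0 < t := by
    rcases htn.eq_or_lt with h | h
    · rw [← h] at hprod; simp at hprod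
    · exact h
  have hapos : 0 < a := by
    rcases ha0.eq_or_lt with h | h
    · rw [← h] at hprod; simp at hprod
    · exact h
  have hbs : ball z0 t ⊆ closedBall c (r / 2) := by
    intro z hz
    have : dist z c ≤ dist z z0 + dist z0 c := dist_triangle _ _ _
    have hz' : dist z z0 < t := hz
    rw [mem_closedBall]; linarith
  have hb : ∀ z ∈ ball z0 t, ‖deriv h z‖ ≤ 2 * ‖deriv h z0‖ := by
    intro z hz
    have h2 := hmax' z (hbs hz)
    have : dist z c ≤ dist z z0 + dist z0 c := dist_triangle _ _ _
    have hz' : dist z z0 < t := hz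
    have h3 : t ≤ r / 2 - dist z c := by linarith
    have h4 : ‖deriv h z‖ * t ≤ a * (2 * t) := by
      calc ‖deriv h z‖ * t ≤ ‖deriv h z‖ * (r / 2 - dist z c) := by gcongr
        _ ≤ _ := h2
        _ = a * (2 * t) := by rw [ht]; ring
    have h5 : ‖deriv h z‖ * t ≤ (2 * a) * t := by linarith
    exact le_of_mul_le_mul_right h5 htpos
  have := ball_subset_image_of_deriv_le_two_mul htpos (hd.mono (hbs.trans hsub))
    (norm_pos_iff.1 hapos) hb
  refine ⟨h z0, (ball_subset_ball ?_).trans (this.trans (image_mono (hbs.trans hsub)))⟩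
  rw [← ha]; linarith

/-- A holomorphic function whose image contains no disc of radius `D` has controlled oscillation. -/
theorem norm_sub_le_of_forall_exists_notMem_image {h : ℂ → ℂ} {c : ℂ} {R D : ℝ} (hR : 0 < R)
    (hD : 0 ≤ D) (hd : DifferentiableOn ℂ h (ball c R))
    (hom : ∀ w : ℂ, ∃ p ∈ ball w D, p ∉ h '' ball c R) {z : ℂ} (hz : z ∈ closedBall c (R / 2)) :
    ‖h z - h c‖ ≤ 128 * D := by
  have hsub : closedBall c (R / 2) ⊆ ball c R := closedBall_subset_ball (by linarith)
  have hder : ∀ x ∈ closedBall c (R / 2), ‖deriv h x‖ ≤ 256 * D / R := by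
    intro x hx
    have hx' : dist x c ≤ R / 2 := hx
    have hs : ball x (R / 2) ⊆ ball c R := ball_subset_ball' (by linarith)
    obtain ⟨w, hw⟩ := exists_ball_subset_image_of_differentiableOn (by linarith) (hd.mono hs)
    obtain ⟨p, hp, hpn⟩ := hom w
    by_contra! hlt
    apply hpn
    apply image_mono hs
    apply hw
    apply ball_subset_ball _ hp
    rw [div_lt_iff₀ hR] at hlt
    linarith
  have := (convex_closedBall c (R / 2)).norm_image_sub_le_of_norm_deriv_le
    (fun x hx => hd.differentiableAt (isOpen_ball.mem_nhds (hsub hx))) hder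
    (mem_closedBall_self (by linarith)) hz
  refine this.trans ?_
  have hz' : ‖z - c‖ ≤ R / 2 := by simpa [dist_eq_norm] using hz
  calc 256 * D / R * ‖z - c‖ ≤ 256 * D / R * (R / 2) := by gcongr
    _ = 128 * D := by field_simp; ring

theorem exists_log_of_differentiableOn_ball {g : ℂ → ℂ} {R : ℝ} (hR : 0 < R)
    (hg : DifferentiableOn ℂ g (ball 0 R)) (h0 : ∀ z ∈ ball (0 : ℂ) R, g z ≠ 0) :
    ∃ L : ℂ → ℂ, DifferentiableOn ℂ L (ball 0 R) ∧
      (∀ z ∈ ball (0 : ℂ) R, Complex.exp (L z) = g z) ∧ L 0 = Complex.log (g 0) := by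
  have hm : (0 : ℂ) ∈ ball (0 : ℂ) R := mem_ball_self hR
  obtain ⟨P, hP⟩ := ((hg.deriv isOpen_ball).div hg h0).isExactOn_ball
  have hLd : ∀ z ∈ ball (0 : ℂ) R,
      HasDerivAt (fun z => P z - P 0 + Complex.log (g 0)) (deriv g z / g z) z := fun z hz =>
    ((hP z hz).sub_const _).add_const _
  refine ⟨fun z => P z - P 0 + Complex.log (g 0),
    fun z hz => (hLd z hz).differentiableAt.differentiableWithinAt, ?_, by simp⟩
  have hK : ∀ z ∈ ball (0 : ℂ) R,
      HasDerivAt (fun z => Complex.exp (-(P z - P 0 + Complex.log (g 0))) * g z) 0 z := by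
    intro z hz
    have h1 := (hLd z hz).neg.cexp
    have h2 := (hg.differentiableAt (isOpen_ball.mem_nhds hz)).hasDerivAt
    have h3 := h1.mul h2
    refine h3.congr_deriv ?_
    have := h0 z hz
    field_simp
    ring
  intro z hz
  have hconst := isOpen_ball.is_const_of_deriv_eq_zero (isPreconnected_ball)
    (fun x hx => (hK x hx).differentiableAt.differentiableWithinAt)
    (fun x hx => (hK x hx).deriv) hz hm
  simp only [sub_self, zero_add, Complex.exp_neg, Complex.exp_log (h0 0 hm)] at hconst
  rw [inv_mul_cancel₀ (h0 0 hm)] at hconst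
  have := Complex.exp_ne_zero (P z - P 0 + Complex.log (g 0))
  field_simp at hconst
  exact hconst.symm

theorem norm_log_le_abs_log_norm_add_pi (z : ℂ) :
    ‖Complex.log z‖ ≤ |Real.log ‖z‖| + Real.pi := by
  have := Complex.norm_le_abs_re_add_abs_im (Complex.log z)
  rw [Complex.log_re, Complex.log_im] at this
  linarith [Complex.abs_arg_le_pi z]

theorem norm_cosh_le_exp_norm (z : ℂ) : ‖Complex.cosh z‖ ≤ Real.exp ‖z‖ := by
  have h1 := Complex.norm_exp_le_exp_norm z
  have h2 := Complex.norm_exp_le_exp_norm (-z)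
  rw [norm_neg] at h2
  have h3 := norm_add_le (Complex.exp z) (Complex.exp (-z))
  rw [Complex.cosh, norm_div, Complex.norm_ofNat]
  linarith

theorem exists_cosh_eq_odd_of_nonneg {x : ℝ} (hx : 0 ≤ x) :
    ∃ y ∈ Icc x (x + 2), ∃ m : ℤ, Real.cosh y = 2 * m + 1 := by
  have hgap : Real.cosh x + 2 ≤ Real.cosh (x + 2) := by
    have h1 : Real.cosh 2 ≥ 1 + 2 := by
      have := Real.cosh_eq 2
      have h2 : (6 : ℝ) ≤ Real.exp 2 := by
        have h3 := Real.exp_one_gt_d9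
        have : Real.exp 2 = Real.exp 1 * Real.exp 1 := by rw [← Real.exp_add]; norm_num
        nlinarith
      have := Real.exp_pos (-2)
      linarith
    have h3 : 0 ≤ Real.sinh x := Real.sinh_nonneg_iff.2 hx
    have h4 : 0 ≤ Real.sinh 2 := Real.sinh_nonneg_iff.2 (by norm_num)
    have h5 := Real.one_le_cosh x
    rw [Real.cosh_add]
    nlinarith [mul_nonneg h3 h4]
  have hl := Int.ceil_lt_add_one ((Real.cosh x - 1) / 2)
  have hr := Int.le_ceil ((Real.cosh x - 1) / 2)
  set m := ⌈(Real.cosh x - 1) / 2⌉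
  have hmem : (2 * (m : ℝ) + 1) ∈ Icc (Real.cosh x) (Real.cosh (x + 2)) :=
    ⟨by linarith, by linarith⟩
  obtain ⟨y, hy, hye⟩ := intermediate_value_Icc (by linarith : x ≤ x + 2)
    Real.continuous_cosh.continuousOn hmem
  exact ⟨y, hy, m, hye⟩

theorem exists_mem_ball_cosh_eq_odd (w : ℂ) :
    ∃ p ∈ ball w 6, ∃ m : ℤ, Complex.cosh p = 2 * m + 1 := by
  obtain ⟨x, hx, m, hm⟩ : ∃ x : ℝ, |x - w.re| ≤ 2 ∧ ∃ m : ℤ, Real.cosh x = 2 * m + 1 := by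
    rcases le_total 0 w.re with h | h
    · obtain ⟨y, hy, m, hm⟩ := exists_cosh_eq_odd_of_nonneg h
      exact ⟨y, abs_le.2 ⟨by linarith [hy.1], by linarith [hy.2]⟩, m, hm⟩
    · obtain ⟨y, hy, m, hm⟩ := exists_cosh_eq_odd_of_nonneg (neg_nonneg.2 h)
      exact ⟨-y, abs_le.2 ⟨by linarith [hy.2], by linarith [hy.1]⟩, m, by rwa [Real.cosh_neg]⟩
  have hpi := Real.pi_pos
  have hr := abs_sub_round (w.im / (2 * Real.pi))
  set k := round (w.im / (2 * Real.pi))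
  have hk : |2 * Real.pi * k - w.im| ≤ Real.pi := by
    have e : 2 * Real.pi * k - w.im = -((2 * Real.pi) * (w.im / (2 * Real.pi) - k)) := by
      field_simp; ring
    rw [e, abs_neg, abs_mul, abs_of_pos (by positivity : 0 < 2 * Real.pi)]
    nlinarith
  refine ⟨(x : ℂ) + k * (2 * Real.pi * Complex.I), ?_, m, ?_⟩
  · rw [mem_ball, dist_eq_norm]
    refine (Complex.norm_le_abs_re_add_abs_im _).trans_lt ?_
    have e1 : ((x : ℂ) + k * (2 * Real.pi * Complex.I) - w).re = x - w.re := by simp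
    have e2 : ((x : ℂ) + k * (2 * Real.pi * Complex.I) - w).im = 2 * Real.pi * k - w.im := by
      simp; ring
    rw [e1, e2]
    linarith [Real.pi_lt_four]
  · have h1 : Complex.exp ((x : ℂ) + k * (2 * Real.pi * Complex.I)) = Complex.exp x := by
      rw [Complex.exp_add, Complex.exp_int_mul_two_pi_mul_I, mul_one]
    rw [Complex.cosh, Complex.exp_neg, h1, ← Complex.exp_neg, ← Complex.cosh,
      ← Complex.ofReal_cosh, hm]
    push_cast; ring

/-- Schottky's theorem. -/
theorem exists_schottky_bound (A : ℝ) : ∃ C : ℝ, 1 ≤ C ∧ ∀ R : ℝ, 0 < R → ∀ F : ℂ → ℂ,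
    DifferentiableOn ℂ F (ball 0 R) → (∀ z ∈ ball (0 : ℂ) R, F z ≠ 0) →
    (∀ z ∈ ball (0 : ℂ) R, F z ≠ 1) → |Real.log ‖F 0‖| ≤ A →
    ∀ z ∈ closedBall (0 : ℂ) (R / 2), ‖F z‖ ≤ C := by
  set q := (A + Real.pi) / Real.pi with hq
  set w := Real.log (2 * q + 1) + Real.pi + 128 * 6 with hw
  refine ⟨Real.exp (Real.pi * Real.exp w), Real.one_le_exp (by positivity), ?_⟩
  intro R hR F hF hF0 hF1 hA z hz
  have hA0 : 0 ≤ A := (abs_nonneg _).trans hA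
  have hpi := Real.pi_pos
  have hm : (0 : ℂ) ∈ ball (0 : ℂ) R := mem_ball_self hR
  have hzR : z ∈ ball (0 : ℂ) R := closedBall_subset_ball (by linarith) hz
  obtain ⟨L, hLd, hLe, hL0⟩ := exists_log_of_differentiableOn_ball hR hF.neg
    (fun z hz => neg_ne_zero.2 (hF0 z hz))
  have hpiI : (Real.pi * Complex.I : ℂ) ≠ 0 := by simp [hpi.ne']
  set Q : ℂ → ℂ := fun z => L z / (Real.pi * Complex.I) with hQ
  have hLQ : ∀ z, L z = Q z * (Real.pi * Complex.I) := fun z => by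
    rw [hQ]; field_simp
  have hQd : DifferentiableOn ℂ Q (ball 0 R) := hLd.div_const _
  have hQodd : ∀ z ∈ ball (0 : ℂ) R, ∀ m : ℤ, Q z ≠ 2 * m + 1 := by
    intro z hz m h
    have h1 := hLe z hz
    have e : L z = m * (2 * Real.pi * Complex.I) + Real.pi * Complex.I := by
      rw [hLQ, h]; ring
    rw [e, Complex.exp_add, Complex.exp_int_mul_two_pi_mul_I, Complex.exp_pi_mul_I, one_mul] at h1
    exact hF1 z hz (neg_injective h1.symm)
  have hQ1 : ∀ z ∈ ball (0 : ℂ) R, Q z ^ 2 - 1 ≠ 0 := by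
    intro z hz h
    have : (Q z - 1) * (Q z + 1) = 0 := by linear_combination h
    rcases mul_eq_zero.1 this with h | h
    · exact hQodd z hz 0 (by push_cast; linear_combination h)
    · exact hQodd z hz (-1) (by push_cast; linear_combination h)
  obtain ⟨M, hMd, hMe, -⟩ := exists_log_of_differentiableOn_ball hR
    ((hQd.pow 2).sub_const 1) hQ1
  set S : ℂ → ℂ := fun z => Complex.exp (M z / 2) with hS
  have hSd : DifferentiableOn ℂ S (ball 0 R) := (hMd.div_const 2).cexp
  have hS2 : ∀ z ∈ ball (0 : ℂ) R, S z ^ 2 = Q z ^ 2 - 1 := by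
    intro z hz
    have := hMe z hz
    simp only [hS]
    rw [← Complex.exp_nat_mul]
    simpa [mul_div_cancel₀] using this
  have hQS : ∀ z ∈ ball (0 : ℂ) R, (Q z + S z) * (Q z - S z) = 1 := fun z hz => by
    linear_combination -(hS2 z hz)
  obtain ⟨W, hWd, hWe, hW0⟩ := exists_log_of_differentiableOn_ball hR (hQd.add hSd)
    (fun z hz h => by
      have := hQS z hz
      simp only [Pi.add_apply] at h
      rw [h, zero_mul] at this; exact zero_ne_one this)
  have hcosh : ∀ z ∈ ball (0 : ℂ) R, Complex.cosh (W z) = Q z := by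
    intro z hz
    have h1 := hWe z hz
    simp only [Pi.add_apply] at h1
    rw [Complex.cosh, Complex.exp_neg, h1, inv_eq_of_mul_eq_one_right (hQS z hz)]
    ring
  have hosc := norm_sub_le_of_forall_exists_notMem_image (D := 6) hR (by norm_num) hWd (fun w => by
    obtain ⟨p, hp, m, hm⟩ := exists_mem_ball_cosh_eq_odd w
    refine ⟨p, hp, ?_⟩
    rintro ⟨z, hz, rfl⟩
    exact hQodd z hz m ((hcosh z hz).symm.trans hm)) hz
  have hL0n : ‖L 0‖ ≤ A + Real.pi := by
    rw [hL0]
    refine (norm_log_le_abs_log_norm_add_pi _).trans ?_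
    simpa using hA
  have hnpi : ‖(Real.pi * Complex.I : ℂ)‖ = Real.pi := by simp [abs_of_pos hpi]
  have hQ0 : ‖Q 0‖ ≤ q := by
    simp only [hQ, norm_div, hnpi, hq]
    gcongr
  have hS0 : ‖S 0‖ ≤ ‖Q 0‖ + 1 := by
    have h1 : ‖S 0‖ ^ 2 ≤ ‖Q 0‖ ^ 2 + 1 := by
      rw [← norm_pow, hS2 0 hm]
      refine (norm_sub_le (Q 0 ^ 2) 1).trans_eq ?_
      rw [norm_pow, norm_one]
    nlinarith [norm_nonneg (Q 0), norm_nonneg (S 0)]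
  have hp : ‖Q 0 + S 0‖ ≤ 2 * q + 1 := (norm_add_le _ _).trans (by linarith)
  have hn : ‖Q 0 - S 0‖ ≤ 2 * q + 1 := (norm_sub_le _ _).trans (by linarith)
  have hprod : ‖Q 0 + S 0‖ * ‖Q 0 - S 0‖ = 1 := by rw [← norm_mul, hQS 0 hm, norm_one]
  have hppos : 0 < ‖Q 0 + S 0‖ := by
    rcases (norm_nonneg (Q 0 + S 0)).eq_or_lt with h | h
    · rw [← h, zero_mul] at hprod; norm_num at hprod
    · exact h
  have hnpos : 0 < ‖Q 0 - S 0‖ := by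
    rcases (norm_nonneg (Q 0 - S 0)).eq_or_lt with h | h
    · rw [← h, mul_zero] at hprod; norm_num at hprod
    · exact h
  have hlog : |Real.log ‖Q 0 + S 0‖| ≤ Real.log (2 * q + 1) := by
    have h1 := Real.log_le_log hppos hp
    have h2 := Real.log_le_log hnpos hn
    have h3 : Real.log ‖Q 0 + S 0‖ + Real.log ‖Q 0 - S 0‖ = 0 := by
      rw [← Real.log_mul hppos.ne' hnpos.ne', hprod, Real.log_one]
    exact abs_le.2 ⟨by linarith, h1⟩
  have hW0n : ‖W 0‖ ≤ Real.log (2 * q + 1) + Real.pi := by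
    rw [hW0]
    refine (norm_log_le_abs_log_norm_add_pi _).trans ?_
    simpa using hlog
  have hWz : ‖W z‖ ≤ w := by
    have := norm_sub_norm_le (W z) (W 0)
    rw [hw]; linarith
  have hQz : ‖Q z‖ ≤ Real.exp w := by
    rw [← hcosh z hzR]
    exact (norm_cosh_le_exp_norm _).trans (Real.exp_le_exp.2 hWz)
  have h1 := hLe z hzR
  have : ‖F z‖ = ‖Complex.exp (L z)‖ := by rw [h1]; simp
  rw [this]
  refine (Complex.norm_exp_le_exp_norm _).trans (Real.exp_le_exp.2 ?_)
  rw [hLQ, norm_mul, hnpi, mul_comm]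
  gcongr

/-- Picard's little theorem for entire functions omitting `0` and `1`. -/
theorem Differentiable.exists_eq_const_of_ne_zero_of_ne_one {F : ℂ → ℂ}
    (hF : Differentiable ℂ F) (h0 : ∀ z, F z ≠ 0) (h1 : ∀ z, F z ≠ 1) : ∃ c, ∀ z, F z = c := by
  obtain ⟨C, -, hC⟩ := exists_schottky_bound |Real.log ‖F 0‖|
  apply hF.exists_const_forall_eq_of_bounded
  refine (isBounded_iff_forall_norm_le.2 ⟨C, ?_⟩)
  rintro _ ⟨z, rfl⟩
  exact hC (2 * (‖z‖ + 1)) (by positivity) F hF.differentiableOn (fun z _ => h0 z) (fun z _ => h1 z)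
    le_rfl z (by rw [mem_closedBall, dist_zero_right]; linarith)

theorem Differentiable.exists_eq_const_of_ne_of_ne {F : ℂ → ℂ} {a b : ℂ} (hab : a ≠ b)
    (hF : Differentiable ℂ F) (h0 : ∀ z, F z ≠ a) (h1 : ∀ z, F z ≠ b) : ∃ c, ∀ z, F z = c := by
  have hba : b - a ≠ 0 := sub_ne_zero.2 hab.symm
  obtain ⟨c, hc⟩ := Differentiable.exists_eq_const_of_ne_zero_of_ne_one
    (F := fun z => (F z - a) / (b - a)) ((hF.sub_const a).div_const _)
    (fun z h => h0 z (by
      rw [div_eq_zero_iff] at h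
      exact sub_eq_zero.1 (h.resolve_right hba)))
    (fun z h => h1 z (by
      rw [div_eq_one_iff_eq hba] at h
      exact sub_left_injective h))
  refine ⟨c * (b - a) + a, fun z => ?_⟩
  rw [← hc z]; field_simp; ring

theorem exists_comp_self_fixed {f : ℂ → ℂ} (hf : Differentiable ℂ f)
    (hna : ¬ ∃ a b : ℂ, ∀ z, f z = a * z + b) : ∃ p, f (f p) = p := by
  by_contra! h
  have h1 : ∀ p, f p ≠ p := fun p hp => h p (by rw [hp, hp])
  have h1' : ∀ p, f p - p ≠ 0 := fun p => sub_ne_zero.2 (h1 p)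
  obtain ⟨c, hc⟩ := Differentiable.exists_eq_const_of_ne_zero_of_ne_one
    (F := fun z => (f (f z) - z) / (f z - z))
    (((hf.comp hf).sub differentiable_id).div (hf.sub differentiable_id) h1')
    (fun z => div_ne_zero (sub_ne_zero.2 (h z)) (h1' z))
    (fun z hz => by
      rw [div_eq_one_iff_eq (h1' z)] at hz
      exact h1 (f z) (sub_left_injective hz))
  have hc0 : c ≠ 0 := by
    rw [← hc 0]; exact div_ne_zero (sub_ne_zero.2 (h 0)) (h1' 0)
  have hc1 : 1 - c ≠ 0 := by
    rw [← hc 0, sub_ne_zero]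
    intro hz
    rw [eq_comm, div_eq_one_iff_eq (h1' 0)] at hz
    exact h1 (f 0) (sub_left_injective hz)
  have heq : ∀ z, f (f z) - z = c * (f z - z) := fun z => by
    rw [← hc z, div_mul_cancel₀ _ (h1' z)]
  have hder : ∀ z, deriv f z * (deriv f (f z) - c) = 1 - c := by
    intro z
    have d1 : HasDerivAt f (deriv f z) z := (hf z).hasDerivAt
    have d2 : HasDerivAt (fun z => f (f z) - z) (deriv f (f z) * deriv f z - 1) z :=
      ((hf (f z)).hasDerivAt.comp z d1).sub (hasDerivAt_id z)
    have d3 : HasDerivAt (fun z => c * (f z - z)) (c * (deriv f z - 1)) z :=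
      (d1.sub (hasDerivAt_id z)).const_mul c
    rw [← funext heq] at d3
    linear_combination d2.unique d3
  have hfd : Differentiable ℂ (deriv f) := hf.deriv
  obtain ⟨k, hk⟩ := Differentiable.exists_eq_const_of_ne_of_ne (F := fun z => deriv f (f z))
    (a := 0) (b := c) hc0.symm (hfd.comp hf)
    (fun z hz => hc1 (by
      have hz' : deriv f (f z) = 0 := hz
      rw [← hder (f z), hz', zero_mul]))
    (fun z hz => hc1 (by
      have hz' : deriv f (f z) = c := hz
      rw [← hder z, hz', sub_self, mul_zero]))
  have hkc : k - c ≠ 0 := fun hz => hc1 (by rw [← hder 0, hk 0, hz, mul_zero])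
  apply hna
  refine ⟨(1 - c) / (k - c), f 0, fun z => ?_⟩
  have hconst : ∀ z, HasDerivAt (fun z => f z - (1 - c) / (k - c) * z) 0 z := by
    intro z
    have d1 : HasDerivAt f (deriv f z) z := (hf z).hasDerivAt
    have d2 : HasDerivAt (fun z => (1 - c) / (k - c) * z) ((1 - c) / (k - c)) z := by
      simpa using (hasDerivAt_id z).const_mul ((1 - c) / (k - c))
    refine (d1.sub d2).congr_deriv ?_
    rw [← hder z, hk z]; field_simp; simp
  have := is_const_of_deriv_eq_zero (fun z => (hconst z).differentiableAt)
    (fun z => (hconst z).deriv) z 0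
  simp only [mul_zero, sub_zero] at this
  linear_combination this

theorem Differentiable.exists_norm_le_of_sphere_subset_image {g G : ℂ → ℂ} {s : Set ℂ} {ρ : ℝ}
    (hρ : 0 < ρ) (hG : Differentiable ℂ G) (hs : sphere 0 ρ ⊆ g '' s) {w : ℂ} (hw : ‖w‖ ≤ ρ) :
    ∃ z ∈ s, ‖G w‖ ≤ ‖G (g z)‖ := by
  obtain ⟨x, hx, hmax⟩ := (isCompact_sphere (0 : ℂ) ρ).exists_isMaxOn
    (NormedSpace.sphere_nonempty.2 hρ.le) hG.continuous.norm.continuousOn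
  obtain ⟨z, hz, rfl⟩ := hs hx
  refine ⟨z, hz, Complex.norm_le_of_forall_mem_frontier_norm_le (U := ball 0 ρ) isBounded_ball
    hG.diffContOnCl (fun y hy => ?_) ?_⟩
  · rw [frontier_ball _ hρ.ne'] at hy
    exact hmax hy
  · rw [closure_ball _ hρ.ne']; simpa using hw

theorem exists_covering_constant : ∃ C : ℝ, 1 ≤ C ∧ ∀ (g : ℂ → ℂ) (R ρ : ℝ),
    Differentiable ℂ g → 0 < R → 0 < ρ → ‖g 0‖ ≤ ρ / 2 →
    (∃ z : ℂ, ‖z‖ ≤ R / 2 ∧ C * ρ < ‖g z‖) → ∀ G : ℂ → ℂ, Differentiable ℂ G →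
    ∀ w : ℂ, ‖w‖ ≤ ρ → ∃ z ∈ ball (0 : ℂ) R, ‖G w‖ ≤ ‖G (g z)‖ := by
  obtain ⟨C, hC1, hC⟩ := exists_schottky_bound (Real.log 6)
  refine ⟨3 * C + 1, by linarith, ?_⟩
  intro g R ρ hg hR hρ hg0 ⟨z, hz, hgz⟩ G hG w hw
  by_cases h1 : sphere 0 ρ ⊆ g '' ball 0 R
  · exact hG.exists_norm_le_of_sphere_subset_image hρ h1 hw
  by_cases h2 : sphere 0 (2 * ρ) ⊆ g '' ball 0 R
  · exact hG.exists_norm_le_of_sphere_subset_image (by positivity) h2 (by linarith)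
  exfalso
  obtain ⟨w1, hw1, hn1⟩ := not_subset.1 h1
  obtain ⟨w2, hw2, hn2⟩ := not_subset.1 h2
  rw [mem_sphere_zero_iff_norm] at hw1 hw2
  have hd1 : ρ ≤ ‖w2 - w1‖ := by
    have := norm_sub_norm_le w2 w1; linarith
  have hd2 : ‖w2 - w1‖ ≤ 3 * ρ := by
    have := norm_sub_le w2 w1; linarith
  have hdpos : 0 < ‖w2 - w1‖ := by linarith
  have hd0 : w2 - w1 ≠ 0 := norm_pos_iff.1 hdpos
  have ha1 : ρ / 2 ≤ ‖g 0 - w1‖ := by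
    have := norm_sub_norm_le w1 (g 0); rw [norm_sub_rev] at this; linarith
  have ha2 : ‖g 0 - w1‖ ≤ 3 * ρ / 2 := by
    have := norm_sub_le (g 0) w1; linarith
  have hF := hC R hR (fun z => (g z - w1) / (w2 - w1))
    ((hg.sub_const w1).div_const _).differentiableOn
    (fun z hz h => hn1 ⟨z, hz, by
      rw [div_eq_zero_iff] at h
      exact sub_eq_zero.1 (h.resolve_right hd0)⟩)
    (fun z hz h => hn2 ⟨z, hz, by
      rw [div_eq_one_iff_eq hd0] at h
      exact sub_left_injective h⟩)
    (by
      have hlo : 6⁻¹ ≤ ‖(g 0 - w1) / (w2 - w1)‖ := by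
        rw [norm_div, le_div_iff₀ hdpos]; linarith
      have hhi : ‖(g 0 - w1) / (w2 - w1)‖ ≤ 6 := by
        rw [norm_div, div_le_iff₀ hdpos]; linarith
      have l1 := Real.log_le_log (by norm_num) hlo
      have l2 := Real.log_le_log (by linarith) hhi
      rw [Real.log_inv] at l1
      exact abs_le.2 ⟨l1, l2⟩) z (by simpa using hz)
  rw [norm_div, div_le_iff₀ hdpos] at hF
  have h3 : ‖g z‖ ≤ ‖g z - w1‖ + ‖w1‖ := by
    simpa using norm_add_le (g z - w1) w1
  have h4 : C * ‖w2 - w1‖ ≤ C * (3 * ρ) := by gcongr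
  linarith

theorem Differentiable.exists_iteratedDeriv_ne_zero_of_not_affine {f : ℂ → ℂ}
    (hf : Differentiable ℂ f) (hna : ¬ ∃ a b : ℂ, ∀ z, f z = a * z + b) :
    ∃ k, 2 ≤ k ∧ iteratedDeriv k f 0 ≠ 0 := by
  by_contra! h
  refine hna ⟨iteratedDeriv 1 f 0, iteratedDeriv 0 f 0, fun z => ?_⟩
  have := Complex.taylorSeries_eq_of_entire hf 0 z
  rw [tsum_eq_sum (s := Finset.range 2)] at this
  · rw [← this]
    simp [Finset.sum_range_succ]; ring
  · intro n hn
    rw [h n (by simpa [Nat.succ_le_iff] using hn), smul_zero, smul_zero]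

theorem Differentiable.exists_quadratic_growth_of_not_affine {f : ℂ → ℂ}
    (hf : Differentiable ℂ f) (hna : ¬ ∃ a b : ℂ, ∀ z, f z = a * z + b) {C : ℝ} (hC : 0 < C) :
    ∃ ε : ℝ, 0 < ε ∧ ε ≤ 1 ∧ ∀ r : ℝ, 2 ≤ r → ∃ z : ℂ, ‖z‖ ≤ r / 2 ∧ C * (ε * r ^ 2) < ‖f z‖ := by
  obtain ⟨k, hk, hka⟩ := hf.exists_iteratedDeriv_ne_zero_of_not_affine hna
  have ha : 0 < ‖iteratedDeriv k f 0‖ := norm_pos_iff.2 hka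
  have hfac : (0 : ℝ) < (Nat.factorial k : ℝ) := by exact_mod_cast Nat.factorial_pos k
  set ε := min 1 (‖iteratedDeriv k f 0‖ / (8 * Nat.factorial k * C)) with hε
  have hεpos : 0 < ε := lt_min one_pos (by positivity)
  refine ⟨ε, hεpos, min_le_left _ _, fun r hr => ?_⟩
  by_contra! h
  have h1 := Complex.norm_iteratedDeriv_le_of_forall_mem_sphere_norm_le k
    (by linarith : 0 < r / 2) (hf.diffContOnCl (s := ball 0 (r / 2)))
    (C := C * (ε * r ^ 2)) (fun z hz => h z (by simpa using (mem_sphere_zero_iff_norm.1 hz).le))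
  have hrk : 0 < (r / 2) ^ k := by positivity
  rw [le_div_iff₀ hrk] at h1
  have h2 : (r / 2) ^ 2 ≤ (r / 2) ^ k := pow_le_pow_right₀ (by linarith) hk
  have h3 : ε * (8 * Nat.factorial k * C) ≤ ‖iteratedDeriv k f 0‖ := by
    rw [← le_div_iff₀ (by positivity)]; exact min_le_right _ _
  have h4 : ‖iteratedDeriv k f 0‖ * (r / 2) ^ 2 ≤ Nat.factorial k * (C * (ε * r ^ 2)) :=
    (mul_le_mul_of_nonneg_left h2 ha.le).trans h1
  have h5 : ε * (8 * Nat.factorial k * C) * (r / 2) ^ 2 ≤ Nat.factorial k * (C * (ε * r ^ 2)) :=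
    (mul_le_mul_of_nonneg_right h3 (by positivity)).trans h4
  have h6 : 0 < Nat.factorial k * (C * (ε * r ^ 2)) := by positivity
  nlinarith

/-- The iterates of a non-affine entire function grow doubly exponentially on every sufficiently
large disc. -/
theorem Differentiable.exists_exp_two_pow_le_norm_iterate {f : ℂ → ℂ}
    (hf : Differentiable ℂ f) (hna : ¬ ∃ a b : ℂ, ∀ z, f z = a * z + b) :
    ∃ R₁ : ℝ, ∀ R ≥ R₁, ∀ n : ℕ, ∃ z : ℂ, ‖z‖ ≤ R ∧ Real.exp (2 ^ n) ≤ ‖f^[n] z‖ := by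
  obtain ⟨C, hC1, hC⟩ := exists_covering_constant
  obtain ⟨ε, hε0, hε1, hε⟩ := hf.exists_quadratic_growth_of_not_affine hna
    (by linarith : 0 < C)
  have key : ∀ n : ℕ, ∀ R : ℝ, 3 / ε ≤ R → 2 ≤ R → 2 * ‖f 0‖ ≤ R →
      ∃ z : ℂ, ‖z‖ ≤ R ∧ ε⁻¹ * (ε * R) ^ (2 ^ n) ≤ ‖f^[n] z‖ := by
    intro n
    induction n with
    | zero =>
      intro R _ h2 _
      refine ⟨(R : ℂ), ?_, ?_⟩
      · simp [abs_of_nonneg (by linarith : 0 ≤ R)]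
      · simp only [pow_zero, pow_one, Function.iterate_zero, id, Complex.norm_real,
          Real.norm_eq_abs, abs_of_nonneg (by linarith : 0 ≤ R)]
        rw [inv_mul_cancel_left₀ hε0.ne']
    | succ n ih =>
      intro R h1 h2 h3
      have hεR : 3 ≤ R * ε := (div_le_iff₀ hε0).1 h1
      have hρ : R ≤ ε * R ^ 2 := by nlinarith
      obtain ⟨w, hw, hw'⟩ := ih (ε * R ^ 2) (h1.trans hρ) (h2.trans hρ) (h3.trans hρ)
      obtain ⟨z, hz, hz'⟩ := hC f R (ε * R ^ 2) hf (by linarith) (by positivity) (by linarith)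
        (hε R h2) f^[n] (hf.iterate n) w hw
      refine ⟨z, by simpa using (mem_ball.1 hz).le, ?_⟩
      rw [Function.iterate_succ_apply]
      refine le_trans (le_of_eq ?_) (hw'.trans hz')
      rw [pow_succ 2 n, mul_comm (2 ^ n) 2, pow_mul]
      ring
  refine ⟨max (3 / ε) (max 2 (2 * ‖f 0‖)), fun R hR n => ?_⟩
  have h1 : 3 / ε ≤ R := (le_max_left _ _).trans hR
  obtain ⟨z, hz, hz'⟩ := key n R h1 (((le_max_left _ _).trans (le_max_right _ _)).trans hR)
    (((le_max_right _ _).trans (le_max_right _ _)).trans hR)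
  refine ⟨z, hz, le_trans ?_ hz'⟩
  have hεR : 3 ≤ ε * R := by rw [mul_comm]; exact (div_le_iff₀ hε0).1 h1
  have he : Real.exp 1 ≤ ε * R := by linarith [Real.exp_one_lt_d9]
  have h2 : Real.exp (2 ^ n) ≤ (ε * R) ^ (2 ^ n) := by
    have := pow_le_pow_left₀ (Real.exp_pos 1).le he (2 ^ n)
    rw [← Real.exp_nat_mul] at this
    simpa using this
  refine h2.trans (le_mul_of_one_le_left (by positivity) ((one_le_inv₀ hε0).2 hε1))

end EntireFunctions

section CircleMeans

open Set Filter Topology Metric Real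

theorem continuousOn_re_herglotzRieszKernel_sphere {w : ℂ} {R : ℝ} (hw : w ∈ ball (0 : ℂ) R) :
    ContinuousOn (Complex.re ∘ herglotzRieszKernel 0 w) (sphere 0 R) := by
  have h := continuousOn_herglotzRieszKernel_sphere hw
  rw [abs_of_pos (pos_of_mem_ball hw)] at h
  exact Complex.continuous_re.comp_continuousOn h

theorem log_norm_sub_le_circleAverage_herglotzRieszKernel {w u : ℂ} {R : ℝ}
    (hu : u ∈ closedBall (0 : ℂ) R) (hw : w ∈ ball (0 : ℂ) R) (huw : w ≠ u) :
    log ‖w - u‖ ≤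
      circleAverage (Complex.re ∘ herglotzRieszKernel 0 w * fun z => log ‖z - u‖) 0 R := by
  have hR : 0 < R := pos_of_mem_ball hw
  by_cases hus : u ∈ sphere (0 : ℂ) R
  · exact (circleAverage_re_herglotzRieszKernel_mul_log hus hw).ge
  have huR : ‖u‖ < R := by
    rw [mem_closedBall_zero_iff] at hu
    rw [mem_sphere_zero_iff_norm] at hus
    exact lt_of_le_of_ne hu hus
  have hwR : ‖w‖ < R := by simpa using hw
  set q : ℂ → ℂ := fun z => R - (starRingEnd ℂ) u * z / R with hq
  have hRC : (R : ℂ) ≠ 0 := by exact_mod_cast hR.ne'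
  have hq0 : ∀ z ∈ closedBall (0 : ℂ) R, q z ≠ 0 := by
    intro z hz h
    rw [mem_closedBall_zero_iff] at hz
    have h1 : (R : ℂ) = (starRingEnd ℂ) u * z / R := sub_eq_zero.1 h
    have h2 : R = ‖u‖ * ‖z‖ / R := by
      have := congrArg norm h1
      simpa [abs_of_pos hR] using this
    have h3 : ‖u‖ * ‖z‖ / R < R := by
      rw [div_lt_iff₀ hR]
      nlinarith [norm_nonneg u, norm_nonneg z]
    linarith
  have hqs : ∀ z : ℂ, R ^ 2 * (‖q z‖ ^ 2 - ‖z - u‖ ^ 2) =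
      (R ^ 2 - ‖z‖ ^ 2) * (R ^ 2 - ‖u‖ ^ 2) := by
    intro z
    have e : ‖q z‖ ^ 2 * R ^ 2 = ‖R ^ 2 - (starRingEnd ℂ) u * z‖ ^ 2 := by
      have e1 : q z * R = R ^ 2 - (starRingEnd ℂ) u * z := by
        simp only [hq]; field_simp
      rw [← e1, norm_mul, Complex.norm_real, mul_pow, Real.norm_eq_abs, sq_abs]
    rw [mul_sub, mul_comm, e]
    simp only [← Complex.normSq_eq_norm_sq, Complex.normSq_apply]
    simp [pow_two]
    ring
  have hharm : InnerProductSpace.HarmonicOnNhd (fun z => log ‖q z‖) (closedBall 0 R) := by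
    intro z hz
    refine AnalyticAt.harmonicAt_log_norm ?_ (hq0 z hz)
    exact Differentiable.analyticAt (by simp only [hq]; fun_prop) z
  have heq : circleAverage (Complex.re ∘ herglotzRieszKernel 0 w * fun z => log ‖z - u‖) 0 R
      = log ‖q w‖ := by
    rw [← InnerProductSpace.HarmonicOnNhd.circleAverage_re_herglotzRieszKernel_smul hharm hw]
    refine circleAverage_congr_sphere fun z hz => ?_
    rw [abs_of_pos hR, mem_sphere_zero_iff_norm] at hz
    have h := hqs z
    rw [hz, sub_self, zero_mul] at h
    have h2 : ‖q z‖ ^ 2 = ‖z - u‖ ^ 2 := by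
      have := (mul_eq_zero.1 h).resolve_left (by positivity)
      linarith
    have h3 : ‖q z‖ = ‖z - u‖ := by
      rwa [sq_eq_sq₀ (norm_nonneg _) (norm_nonneg _)] at h2
    simp [h3]
  rw [heq]
  apply Real.log_le_log (norm_pos_iff.2 (sub_ne_zero.2 huw))
  rw [← sq_le_sq₀ (norm_nonneg _) (norm_nonneg _)]
  have h := hqs w
  have h1 : 0 ≤ (R ^ 2 - ‖w‖ ^ 2) * (R ^ 2 - ‖u‖ ^ 2) := by
    apply mul_nonneg <;> nlinarith [norm_nonneg u, norm_nonneg w]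
  rw [← h] at h1
  have := nonneg_of_mul_nonneg_right h1 (by positivity)
  linarith

/-- The Poisson–Jensen inequality. -/
theorem log_norm_le_circleAverage_herglotzRieszKernel {F : ℂ → ℂ} {w : ℂ} {R : ℝ}
    (hF : AnalyticOnNhd ℂ F (closedBall 0 R)) (hw : w ∈ ball (0 : ℂ) R) (hFw : F w ≠ 0) :
    log ‖F w‖ ≤
      circleAverage (Complex.re ∘ herglotzRieszKernel 0 w * fun z => log ‖F z‖) 0 R := by
  have hR : 0 < R := pos_of_mem_ball hw
  have hwc := ball_subset_closedBall hw
  set P := Complex.re ∘ herglotzRieszKernel 0 w with hP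
  have hPc : ContinuousOn P (sphere 0 |R|) := by
    rw [abs_of_pos hR]; exact continuousOn_re_herglotzRieszKernel_sphere hw
  set D := MeromorphicOn.divisor F (closedBall 0 R) with hD
  have hfin : D.support.Finite := D.finiteSupport (isCompact_closedBall 0 R)
  have hord : ∀ u : closedBall (0 : ℂ) R, meromorphicOrderAt F u ≠ ⊤ := by
    rw [← hF.meromorphicOn.exists_meromorphicOrderAt_ne_top_iff_forall
      ⟨⟨w, hwc⟩, (convex_closedBall 0 R).isPreconnected⟩]
    refine ⟨⟨w, hwc⟩, ?_⟩
    rw [(hF w hwc).meromorphicNFAt.meromorphicOrderAt_eq_zero_iff.2 hFw]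
    exact WithTop.zero_ne_top
  obtain ⟨g, hg, hg0, hFg⟩ := hF.meromorphicOn.extract_zeros_poles hord hfin
  have hlog := MeromorphicOn.extract_zeros_poles_log hg0 hFg
  rw [← hD] at hlog
  rw [finsum_eq_sum_of_support_subset (s := hfin.toFinset)] at hlog
  swap
  · intro u hu
    simp only [Finite.coe_toFinset, Function.mem_support]
    intro h
    apply hu
    funext x
    simp [h]
  have hDnn : ∀ u, 0 ≤ D u := fun u => MeromorphicOn.AnalyticOnNhd.divisor_nonneg hF u
  have hsupp : ∀ u ∈ hfin.toFinset, u ∈ closedBall (0 : ℂ) R := fun u hu =>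
    D.supportWithinDomain ((Finite.mem_toFinset hfin).1 hu)
  have hDw : D w = 0 := by
    rw [hD, MeromorphicOn.AnalyticOnNhd.divisor_apply hF hwc,
      (hF w hwc).analyticOrderAt_eq_zero.2 hFw]
    rfl
  have hne : ∀ u ∈ hfin.toFinset, w ≠ u := by
    rintro u hu rfl
    exact ((Finite.mem_toFinset hfin).1 hu) hDw
  have hval : log ‖F w‖ = ∑ u ∈ hfin.toFinset, D u * log ‖w - u‖ + log ‖g w‖ := by
    have hl : Tendsto (fun z => log ‖F z‖) (𝓝[≠] w) (𝓝 (log ‖F w‖)) :=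
      ((hF w hwc).continuousAt.norm.log (norm_ne_zero_iff.2 hFw)).tendsto.mono_left
        nhdsWithin_le_nhds
    have hr : Tendsto (fun z => ∑ u ∈ hfin.toFinset, D u * log ‖z - u‖ + log ‖g z‖) (𝓝[≠] w)
        (𝓝 (∑ u ∈ hfin.toFinset, D u * log ‖w - u‖ + log ‖g w‖)) := by
      refine Tendsto.mono_left (Tendsto.add (tendsto_finsetSum _ fun u hu => ?_) ?_)
        nhdsWithin_le_nhds
      · refine Tendsto.const_mul _ (Tendsto.log ?_ (norm_ne_zero_iff.2 (sub_ne_zero.2 (hne u hu))))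
        exact (continuous_id.sub continuous_const).norm.tendsto w
      · exact ((hg w hwc).continuousAt.norm.log (norm_ne_zero_iff.2 (hg0 ⟨w, hwc⟩))).tendsto
    refine tendsto_nhds_unique (hl.congr' ?_) hr
    have h1 := mem_codiscreteWithin_iff_forall_mem_nhdsNE.1 hlog w hwc
    have h2 : closedBall (0 : ℂ) R ∈ 𝓝[≠] w :=
      mem_nhdsWithin_of_mem_nhds (mem_of_superset (isOpen_ball.mem_nhds hw) ball_subset_closedBall)
    filter_upwards [h1, h2] with z hz1 hz2
    rcases hz1 with hz | hz
    · have hz' : log ‖F z‖ = _ := hz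
      rw [hz']
      simp
    · exact absurd hz2 hz
  have hgs : AnalyticOnNhd ℂ g (sphere 0 |R|) := by
    rw [abs_of_pos hR]; exact hg.mono sphere_subset_closedBall
  have hint : ∀ u : ℂ, CircleIntegrable (P * fun z => log ‖z - u‖) 0 R := fun u =>
    CircleIntegrable.continuousOn_mul
      (MeromorphicOn.circleIntegrable_log_norm (f := fun z => z - u)
        (fun z _ => (analyticAt_id.sub analyticAt_const).meromorphicAt)) hPc
  have hintg : CircleIntegrable (P * fun z => log ‖g z‖) 0 R :=
    CircleIntegrable.continuousOn_mul hgs.meromorphicOn.circleIntegrable_log_norm hPc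
  have hAg : circleAverage (P * fun z => log ‖g z‖) 0 R = log ‖g w‖ :=
    InnerProductSpace.HarmonicOnNhd.circleAverage_re_herglotzRieszKernel_smul
      (f := fun z => log ‖g z‖)
      (fun z hz => AnalyticAt.harmonicAt_log_norm (hg z hz) (hg0 ⟨z, hz⟩)) hw
  have hA : circleAverage (P * fun z => log ‖F z‖) 0 R
      = ∑ u ∈ hfin.toFinset, (D u : ℝ) * circleAverage (P * fun z => log ‖z - u‖) 0 R
        + log ‖g w‖ := by
    rw [← hAg]
    have e : (P * fun z => log ‖F z‖) =ᶠ[codiscreteWithin (sphere 0 |R|)]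
        (∑ u ∈ hfin.toFinset, (D u : ℝ) • (P * fun z => log ‖z - u‖))
          + (P * fun z => log ‖g z‖) := by
      have hs : sphere (0 : ℂ) |R| ⊆ closedBall 0 R := by
        rw [abs_of_pos hR]; exact sphere_subset_closedBall
      filter_upwards [codiscreteWithin_mono hs hlog] with z hz
      have hz' : log ‖F z‖ = _ := hz
      simp only [Pi.mul_apply, hz', Pi.add_apply, Finset.sum_apply, Pi.smul_apply, smul_eq_mul,
        mul_add, Finset.mul_sum]
      congr 1
      exact Finset.sum_congr rfl fun u _ => by ring
    rw [circleAverage_congr_codiscreteWithin e hR.ne', circleAverage_add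
      (CircleIntegrable.sum _ fun u _ => (hint u).const_smul) hintg,
      circleAverage_sum fun u _ => (hint u).const_smul]
    simp only [circleAverage_smul, smul_eq_mul]
  rw [hA, hval]
  gcongr with u hu
  · exact_mod_cast hDnn u
  · exact log_norm_sub_le_circleAverage_herglotzRieszKernel (hsupp u hu) hw (hne u hu)

theorem log_norm_zero_le_circleAverage {F : ℂ → ℂ} {R : ℝ} (hR : 0 < R)
    (hF : Differentiable ℂ F) (hF0 : F 0 ≠ 0) :
    log ‖F 0‖ ≤ circleAverage (fun z => log ‖F z‖) 0 R := by
  have h := log_norm_le_circleAverage_herglotzRieszKernel (R := R)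
    (fun z _ => hF.analyticAt z) (mem_ball_self hR) hF0
  refine h.trans_eq (circleAverage_congr_sphere fun z hz => ?_)
  rw [abs_of_pos hR, mem_sphere_zero_iff_norm] at hz
  have hz0 : z ≠ 0 := norm_pos_iff.1 (by rw [hz]; exact hR)
  simp [herglotzRieszKernel_def, hz0]

/-- A Harnack-type bound for the logarithm of the modulus of an analytic function. -/
theorem log_norm_le_three_mul_circleAverage_posLog {F : ℂ → ℂ} {R : ℝ} (hR : 0 < R)
    (hF : Differentiable ℂ F) {w : ℂ} (hw : ‖w‖ ≤ R / 2) :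
    log ‖F w‖ ≤ 3 * circleAverage (fun z => log⁺ ‖F z‖) 0 R := by
  have hnn : 0 ≤ circleAverage (fun z => log⁺ ‖F z‖) 0 R :=
    circleAverage_nonneg_of_nonneg fun z _ => posLog_nonneg
  by_cases hFw : F w = 0
  · rw [hFw, norm_zero, log_zero]; positivity
  have hwR : w ∈ ball (0 : ℂ) R := by rw [mem_ball_zero_iff]; linarith
  have hPc := continuousOn_re_herglotzRieszKernel_sphere hwR
  rw [← abs_of_pos hR] at hPc
  have hFm : MeromorphicOn F (sphere 0 |R|) := fun z _ => (hF.analyticAt z).meromorphicAt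
  have hint := hFm.circleIntegrable_log_norm
  have hintp : CircleIntegrable (fun z => log⁺ ‖F z‖) 0 R := hFm.circleIntegrable_posLog_norm
  refine (log_norm_le_circleAverage_herglotzRieszKernel (R := R)
    (fun z _ => hF.analyticAt z) hwR hFw).trans ?_
  have e : 3 * circleAverage (fun z => log⁺ ‖F z‖) 0 R =
      circleAverage (fun z => (3 : ℝ) • log⁺ ‖F z‖) 0 R := by
    rw [circleAverage_fun_smul, smul_eq_mul]
  rw [e]
  refine circleAverage_mono (hint.continuousOn_mul hPc) hintp.const_smul fun z hz => ?_
  rw [abs_of_pos hR] at hz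
  have h1 := re_herglotzRieszKernel_le hz hwR
  have h2 := le_re_herglotzRieszKernel hz hwR
  rw [← herglotzRieszKernel_def] at h1 h2
  rw [sub_zero] at h1 h2
  have hw0 := norm_nonneg w
  have h3 : (R + ‖w‖) / (R - ‖w‖) ≤ 3 := by
    rw [div_le_iff₀ (by linarith)]; linarith
  have h4 : 0 ≤ (R - ‖w‖) / (R + ‖w‖) := div_nonneg (by linarith) (by linarith)
  simp only [Pi.mul_apply, Function.comp_apply, smul_eq_mul]
  have h5 : log ‖F z‖ ≤ log⁺ ‖F z‖ := le_max_right _ _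
  have h6 : 0 ≤ log⁺ ‖F z‖ := posLog_nonneg
  calc (herglotzRieszKernel 0 w z).re * log ‖F z‖
      ≤ (herglotzRieszKernel 0 w z).re * log⁺ ‖F z‖ := by gcongr; linarith
    _ ≤ 3 * log⁺ ‖F z‖ := by gcongr; linarith

/-- The mean of `log ‖F‖` over the circle of radius `R` centred at the origin. -/
noncomputable def circleLogMean (R : ℝ) (F : ℂ → ℂ) : ℝ :=
  circleAverage (fun z => log ‖F z‖) 0 R

theorem circleIntegrable_log_norm_of_differentiable {F : ℂ → ℂ} (hF : Differentiable ℂ F) (R : ℝ) :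
    CircleIntegrable (fun z => log ‖F z‖) 0 R :=
  MeromorphicOn.circleIntegrable_log_norm fun z _ => (hF.analyticAt z).meromorphicAt

theorem Differentiable.eventually_codiscreteWithin_ne_zero {F : ℂ → ℂ} (hF : Differentiable ℂ F)
    (hF0 : F ≠ 0) (s : Set ℂ) : ∀ᶠ z in codiscreteWithin s, F z ≠ 0 := by
  have h : AnalyticOnNhd ℂ F univ := fun z _ => hF.analyticAt z
  refine codiscreteWithin_mono (subset_univ s) ?_
  refine (h.eqOn_zero_or_eventually_ne_zero_of_preconnected isPreconnected_univ).resolve_left ?_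
  intro h'
  exact hF0 (funext fun z => h' (mem_univ z))

theorem circleLogMean_mul {F G : ℂ → ℂ} {R : ℝ} (hR : 0 < R) (hF : Differentiable ℂ F)
    (hG : Differentiable ℂ G) (hF0 : F ≠ 0) (hG0 : G ≠ 0) :
    circleLogMean R (fun z => F z * G z) = circleLogMean R F + circleLogMean R G := by
  unfold circleLogMean
  rw [← circleAverage_fun_add (circleIntegrable_log_norm_of_differentiable hF R)
    (circleIntegrable_log_norm_of_differentiable hG R)]
  refine circleAverage_congr_codiscreteWithin ?_ hR.ne'
  filter_upwards [hF.eventually_codiscreteWithin_ne_zero hF0 _,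
    hG.eventually_codiscreteWithin_ne_zero hG0 _] with z h1 h2
  rw [norm_mul, log_mul (norm_ne_zero_iff.2 h1) (norm_ne_zero_iff.2 h2)]

theorem circleLogMean_pow {F : ℂ → ℂ} {R : ℝ} (k : ℕ) :
    circleLogMean R (fun z => F z ^ k) = k * circleLogMean R F := by
  unfold circleLogMean
  rw [← smul_eq_mul, ← circleAverage_fun_smul]
  simp only [norm_pow, log_pow, smul_eq_mul]

theorem circleLogMean_id {R : ℝ} (hR : 0 < R) : circleLogMean R (fun z => z) = log R := by
  unfold circleLogMean
  refine circleAverage_const_on_circle fun z hz => ?_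
  rw [abs_of_pos hR, mem_sphere_zero_iff_norm] at hz
  rw [hz]

theorem circleLogMean_const {R : ℝ} (c : ℂ) : circleLogMean R (fun _ => c) = log ‖c‖ :=
  circleAverage_const _ _ _

theorem Differentiable.mul_ne_zero_of_ne_zero {F G : ℂ → ℂ} (hF : Differentiable ℂ F)
    (hG : Differentiable ℂ G) (hF0 : F ≠ 0) (hG0 : G ≠ 0) : (fun z => F z * G z) ≠ 0 := by
  intro h
  have h1 := hF.eventually_codiscreteWithin_ne_zero hF0 univ
  have h2 := hG.eventually_codiscreteWithin_ne_zero hG0 univ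
  have h3 := (mem_codiscreteWithin_iff_forall_mem_nhdsNE.1 (h1.and h2)) 0 (mem_univ 0)
  simp only [compl_univ, union_empty] at h3
  obtain ⟨z, hz1, hz2⟩ := Filter.nonempty_of_mem h3
  exact mul_ne_zero hz1 hz2 (congrFun h z)

theorem circleLogMean_prod_range {F : ℕ → ℂ → ℂ} {R : ℝ} (hR : 0 < R)
    (hF : ∀ j, Differentiable ℂ (F j)) (hF0 : ∀ j, F j ≠ 0) (n : ℕ) :
    (fun z => ∏ j ∈ Finset.range n, F j z) ≠ 0 ∧
    circleLogMean R (fun z => ∏ j ∈ Finset.range n, F j z)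
      = ∑ j ∈ Finset.range n, circleLogMean R (F j) := by
  induction n with
  | zero =>
    refine ⟨fun h => one_ne_zero (α := ℂ) (by simpa using congrFun h 0), ?_⟩
    simpa using circleLogMean_const (R := R) 1
  | succ n ih =>
    have hd : Differentiable ℂ (fun z => ∏ j ∈ Finset.range n, F j z) :=
      Differentiable.fun_finsetProd fun j _ => hF j
    simp only [Finset.prod_range_succ, Finset.sum_range_succ]
    refine ⟨hd.mul_ne_zero_of_ne_zero (hF n) ih.1 (hF0 n), ?_⟩
    rw [circleLogMean_mul hR hd (hF n) ih.1 (hF0 n), ih.2]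

/-- A nonzero entire function is a power of the variable times an entire function which does not
vanish at the origin. -/
theorem Differentiable.exists_eq_pow_mul {F : ℂ → ℂ} (hF : Differentiable ℂ F) (hF0 : F ≠ 0) :
    ∃ (k : ℕ) (G : ℂ → ℂ), Differentiable ℂ G ∧ G 0 ≠ 0 ∧ (∀ z, F z = z ^ k * G z) ∧
      ∀ N : ℕ, (∀ j < N, iteratedDeriv j F 0 = 0) → N ≤ k := by
  have hA := hF.analyticAt 0
  have htop : analyticOrderAt F 0 ≠ ⊤ := by
    intro h
    rw [analyticOrderAt_eq_top] at h
    apply hF0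
    have h1 : AnalyticOnNhd ℂ F univ := fun z _ => hF.analyticAt z
    exact h1.eq_of_eventuallyEq (fun z _ => analyticAt_const) (g := 0) h
  obtain ⟨k, hk⟩ := ENat.ne_top_iff_exists.1 htop
  obtain ⟨g, hg, hg0, hFg⟩ := (hA.analyticOrderAt_eq_natCast).1 hk.symm
  refine ⟨k, Function.update (fun z => F z / z ^ k) 0 (g 0), ?_, by simpa using hg0, ?_, ?_⟩
  · have hev : Function.update (fun z => F z / z ^ k) 0 (g 0) =ᶠ[𝓝 0] g := by
      filter_upwards [hFg] with z hz
      by_cases hz0 : z = 0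
      · simp [hz0]
      · rw [Function.update_of_ne hz0, hz]
        simp [hz0]
    intro z
    by_cases hz0 : z = 0
    · rw [hz0]
      exact hev.symm.differentiableAt_iff.1 hg.differentiableAt
    · have : (fun z => F z / z ^ k) =ᶠ[𝓝 z] Function.update (fun z => F z / z ^ k) 0 (g 0) := by
        filter_upwards [isOpen_ne.mem_nhds hz0] with y hy
        rw [Function.update_of_ne hy]
      rw [← this.differentiableAt_iff]
      exact (hF z).div (by fun_prop) (pow_ne_zero _ hz0)
  · intro z
    by_cases hz0 : z = 0
    · have := hFg.self_of_nhds
      simpa [hz0] using this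
    · rw [Function.update_of_ne hz0]; field_simp
  · intro N hN
    have := (natCast_le_analyticOrderAt_iff_iteratedDeriv_eq_zero hA).2 hN
    rw [← hk] at this
    exact_mod_cast this

theorem Differentiable.comp_ne_zero_of_not_const {F G : ℂ → ℂ} (hF : Differentiable ℂ F)
    (hG : Differentiable ℂ G) (hF0 : F ≠ 0) (hG0 : ¬ ∃ w, ∀ z, G z = w) :
    (fun z => F (G z)) ≠ 0 := by
  intro h
  have hGa : AnalyticOnNhd ℂ G univ := fun z _ => hG.analyticAt z
  have hFa : AnalyticOnNhd ℂ F univ := fun z _ => hF.analyticAt z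
  rcases hGa.is_constant_or_isOpen isPreconnected_univ with ⟨w, hw⟩ | hop
  · exact hG0 ⟨w, fun z => hw z (mem_univ z)⟩
  · have h1 : G '' univ ∈ 𝓝 (G 0) := (hop univ (subset_univ _) isOpen_univ).mem_nhds
      ⟨0, mem_univ _, rfl⟩
    apply hF0
    refine hFa.eq_of_eventuallyEq (fun z _ => analyticAt_const) (g := 0) (z₀ := G 0) ?_
    filter_upwards [h1] with z hz
    obtain ⟨y, -, rfl⟩ := hz
    exact congrFun h y

theorem Differentiable.comp_ne_zero {F G : ℂ → ℂ} (hF : Differentiable ℂ F)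
    (hG : Differentiable ℂ G) (hF0 : F ≠ 0) (hG0 : G ≠ 0) (hG00 : G 0 = 0) :
    (fun z => F (G z)) ≠ 0 := by
  refine hF.comp_ne_zero_of_not_const hG hF0 ?_
  rintro ⟨w, hw⟩
  exact hG0 (funext fun z => by rw [hw z, ← hw 0, hG00]; rfl)

theorem exists_mul_sub_le_circleLogMean_comp {U : ℂ → ℂ} (hU : Differentiable ℂ U) (hU0 : U ≠ 0) :
    ∃ (m : ℕ) (c : ℝ), 0 ≤ c ∧ (U 0 = 0 → 1 ≤ m) ∧ ∀ R : ℝ, 0 < R → ∀ G : ℂ → ℂ,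
      Differentiable ℂ G → G ≠ 0 → G 0 = 0 →
      m * circleLogMean R G - c ≤ circleLogMean R (fun z => U (G z)) := by
  obtain ⟨m, U₁, hU₁, hU₁0, hUU, -⟩ := hU.exists_eq_pow_mul hU0
  refine ⟨m, |log ‖U₁ 0‖|, abs_nonneg _, ?_, ?_⟩
  · intro h
    by_contra! hm
    have hm0 : m = 0 := by omega
    rw [hUU, hm0] at h
    exact hU₁0 (by simpa using h)
  · intro R hR G hG hG0 hG00
    have h1 : (fun z => U (G z)) = fun z => (G z) ^ m * U₁ (G z) := funext fun z => hUU _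
    have hpow : (fun z => G z ^ m) ≠ 0 := by
      intro h
      refine hG0 (funext fun z => ?_)
      exact eq_zero_of_pow_eq_zero (congrFun h z)
    have hcomp : (fun z => U₁ (G z)) ≠ 0 := by
      intro h
      have := congrFun h 0
      simp only [hG00, Pi.zero_apply] at this
      exact hU₁0 this
    have hd : Differentiable ℂ (fun z => U₁ (G z)) := hU₁.comp hG
    rw [h1, circleLogMean_mul (F := fun z => G z ^ m) hR (hG.pow m) hd hpow hcomp,
      circleLogMean_pow]
    have h2 := log_norm_zero_le_circleAverage hR hd (by simpa [hG00] using hU₁0)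
    simp only [hG00] at h2
    have h3 := neg_abs_le (log ‖U₁ 0‖)
    unfold circleLogMean
    linarith

theorem Differentiable.iterate_ne_zero {g : ℂ → ℂ} (hg : Differentiable ℂ g) (hg0 : g ≠ 0)
    (hg00 : g 0 = 0) (n : ℕ) : g^[n] ≠ 0 := by
  induction n with
  | zero => exact fun h => one_ne_zero (α := ℂ) (congrFun h 1)
  | succ n ih =>
    rw [Function.iterate_succ']
    exact hg.comp_ne_zero (hg.iterate n) hg0 ih (Function.iterate_fixed hg00 n)

theorem exists_neg_mul_le_circleLogMean_iterate {g : ℂ → ℂ} (hg : Differentiable ℂ g)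
    (hg0 : g ≠ 0) (hg00 : g 0 = 0) :
    ∃ c : ℝ, 0 ≤ c ∧ ∀ R : ℝ, exp c ≤ R → ∀ n : ℕ, -(c * n) ≤ circleLogMean R g^[n] := by
  obtain ⟨m, c, hc, hm, h⟩ := exists_mul_sub_le_circleLogMean_comp hg hg0
  refine ⟨c, hc, fun R hR n => ?_⟩
  have hR0 : 0 < R := (exp_pos c).trans_le hR
  have hlog : c ≤ log R := by rwa [le_log_iff_exp_le hR0]
  have hstep : ∀ n : ℕ, m * circleLogMean R g^[n] - c ≤ circleLogMean R g^[n + 1] := by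
    intro n
    rw [Function.iterate_succ']
    exact h R hR0 _ (hg.iterate n) (hg.iterate_ne_zero hg0 hg00 n) (Function.iterate_fixed hg00 n)
  have hzero : circleLogMean R g^[0] = log R := circleLogMean_id hR0
  rcases (hm hg00).eq_or_lt with h1 | h1
  · induction n with
    | zero => rw [hzero]; simp; linarith
    | succ n ih =>
      have := hstep n
      rw [← h1] at this
      push_cast at this ⊢
      linarith
  · have key : c ≤ circleLogMean R g^[n] := by
      induction n with
      | zero => rwa [hzero]
      | succ n ih =>
        have h2 : (2 : ℝ) ≤ m := by exact_mod_cast h1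
        nlinarith [hstep n]
    have : 0 ≤ c * n := by positivity
    linarith

theorem exists_neg_mul_le_circleLogMean_prod_iterate {g U : ℂ → ℂ} (hg : Differentiable ℂ g)
    (hg0 : g ≠ 0) (hg00 : g 0 = 0) (hU : Differentiable ℂ U) (hU0 : U ≠ 0) :
    ∃ K R₀ : ℝ, 0 ≤ K ∧ 0 < R₀ ∧ ∀ R : ℝ, R₀ ≤ R → ∀ n : ℕ,
      -(K * n) ≤ circleLogMean R g^[n] ∧
      -(K * n ^ 2) ≤ circleLogMean R (fun z => ∏ j ∈ Finset.range n, U (g^[j] z)) := by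
  obtain ⟨c, hc, h⟩ := exists_neg_mul_le_circleLogMean_iterate hg hg0 hg00
  obtain ⟨m, c', hc', -, h'⟩ := exists_mul_sub_le_circleLogMean_comp hU hU0
  refine ⟨m * c + c' + c, exp c, by positivity, exp_pos c, fun R hR n => ⟨?_, ?_⟩⟩
  · have h1 := h R hR n
    have h2 : 0 ≤ (m * c + c') * n := by positivity
    linarith
  have hR0 : 0 < R := (exp_pos c).trans_le hR
  rw [(circleLogMean_prod_range (F := fun j z => U (g^[j] z)) hR0
    (fun j => hU.comp (hg.iterate j))
    (fun j => hU.comp_ne_zero (hg.iterate j) hU0 (hg.iterate_ne_zero hg0 hg00 j)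
      (Function.iterate_fixed hg00 j)) n).2]
  have hterm : ∀ j ∈ Finset.range n,
      -((m * c + c' + c) * n) ≤ circleLogMean R (fun z => U (g^[j] z)) := by
    intro j hj
    have hj' : ((j : ℝ) + 1) ≤ n := by exact_mod_cast Finset.mem_range.1 hj
    have h1 := h' R hR0 _ (hg.iterate j) (hg.iterate_ne_zero hg0 hg00 j)
      (Function.iterate_fixed hg00 j)
    have h2 := mul_le_mul_of_nonneg_left (h R hR j) (Nat.cast_nonneg (α := ℝ) m)
    have h3 : m * (c * j) ≤ m * (c * n) := by
      have hjn : (j : ℝ) ≤ n := by linarith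
      gcongr
    have h4 : c' * 1 ≤ c' * n := by
      gcongr
      have : (0:ℝ) ≤ j := Nat.cast_nonneg j
      linarith
    have h5 : 0 ≤ c * n := by positivity
    nlinarith
  have := Finset.card_nsmul_le_sum _ _ _ hterm
  simp only [Finset.card_range, nsmul_eq_mul] at this
  refine le_trans (le_of_eq ?_) this
  ring

section WeightedComposition

variable {V : Type*} [NormedAddCommGroup V] [NormedSpace ℂ V] {ι : V →ₗ[ℂ] (ℂ → ℂ)}

theorem weightedComposition_pow_apply {g U : ℂ → ℂ} {S : V →L[ℂ] V}
    (hS : ∀ h : V, ι (S h) = fun z => U z * ι h (g z)) (n : ℕ) (h : V) :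
    ι ((S ^ n) h) = fun z => (∏ j ∈ Finset.range n, U (g^[j] z)) * ι h (g^[n] z) := by
  induction n with
  | zero => simp
  | succ n ih =>
    rw [pow_succ', mul_apply_eq_comp, hS, ih]
    funext z
    rw [Finset.prod_range_succ']
    simp only [Function.iterate_succ_apply, Function.iterate_zero, id]
    ring

theorem norm_pow_apply_le (S : V →L[ℂ] V) (n : ℕ) (h : V) : ‖(S ^ n) h‖ ≤ ‖S‖ ^ n * ‖h‖ := by
  induction n with
  | zero => simp
  | succ n ih =>
    rw [pow_succ', mul_apply_eq_comp, pow_succ', mul_assoc]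
    exact (S.le_opNorm _).trans (by gcongr)

theorem exists_circleLogMean_pow_apply_le
    (hent : ∀ h : V, Differentiable ℂ (ι h))
    (hbd : ∀ K : Set ℂ, IsCompact K → ∃ C : ℝ, 0 ≤ C ∧ ∀ h : V, ∀ z ∈ K, ‖ι h z‖ ≤ C * ‖h‖)
    (S : V →L[ℂ] V) (R : ℝ) :
    ∃ c : ℝ, 0 ≤ c ∧ ∀ B : ℝ, 0 ≤ B → ∃ C : ℝ, 0 ≤ C ∧ ∀ h : V, ‖h‖ ≤ B → ∀ n : ℕ,
      circleLogMean R (ι ((S ^ n) h)) ≤ c * n + C := by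
  obtain ⟨C₀, hC₀, hC⟩ := hbd (sphere 0 |R|) (isCompact_sphere _ _)
  have hS0 := norm_nonneg S
  refine ⟨log (‖S‖ + 1), log_nonneg (by linarith), fun B hB => ⟨log ((C₀ + 1) * (B + 1)),
    log_nonneg (by nlinarith), fun h hh n => ?_⟩⟩
  refine circleAverage_mono_on_of_le_circle
    (circleIntegrable_log_norm_of_differentiable (hent _) R) fun z hz => ?_
  have h1 : ‖ι ((S ^ n) h) z‖ ≤ (‖S‖ + 1) ^ n * ((C₀ + 1) * (B + 1)) := by
    calc ‖ι ((S ^ n) h) z‖ ≤ C₀ * ‖(S ^ n) h‖ := hC _ z hz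
      _ ≤ C₀ * (‖S‖ ^ n * ‖h‖) := by
        gcongr
        exact norm_pow_apply_le S n h
      _ ≤ (C₀ + 1) * ((‖S‖ + 1) ^ n * (B + 1)) := by gcongr <;> linarith
      _ = _ := by ring
  have hpos : 0 < (‖S‖ + 1) ^ n := by positivity
  have hM : 1 ≤ (‖S‖ + 1) ^ n * ((C₀ + 1) * (B + 1)) := by
    have : 1 ≤ (‖S‖ + 1) ^ n := one_le_pow₀ (by linarith)
    have : 1 ≤ (C₀ + 1) * (B + 1) := by nlinarith
    nlinarith
  have h2 : log ((‖S‖ + 1) ^ n * ((C₀ + 1) * (B + 1)))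
      = log (‖S‖ + 1) * n + log ((C₀ + 1) * (B + 1)) := by
    rw [log_mul hpos.ne' (by positivity), log_pow, mul_comm]
  rw [← h2]
  rcases (norm_nonneg (ι ((S ^ n) h) z)).eq_or_lt with h0 | h0
  · rw [← h0, log_zero]; exact log_nonneg hM
  · exact log_le_log h0 h1

theorem exists_ne_zero_iteratedDeriv_eq_zero (hV : ¬ FiniteDimensional ℂ V)
    (hent : ∀ h : V, Differentiable ℂ (ι h)) (N : ℕ) :
    ∃ h : V, h ≠ 0 ∧ ∀ j < N, iteratedDeriv j (ι h) 0 = 0 := by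
  let L : V →ₗ[ℂ] (Fin N → ℂ) :=
    { toFun := fun h j => iteratedDeriv j (ι h) 0
      map_add' := fun x y => by
        funext j
        rw [map_add, Pi.add_apply]
        exact iteratedDeriv_add ((hent x).contDiff.contDiffAt) ((hent y).contDiff.contDiffAt)
      map_smul' := fun a x => by
        funext j
        rw [map_smul, Pi.smul_apply]
        exact iteratedDeriv_const_smul ((hent x).contDiff.contDiffAt) a }
  by_contra! h
  apply hV
  refine FiniteDimensional.of_injective L ((injective_iff_map_eq_zero L).2 fun x hx => ?_)
  by_contra hx0
  obtain ⟨j, hj, hne⟩ := h x hx0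
  exact hne (congrFun hx ⟨j, hj⟩)

/-- There are nonzero elements of `V` vanishing at the origin to arbitrarily high order. -/
theorem exists_eq_pow_mul_of_not_finiteDimensional (hV : ¬ FiniteDimensional ℂ V)
    (hinj : Function.Injective ι) (hent : ∀ h : V, Differentiable ℂ (ι h)) (N : ℕ) :
    ∃ (h : V) (k : ℕ) (G : ℂ → ℂ), N ≤ k ∧ Differentiable ℂ G ∧ G 0 ≠ 0 ∧
      ∀ z, ι h z = z ^ k * G z := by
  obtain ⟨h, h0, hN⟩ := exists_ne_zero_iteratedDeriv_eq_zero hV hent N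
  have hne : ι h ≠ 0 := (map_ne_zero_iff ι hinj).2 h0
  obtain ⟨k, G, hG, hG0, heq, hk⟩ := (hent h).exists_eq_pow_mul hne
  exact ⟨h, k, G, hk N hN, hG, hG0, heq⟩

end WeightedComposition

/-- If the logarithmic means of `G - w` are bounded uniformly for `w` on a small circle, then `G` is
bounded on a disc. -/
theorem norm_le_exp_of_circleLogMean_sub_le {G : ℂ → ℂ} {R s M : ℝ} (hR : 0 < R) (hs : 0 < s)
    (hs1 : s ≤ 1) (hG : Differentiable ℂ G) (hG00 : G 0 = 0)
    (hM : ∀ w : ℂ, ‖w‖ = s → circleLogMean R (fun z => G z - w) ≤ M)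
    {w : ℂ} (hw : ‖w‖ ≤ R / 2) : ‖G w‖ ≤ exp (3 * (M - log s)) := by
  have hsC : (s : ℂ) ≠ 0 := by exact_mod_cast hs.ne'
  set F : ℂ → ℂ := fun z => G z / s with hF
  have hFd : Differentiable ℂ F := hG.div_const _
  have hFm : Meromorphic F := fun z => (hFd.analyticAt z).meromorphicAt
  have h1 : ∀ a ∈ sphere (0 : ℂ) |1|, circleLogMean R (fun z => F z - a) ≤ M - log s := by
    intro a ha
    rw [abs_one, mem_sphere_zero_iff_norm] at ha
    have hsa : ‖(s : ℂ) * a‖ = s := by simp [ha, abs_of_pos hs]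
    have h2 := hM (s * a) hsa
    have h3 : (fun z => G z - s * a) = fun z => (fun _ => (s : ℂ)) z * (fun z => F z - a) z := by
      funext z
      simp only [hF]
      field_simp
    have ha0 : a ≠ 0 := norm_pos_iff.1 (by rw [ha]; exact one_pos)
    rw [h3, circleLogMean_mul hR (differentiable_const _) (hFd.sub_const a)
      (fun h => hsC (congrFun h 0))
      (fun h => ha0 (by simpa [hF, hG00] using congrFun h 0)), circleLogMean_const] at h2
    simp only [Complex.norm_real, norm_eq_abs, abs_of_pos hs] at h2
    linarith
  have h2 : circleAverage (fun z => log⁺ ‖F z‖) 0 R ≤ M - log s := by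
    have e := congrFun (ValueDistribution.circleAverage_circleAverage_eq_proximity_top hFm) R
    rw [ValueDistribution.proximity_top] at e
    rw [← e]
    exact circleAverage_mono_on_of_le_circle
      (ValueDistribution.circleIntegrable_circleAverage_log_norm_sub hFm) h1
  have h3 := (log_norm_le_three_mul_circleAverage_posLog hR hFd hw).trans
    (mul_le_mul_of_nonneg_left h2 (by norm_num))
  have h4 : ‖F w‖ ≤ exp (3 * (M - log s)) := by
    rcases (norm_nonneg (F w)).eq_or_lt with h0 | h0
    · rw [← h0]; positivity
    · rwa [← log_le_iff_le_exp h0]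
  refine le_trans ?_ h4
  simp only [hF, norm_div, Complex.norm_real, norm_eq_abs, abs_of_pos hs]
  exact le_div_self (norm_nonneg _) hs hs1

section WeightedComposition

variable {V : Type*} [NormedAddCommGroup V] [NormedSpace ℂ V] {ι : V →ₗ[ℂ] (ℂ → ℂ)}

/-- A norm-bounded family of elements of `V` with a prescribed zero on a small circle. -/
theorem exists_bounded_family_eq_sub_mul (hV : ¬ FiniteDimensional ℂ V)
    (hinj : Function.Injective ι) (hent : ∀ h : V, Differentiable ℂ (ι h)) :
    ∃ (s B δ : ℝ) (k : ℕ), 0 < s ∧ s ≤ 1 ∧ 0 ≤ B ∧ 0 < δ ∧ ∀ w : ℂ, ‖w‖ = s →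
      ∃ (h : V) (Q : ℂ → ℂ), ‖h‖ ≤ B ∧ Differentiable ℂ Q ∧ δ ≤ ‖Q 0‖ ∧
        ∀ z, ι h z = z ^ k * ((z - w) * Q z) := by
  obtain ⟨h₁, k, e₁, -, he₁, he₁0, heq₁⟩ :=
    exists_eq_pow_mul_of_not_finiteDimensional hV hinj hent 0
  obtain ⟨h₂, l, e, hl, he, he0, heq₂⟩ :=
    exists_eq_pow_mul_of_not_finiteDimensional hV hinj hent (k + 1)
  obtain ⟨d, rfl⟩ : ∃ d, l = k + (d + 1) := ⟨l - k - 1, by omega⟩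
  have he0' : 0 < ‖e 0‖ := norm_pos_iff.2 he0
  obtain ⟨ε, hε, hεe⟩ := Metric.eventually_nhds_iff_ball.1
    ((he.continuous.norm.tendsto 0).eventually (lt_mem_nhds (half_lt_self he0')))
  set s := min (ε / 2) 1 with hs
  have hs0 : 0 < s := lt_min (by linarith) one_pos
  have hs1 : s ≤ 1 := min_le_right _ _
  have hsε : s < ε := (min_le_left _ _).trans_lt (by linarith)
  set e₂ : ℂ → ℂ := fun z => z ^ (d + 1) * e z with he₂
  have he₂d : Differentiable ℂ e₂ := by fun_prop
  obtain ⟨M₁, hM₁⟩ := (isCompact_sphere (0 : ℂ) s).exists_bound_of_continuousOn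
    he₁.continuous.continuousOn
  obtain ⟨M₂, hM₂⟩ := (isCompact_sphere (0 : ℂ) s).exists_bound_of_continuousOn
    he₂d.continuous.continuousOn
  refine ⟨s, |M₂| * ‖h₁‖ + |M₁| * ‖h₂‖, s ^ (d + 1) * (‖e 0‖ / 2) * ‖e₁ 0‖, k, hs0, hs1,
    by positivity, by positivity, fun w hw => ?_⟩
  set φ : ℂ → ℂ := fun z => e₂ w * e₁ z - e₁ w * e₂ z with hφ
  have hφd : Differentiable ℂ φ := by fun_prop
  have hφw : φ w = 0 := by simp only [hφ]; ring
  have hQ : Differentiable ℂ (dslope φ w) := by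
    rw [← differentiableOn_univ, Complex.differentiableOn_dslope univ_mem, differentiableOn_univ]
    exact hφd
  have hQeq : ∀ z, (z - w) * dslope φ w z = φ z := fun z => by
    have := sub_smul_dslope φ w z
    rwa [smul_eq_mul, hφw, sub_zero] at this
  have hws : w ∈ sphere (0 : ℂ) s := mem_sphere_zero_iff_norm.2 hw
  refine ⟨e₂ w • h₁ - e₁ w • h₂, dslope φ w, ?_, hQ, ?_, fun z => ?_⟩
  · refine (norm_sub_le _ _).trans ?_
    rw [norm_smul, norm_smul]
    gcongr
    · exact (hM₂ w hws).trans (le_abs_self _)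
    · exact (hM₁ w hws).trans (le_abs_self _)
  · have h0 := congrArg norm (hQeq 0)
    have h1 : φ 0 = w ^ (d + 1) * e w * e₁ 0 := by simp [hφ, he₂]
    rw [h1, norm_mul, norm_mul, norm_mul, norm_pow, zero_sub, norm_neg, hw] at h0
    have h2 : ‖e 0‖ / 2 ≤ ‖e w‖ := (hεe w (by rw [mem_ball_zero_iff, hw]; exact hsε)).le
    calc s ^ (d + 1) * (‖e 0‖ / 2) * ‖e₁ 0‖ ≤ s ^ (d + 1) * ‖e w‖ * ‖e₁ 0‖ := by gcongr
      _ = s * ‖dslope φ w 0‖ := h0.symm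
      _ ≤ ‖dslope φ w 0‖ := mul_le_of_le_one_left (norm_nonneg _) hs1
  · rw [hQeq, map_sub, map_smul, map_smul]
    simp only [Pi.sub_apply, Pi.smul_apply, smul_eq_mul, heq₁, heq₂, hφ, he₂]
    ring

theorem exists_norm_iterate_le_exp_sq (hV : ¬ FiniteDimensional ℂ V)
    (hinj : Function.Injective ι) (hent : ∀ h : V, Differentiable ℂ (ι h))
    (hbd : ∀ K : Set ℂ, IsCompact K → ∃ C : ℝ, 0 ≤ C ∧ ∀ h : V, ∀ z ∈ K, ‖ι h z‖ ≤ C * ‖h‖)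
    {g U : ℂ → ℂ} (hg : Differentiable ℂ g) (hg0 : g ≠ 0) (hg00 : g 0 = 0)
    (hU : Differentiable ℂ U) (hU0 : U ≠ 0) (S : V →L[ℂ] V)
    (hS : ∀ h : V, ι (S h) = fun z => U z * ι h (g z)) :
    ∃ R₀ : ℝ, ∀ R : ℝ, R₀ ≤ R → ∃ K : ℝ, ∀ (n : ℕ) (w : ℂ), ‖w‖ ≤ R / 2 →
      ‖g^[n] w‖ ≤ exp (K * (n ^ 2 + 1)) := by
  obtain ⟨K, R₀, hK, hR₀, hlow⟩ := exists_neg_mul_le_circleLogMean_prod_iterate hg hg0 hg00 hU hU0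
  obtain ⟨s, B, δ, k, hs, hs1, hB, hδ, hfam⟩ := exists_bounded_family_eq_sub_mul hV hinj hent
  refine ⟨R₀, fun R hR => ?_⟩
  have hR0 : 0 < R := hR₀.trans_le hR
  obtain ⟨c, hc, hup⟩ := exists_circleLogMean_pow_apply_le hent hbd S R
  obtain ⟨C, hC, hup⟩ := hup B hB
  refine ⟨3 * (c + C + K + k * K + |log δ| + |log s|), fun n w hw => ?_⟩
  have hGd := hg.iterate n
  have hGne := hg.iterate_ne_zero hg0 hg00 n
  have hG00 : g^[n] 0 = 0 := Function.iterate_fixed hg00 n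
  have hprod := (circleLogMean_prod_range (F := fun j z => U (g^[j] z)) hR0
    (fun j => hU.comp (hg.iterate j))
    (fun j => hU.comp_ne_zero (hg.iterate j) hU0 (hg.iterate_ne_zero hg0 hg00 j)
      (Function.iterate_fixed hg00 j)) n).1
  have hprodd : Differentiable ℂ (fun z => ∏ j ∈ Finset.range n, U (g^[j] z)) :=
    Differentiable.fun_finsetProd fun j _ => hU.comp (hg.iterate j)
  have hmean : ∀ w : ℂ, ‖w‖ = s → circleLogMean R (fun z => g^[n] z - w) ≤
      c * n + C + K * n ^ 2 + k * (K * n) + |log δ| := by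
    intro w hw
    obtain ⟨h, Q, hhB, hQ, hQ0, hh⟩ := hfam w hw
    have h1 := hup h hhB n
    have hw0 : w ≠ 0 := norm_pos_iff.1 (by rw [hw]; exact hs)
    have hsubne : (fun z => g^[n] z - w) ≠ 0 := fun h0 =>
      hw0 (by simpa [hG00] using congrFun h0 0)
    have hsubd : Differentiable ℂ (fun z => g^[n] z - w) := hGd.sub_const w
    have hQne : (fun z => Q (g^[n] z)) ≠ 0 := fun h0 => by
      have := congrFun h0 0
      simp only [hG00, Pi.zero_apply] at this
      rw [this, norm_zero] at hQ0
      linarith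
    have hQd : Differentiable ℂ (fun z => Q (g^[n] z)) := hQ.comp hGd
    have hpowne : (fun z => g^[n] z ^ k) ≠ 0 := fun h0 =>
      hGne (funext fun z => eq_zero_of_pow_eq_zero (congrFun h0 z))
    have hsQd : Differentiable ℂ (fun z => (g^[n] z - w) * Q (g^[n] z)) := hsubd.mul hQd
    have hsQne := hsubd.mul_ne_zero_of_ne_zero hQd hsubne hQne
    rw [weightedComposition_pow_apply hS] at h1
    simp only [hh] at h1
    rw [circleLogMean_mul (G := fun z => g^[n] z ^ k * ((g^[n] z - w) * Q (g^[n] z))) hR0 hprodd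
        ((hGd.pow k).mul hsQd) hprod
        (Differentiable.mul_ne_zero_of_ne_zero (F := fun z => g^[n] z ^ k) (hGd.pow k)
          hsQd hpowne hsQne),
      circleLogMean_mul (F := fun z => g^[n] z ^ k) hR0 (hGd.pow k) hsQd hpowne
        hsQne,
      circleLogMean_mul hR0 hsubd hQd hsubne hQne, circleLogMean_pow] at h1
    have h2 := log_norm_zero_le_circleAverage hR0 hQd (by
      rw [hG00]; exact norm_pos_iff.1 (hδ.trans_le hQ0))
    rw [hG00] at h2
    have h3 : log δ ≤ circleLogMean R (fun z => Q (g^[n] z)) := (log_le_log hδ hQ0).trans h2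
    have h4 := neg_abs_le (log δ)
    obtain ⟨h5, h6⟩ := hlow R hR n
    have h7 := mul_le_mul_of_nonneg_left h5 (Nat.cast_nonneg (α := ℝ) k)
    linarith
  refine (norm_le_exp_of_circleLogMean_sub_le hR0 hs hs1 hGd hG00 hmean hw).trans ?_
  rw [exp_le_exp]
  have hn : (0 : ℝ) ≤ n := Nat.cast_nonneg n
  have hn1 : (n : ℝ) ≤ n ^ 2 + 1 := by nlinarith [sq_nonneg ((n : ℝ) - 1)]
  have hn2 : (1 : ℝ) ≤ n ^ 2 + 1 := by nlinarith
  have a1 := mul_le_mul_of_nonneg_left hn1 hc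
  have a2 := mul_le_mul_of_nonneg_left hn2 hC
  have a3 : K * n ^ 2 ≤ K * (n ^ 2 + 1) := by nlinarith
  have a4 : k * (K * n) ≤ k * (K * (n ^ 2 + 1)) := by gcongr
  have a5 := mul_le_mul_of_nonneg_left hn2 (abs_nonneg (log δ))
  have a6 := mul_le_mul_of_nonneg_left hn2 (abs_nonneg (log s))
  have a7 := neg_abs_le (log s)
  linarith

end WeightedComposition

theorem sq_add_one_le_four_mul_two_pow (n : ℕ) : n ^ 2 + 1 ≤ 4 * 2 ^ n := by
  induction n with
  | zero => norm_num
  | succ n ih =>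
    have h : n + 1 ≤ 2 ^ n := Nat.lt_two_pow_self
    rw [pow_succ 2 n]
    nlinarith

section WeightedComposition

variable {V : Type*} [NormedAddCommGroup V] [NormedSpace ℂ V] {ι : V →ₗ[ℂ] (ℂ → ℂ)}

/-- A bounded weighted composition operator on an infinite-dimensional space cannot have an
expanding linear symbol. -/
theorem norm_le_one_of_weightedComposition_mul (hV : ¬ FiniteDimensional ℂ V)
    (hinj : Function.Injective ι) (hent : ∀ h : V, Differentiable ℂ (ι h))
    (hbd : ∀ K : Set ℂ, IsCompact K → ∃ C : ℝ, 0 ≤ C ∧ ∀ h : V, ∀ z ∈ K, ‖ι h z‖ ≤ C * ‖h‖)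
    {a : ℂ} {U : ℂ → ℂ} (hU : Differentiable ℂ U) (hU0 : U ≠ 0) (S : V →L[ℂ] V)
    (hS : ∀ h : V, ι (S h) = fun z => U z * ι h (a * z)) : ‖a‖ ≤ 1 := by
  by_contra! ha
  have ha0 : a ≠ 0 := norm_pos_iff.1 (by linarith)
  have hL : 0 < log ‖a‖ := log_pos ha
  set g : ℂ → ℂ := fun z => a * z with hgdef
  have hg : Differentiable ℂ g := by fun_prop
  have hg0 : g ≠ 0 := fun h => ha0 (by simpa [hgdef] using congrFun h 1)
  have hg00 : g 0 = 0 := by simp [hgdef]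
  have hiter : ∀ n : ℕ, g^[n] = fun z => a ^ n * z := by
    intro n
    induction n with
    | zero => funext z; simp
    | succ n ih => rw [Function.iterate_succ', ih]; funext z; simp only [Function.comp, hgdef]; ring
  have hmean : ∀ n : ℕ, circleLogMean 1 g^[n] = n * log ‖a‖ := by
    intro n
    rw [hiter, circleLogMean_mul (F := fun _ => a ^ n) (G := fun z => z) one_pos
      (differentiable_const _) differentiable_id (fun h => pow_ne_zero n ha0 (congrFun h 0))
      (fun h => one_ne_zero (α := ℂ) (congrFun h 1)), circleLogMean_const,
      circleLogMean_id one_pos, norm_pow, log_pow, log_one, add_zero]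
  obtain ⟨m, c', hc', -, hlow⟩ := exists_mul_sub_le_circleLogMean_comp hU hU0
  obtain ⟨c, hc, hup⟩ := exists_circleLogMean_pow_apply_le hent hbd S 1
  obtain ⟨N, hN⟩ := exists_nat_gt ((c + c') / log ‖a‖)
  rw [div_lt_iff₀ hL] at hN
  obtain ⟨h, k, G, hk, hG, hG0, heq⟩ :=
    exists_eq_pow_mul_of_not_finiteDimensional hV hinj hent N
  obtain ⟨C, hC, hup⟩ := hup ‖h‖ (norm_nonneg _)
  have hNk : (N : ℝ) * log ‖a‖ ≤ k * log ‖a‖ := by gcongr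
  have key : ∀ n : ℕ, n * (k * log ‖a‖ - (c + c')) ≤ C - log ‖G 0‖ := by
    intro n
    have hGd := hg.iterate n
    have hGne := hg.iterate_ne_zero hg0 hg00 n
    have hG00 : g^[n] 0 = 0 := Function.iterate_fixed hg00 n
    obtain ⟨hprod, hsum⟩ := circleLogMean_prod_range (F := fun j z => U (g^[j] z)) one_pos
      (fun j => hU.comp (hg.iterate j))
      (fun j => hU.comp_ne_zero (hg.iterate j) hU0 (hg.iterate_ne_zero hg0 hg00 j)
        (Function.iterate_fixed hg00 j)) n
    have hprodd : Differentiable ℂ (fun z => ∏ j ∈ Finset.range n, U (g^[j] z)) :=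
      Differentiable.fun_finsetProd fun j _ => hU.comp (hg.iterate j)
    have hterm : ∀ j ∈ Finset.range n, -c' ≤ circleLogMean 1 (fun z => U (g^[j] z)) := by
      intro j _
      have h1 := hlow 1 one_pos _ (hg.iterate j) (hg.iterate_ne_zero hg0 hg00 j)
        (Function.iterate_fixed hg00 j)
      rw [hmean] at h1
      have : 0 ≤ (m : ℝ) * (j * log ‖a‖) := by positivity
      linarith
    have hsum' := Finset.card_nsmul_le_sum _ _ _ hterm
    rw [← hsum] at hsum'
    simp only [Finset.card_range, nsmul_eq_mul] at hsum'
    have h1 := hup h le_rfl n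
    have hcompd : Differentiable ℂ (fun z => G (g^[n] z)) := hG.comp hGd
    have hcompne : (fun z => G (g^[n] z)) ≠ 0 := fun h0 => by
      have := congrFun h0 0
      simp only [hG00, Pi.zero_apply] at this
      exact hG0 this
    have hpowne : (fun z => g^[n] z ^ k) ≠ 0 := fun h0 =>
      hGne (funext fun z => eq_zero_of_pow_eq_zero (congrFun h0 z))
    have hpowd : Differentiable ℂ (fun z => g^[n] z ^ k) := hGd.pow k
    rw [weightedComposition_pow_apply (g := g) hS] at h1
    simp only [heq] at h1
    rw [circleLogMean_mul (G := fun z => g^[n] z ^ k * G (g^[n] z)) one_pos hprodd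
        (hpowd.mul hcompd) hprod (hpowd.mul_ne_zero_of_ne_zero hcompd hpowne hcompne),
      circleLogMean_mul one_pos hpowd hcompd hpowne hcompne, circleLogMean_pow, hmean] at h1
    have h2 := log_norm_zero_le_circleAverage one_pos hcompd (by rwa [hG00])
    rw [hG00] at h2
    unfold circleLogMean at h1 hsum'
    linarith
  obtain ⟨n, hn⟩ := exists_nat_gt ((C - log ‖G 0‖) / (k * log ‖a‖ - (c + c')))
  rw [div_lt_iff₀ (by linarith)] at hn
  linarith [key n]

/-- A bounded weighted composition operator on an infinite-dimensional space whose symbol has the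
origin as a point of period at most two has affine symbol. -/
theorem exists_affine_of_weightedComposition_of_comp_self_zero (hV : ¬ FiniteDimensional ℂ V)
    (hinj : Function.Injective ι) (hent : ∀ h : V, Differentiable ℂ (ι h))
    (hbd : ∀ K : Set ℂ, IsCompact K → ∃ C : ℝ, 0 ≤ C ∧ ∀ h : V, ∀ z ∈ K, ‖ι h z‖ ≤ C * ‖h‖)
    {f u : ℂ → ℂ} (hf : Differentiable ℂ f) (hff : f (f 0) = 0) (hu : Differentiable ℂ u)
    (hu0 : u ≠ 0) (T : V →L[ℂ] V) (hT : ∀ h : V, ι (T h) = fun z => u z * ι h (f z)) :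
    ∃ a b : ℂ, ∀ z, f z = a * z + b := by
  by_contra hna
  have hconst : ¬ ∃ w, ∀ z, f z = w := fun ⟨w, hw⟩ => hna ⟨0, w, fun z => by rw [hw]; ring⟩
  have hf0 : f ≠ 0 := fun h => hconst ⟨0, fun z => congrFun h z⟩
  obtain ⟨R₁, hR₁⟩ := hf.exists_exp_two_pow_le_norm_iterate hna
  obtain ⟨R₀, hR₀⟩ := exists_norm_iterate_le_exp_sq (g := f^[2]) (U := fun z => u z * u (f z))
    hV hinj hent hbd (hf.iterate 2) (hf.comp_ne_zero_of_not_const hf hf0 hconst) hff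
    (hu.mul (hu.comp hf)) (hu.mul_ne_zero_of_ne_zero (hu.comp hf) hu0
      (hu.comp_ne_zero_of_not_const hf hu0 hconst)) (T.comp T) (fun h => by
        rw [ContinuousLinearMap.comp_apply, hT, hT]
        funext z
        simp only [Function.iterate_succ_apply, Function.iterate_zero, id]
        ring)
  obtain ⟨K, hK⟩ := hR₀ (max R₀ (2 * R₁)) (le_max_left _ _)
  have key : ∀ n : ℕ, (2 : ℝ) ^ n ≤ 4 * |K| := by
    intro n
    obtain ⟨z, hz, hz'⟩ := hR₁ _ le_rfl (2 * n)
    have h1 := hK n z (hz.trans (by linarith [le_max_right R₀ (2 * R₁)]))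
    rw [← Function.iterate_mul] at h1
    have h2 := exp_le_exp.1 (hz'.trans h1)
    have h3 : ((n : ℝ) ^ 2 + 1) ≤ 4 * 2 ^ n := by exact_mod_cast sq_add_one_le_four_mul_two_pow n
    have h4 : (2 : ℝ) ^ n * 2 ^ n ≤ 4 * |K| * 2 ^ n := by
      calc (2 : ℝ) ^ n * 2 ^ n = 2 ^ (2 * n) := by rw [← pow_add, two_mul]
        _ ≤ K * (n ^ 2 + 1) := h2
        _ ≤ |K| * (n ^ 2 + 1) := by gcongr; exact le_abs_self K
        _ ≤ |K| * (4 * 2 ^ n) := by gcongr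
        _ = _ := by ring
    exact le_of_mul_le_mul_right h4 (by positivity)
  obtain ⟨n, hn⟩ := pow_unbounded_of_one_lt (4 * |K|) (one_lt_two (α := ℝ))
  linarith [key n]

/-- Translating the variable conjugates the symbol of a weighted composition operator. -/
theorem exists_weightedComposition_translate
    (hinj : Function.Injective ι) (hent : ∀ h : V, Differentiable ℂ (ι h))
    (hbd : ∀ K : Set ℂ, IsCompact K → ∃ C : ℝ, 0 ≤ C ∧ ∀ h : V, ∀ z ∈ K, ‖ι h z‖ ≤ C * ‖h‖)
    {f u : ℂ → ℂ} {T : V →L[ℂ] V} (hT : ∀ h : V, ι (T h) = fun z => u z * ι h (f z)) (p : ℂ) :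
    ∃ ι' : V →ₗ[ℂ] (ℂ → ℂ), Function.Injective ι' ∧ (∀ h : V, Differentiable ℂ (ι' h)) ∧
      (∀ K : Set ℂ, IsCompact K → ∃ C : ℝ, 0 ≤ C ∧ ∀ h : V, ∀ z ∈ K, ‖ι' h z‖ ≤ C * ‖h‖) ∧
      ∀ h : V, ι' (T h) = fun z => u (z + p) * ι' h (f (z + p) - p) := by
  refine ⟨(LinearMap.funLeft ℂ ℂ (fun z => z + p)).comp ι, ?_, fun h => ?_, fun K hK => ?_,
    fun h => ?_⟩
  · exact (LinearMap.funLeft_injective_of_surjective ℂ ℂ _ (add_right_surjective p)).comp hinj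
  · exact (hent h).comp (differentiable_id.add_const p)
  · obtain ⟨C, hC, h⟩ := hbd _ (hK.image (continuous_add_const p))
    exact ⟨C, hC, fun v z hz => h v _ (mem_image_of_mem _ hz)⟩
  · funext z
    simp [LinearMap.funLeft_apply, hT]

end WeightedComposition

end CircleMeans

/-- if `V` is an infinite-dimensional complex Banach space continuously
included in the entire functions on ℂ and the weighted composition operator `uC_f`
(with `u` a nonzero entire function) is bounded on `V`, then `f(z) = a z + b` with
`|a| ≤ 1`. -/
theorem bounded_weighted_composition_symbol_affine
    {V : Type*} [NormedAddCommGroup V] [NormedSpace ℂ V] [CompleteSpace V]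
    (hV : ¬ FiniteDimensional ℂ V)
    (ι : V →ₗ[ℂ] (ℂ → ℂ)) (hinj : Function.Injective ι)
    (hent : ∀ h : V, Differentiable ℂ (ι h))
    (hbd : ∀ K : Set ℂ, IsCompact K →
      ∃ C : ℝ, 0 ≤ C ∧ ∀ h : V, ∀ z ∈ K, ‖ι h z‖ ≤ C * ‖h‖)
    (f : ℂ → ℂ) (hf : Differentiable ℂ f)
    (u : ℂ → ℂ) (hu : Differentiable ℂ u) (hu0 : u ≠ 0)
    (T : V →L[ℂ] V) (hT : ∀ h : V, ι (T h) = fun z => u z * ι h (f z)) :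
    ∃ a b : ℂ, ‖a‖ ≤ 1 ∧ ∀ z : ℂ, f z = a * z + b := by
  have hu' : ∀ p : ℂ, Differentiable ℂ (fun z => u (z + p)) := fun p =>
    hu.comp (differentiable_id.add_const p)
  have hu0' : ∀ p : ℂ, (fun z => u (z + p)) ≠ 0 := fun p h =>
    hu0 (funext fun z => by simpa using congrFun h (z - p))
  have haff : ∃ a b : ℂ, ∀ z, f z = a * z + b := by
    by_contra hna
    obtain ⟨p, hp⟩ := exists_comp_self_fixed hf hna
    obtain ⟨ι', hinj', hent', hbd', hT'⟩ := exists_weightedComposition_translate hinj hent hbd hT p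
    obtain ⟨a, b, hab⟩ := exists_affine_of_weightedComposition_of_comp_self_zero
      (f := fun z => f (z + p) - p) hV hinj' hent' hbd'
      ((hf.comp (differentiable_id.add_const p)).sub_const p) (by simp [hp]) (hu' p) (hu0' p) T hT'
    refine hna ⟨a, b + p - a * p, fun z => ?_⟩
    have := hab (z - p)
    rw [sub_add_cancel] at this
    linear_combination this
  obtain ⟨a, b, hab⟩ := haff
  refine ⟨a, b, ?_, hab⟩
  by_contra! ha
  have ha1 : 1 - a ≠ 0 := fun h => by
    rw [← sub_eq_zero.1 h, norm_one] at ha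
    exact lt_irrefl _ ha
  obtain ⟨ι', hinj', hent', hbd', hT'⟩ :=
    exists_weightedComposition_translate hinj hent hbd hT (b / (1 - a))
  refine ha.not_ge (norm_le_one_of_weightedComposition_mul hV hinj' hent' hbd'
    (hu' (b / (1 - a))) (hu0' (b / (1 - a))) T fun h => ?_)
  rw [hT']
  funext z
  have hz : f (z + b / (1 - a)) - b / (1 - a) = a * z := by
    rw [hab]
    field_simp
    ring
  rw [hz]
end

section
/- Let V be a complex Banach space with an injective linear map ι into the entire functions on ℂ² satisfying the continuous-inclusion bounds. Assume: (1) Assumption (II) holds for (V, p) for every p ∈ ℂ²; and (2) the ℂ-linear span of G₂(V) inside the 2×2 complex matrices is all of M₂(ℂ), where G₂(V) is the set of invertible 2×2 complex matrices A for which there exist b ∈ ℂ² and an entire function w : ℂ² → ℂ such that the weighted composition operator with weight exp∘w and symbol z ↦ A z + b is bounded on V. Let f : ℂ² → ℂ² be a polynomial automorphism. If there exists an entire nonvanishing u : ℂ² → ℂ such that the weighted composition operator uC_f is bounded on V, then f is affine. -/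
section

open Set Filter Topology

/-- Cauchy estimate for the derivative of an entire function of several variables. -/
theorem norm_fderiv_le_of_forall_mem_closedBall_norm_le {E : Type*} [NormedAddCommGroup E]
    [NormedSpace ℂ E] {F : E → ℂ} (hF : Differentiable ℂ F) {z : E} {C : ℝ}
    (hC : ∀ y ∈ Metric.closedBall z 1, ‖F y‖ ≤ C) : ‖fderiv ℂ F z‖ ≤ C := by
  have hC0 : 0 ≤ C := (norm_nonneg _).trans (hC z (by simp))
  refine ContinuousLinearMap.opNorm_le_of_unit_norm (𝕜 := ℂ) hC0 fun e he => ?_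
  have hd : ∀ t : ℂ, HasDerivAt (fun t : ℂ => F (z + t • e)) (fderiv ℂ F (z + t • e) e) t := by
    intro t
    have h1 : HasDerivAt (fun t : ℂ => z + t • e) e t := by
      simpa using ((hasDerivAt_id t).smul_const e).const_add z
    exact (hF (z + t • e)).hasFDerivAt.comp_hasDerivAt t h1
  have h2 := Complex.norm_deriv_le_of_forall_mem_sphere_norm_le (c := 0) (R := 1) (C := C)
    (f := fun t : ℂ => F (z + t • e)) one_pos
    (Differentiable.diffContOnCl fun t => (hd t).differentiableAt) (by
      intro t ht
      refine hC _ ?_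
      have : ‖t‖ = 1 := by simpa using ht
      simp [norm_smul, this, he])
  rw [(hd 0).deriv] at h2
  simpa using h2

theorem differentiable_fderiv_apply_of_differentiable {F : (Fin 2 → ℂ) → ℂ}
    (hF : Differentiable ℂ F) (e : Fin 2 → ℂ) :
    Differentiable ℂ fun z => fderiv ℂ F z e := by
  have hd : ∀ z, ∀ t : ℂ,
      HasDerivAt (fun t : ℂ => F (z + t • e)) (fderiv ℂ F (z + t • e) e) t := by
    intro z t
    have h1 : HasDerivAt (fun t : ℂ => z + t • e) e t := by
      simpa using ((hasDerivAt_id t).smul_const e).const_add z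
    exact (hF (z + t • e)).hasFDerivAt.comp_hasDerivAt t h1
  have hrep : ∀ z, fderiv ℂ F z e =
      (2 * Real.pi * Complex.I : ℂ)⁻¹ •
        ∮ ζ in C(0, 1), (1 / (ζ - 0) ^ 2) • F (z + ζ • e) := by
    intro z
    have := DiffContOnCl.deriv_eq_smul_circleIntegral (c := 0) (R := 1)
      (f := fun t : ℂ => F (z + t • e)) one_pos
      (Differentiable.diffContOnCl fun t => (hd z t).differentiableAt)
    rw [this, inv_smul_smul₀ Complex.two_pi_I_ne_zero, (hd z 0).deriv]
    simp
  intro z₀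
  rw [show (fun z => fderiv ℂ F z e) = fun z => (2 * Real.pi * Complex.I : ℂ)⁻¹ •
      ∮ ζ in C(0, 1), (1 / (ζ - 0) ^ 2) • F (z + ζ • e) from funext hrep]
  refine DifferentiableAt.fun_const_smul ?_ _
  obtain ⟨C, hC⟩ := (isCompact_closedBall z₀ (2 + ‖e‖)).exists_bound_of_continuousOn
    hF.continuous.continuousOn
  have hcm : Continuous (circleMap 0 1) := continuous_circleMap 0 1
  have hc1 : ∀ θ, ‖circleMap 0 1 θ‖ = 1 := by simp
  have hc0 : ∀ θ, circleMap 0 1 θ - 0 ≠ 0 := fun θ h => by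
    have := hc1 θ
    rw [sub_zero] at h
    simp [h] at this
  have hker : Continuous fun θ : ℝ =>
      deriv (circleMap 0 1) θ * (1 / (circleMap 0 1 θ - 0) ^ 2) := by
    simp only [deriv_circleMap]
    exact (hcm.mul continuous_const).mul
      (continuous_const.div ((hcm.sub continuous_const).pow 2) fun θ => pow_ne_zero 2 (hc0 θ))
  have hkey := intervalIntegral.hasFDerivAt_integral_of_dominated_of_fderiv_le (𝕜 := ℂ)
    (μ := MeasureTheory.volume) (a := 0) (b := 2 * Real.pi) (x₀ := z₀)
    (s := Metric.ball z₀ 1) (bound := fun _ => C)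
    (F := fun z θ => (deriv (circleMap 0 1) θ * (1 / (circleMap 0 1 θ - 0) ^ 2)) •
      F (z + circleMap 0 1 θ • e))
    (F' := fun z θ => (deriv (circleMap 0 1) θ * (1 / (circleMap 0 1 θ - 0) ^ 2)) •
      fderiv ℂ F (z + circleMap 0 1 θ • e))
    (Metric.ball_mem_nhds _ one_pos) ?_ ?_ ?_ ?_ ?_ ?_
  · have := hkey.differentiableAt
    simpa only [circleIntegral, smul_smul] using this
  · refine Eventually.of_forall fun z => ?_
    exact (hker.smul (hF.continuous.comp
      (continuous_const.add (hcm.smul continuous_const)))).aestronglyMeasurable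
  · exact (hker.smul (hF.continuous.comp
      (continuous_const.add (hcm.smul continuous_const)))).intervalIntegrable _ _
  · refine MeasureTheory.AEStronglyMeasurable.smul hker.aestronglyMeasurable ?_
    exact ((measurable_fderiv ℂ F).comp
      (continuous_const.add (hcm.smul continuous_const)).measurable).aestronglyMeasurable
  · refine Eventually.of_forall fun θ _ z hz => ?_
    rw [norm_smul, norm_mul, norm_div, norm_pow, deriv_circleMap, sub_zero, norm_mul, hc1]
    simp only [Complex.norm_I, norm_one, mul_one, one_pow, div_one, one_mul]
    refine norm_fderiv_le_of_forall_mem_closedBall_norm_le hF fun y hy => hC y ?_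
    rw [mem_closedBall_iff_norm] at hy ⊢
    rw [mem_ball_iff_norm] at hz
    calc ‖y - z₀‖ = ‖(y - (z + circleMap 0 1 θ • e)) + (z - z₀) + circleMap 0 1 θ • e‖ := by
          congr 1; abel
      _ ≤ ‖y - (z + circleMap 0 1 θ • e)‖ + ‖z - z₀‖ + ‖circleMap 0 1 θ • e‖ := norm_add₃_le
      _ ≤ 2 + ‖e‖ := by rw [norm_smul, hc1]; linarith
  · exact intervalIntegrable_const
  · refine Eventually.of_forall fun θ _ z _ => ?_
    have h1 : HasFDerivAt (fun z => F (z + circleMap 0 1 θ • e))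
        (fderiv ℂ F (z + circleMap 0 1 θ • e)) z := by
      have := (hF (z + circleMap 0 1 θ • e)).hasFDerivAt.comp z
        ((hasFDerivAt_id (𝕜 := ℂ) z).add_const (circleMap 0 1 θ • e))
      rw [ContinuousLinearMap.comp_id] at this
      exact this
    exact h1.fun_const_smul _

theorem contDiff_nat_of_differentiable {F : (Fin 2 → ℂ) → ℂ} (hF : Differentiable ℂ F) (n : ℕ) :
    ContDiff ℂ n F := by
  induction n generalizing F with
  | zero => exact contDiff_zero.2 hF.continuous
  | succ n ih =>
    rw [Nat.cast_succ, contDiff_succ_iff_fderiv_apply]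
    exact ⟨hF, fun h => absurd h (by simp),
      fun y => ih (differentiable_fderiv_apply_of_differentiable hF y)⟩

/-- A function whose derivatives of order at most `n` vanish at `p` is `O(‖z - p‖ ^ (n + 1))`. -/
theorem isBigO_pow_of_iteratedFDeriv_eq_zero {F : (Fin 2 → ℂ) → ℂ} (hF : Differentiable ℂ F)
    {p : Fin 2 → ℂ} {n : ℕ} (h0 : ∀ k < n + 1, iteratedFDeriv ℂ k F p = 0) :
    F =O[𝓝 p] fun z => ‖z - p‖ ^ (n + 1) := by
  have hdiff : ∀ k, Differentiable ℂ (iteratedFDeriv ℂ k F) := fun k =>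
    (contDiff_nat_of_differentiable hF (k + 1)).differentiable_iteratedFDeriv
      (by exact_mod_cast Nat.lt_succ_self k)
  have key : ∀ j ≤ n, iteratedFDeriv ℂ (n - j) F =O[𝓝 p] fun z => ‖z - p‖ ^ (j + 1) := by
    intro j
    induction j with
    | zero =>
      intro _
      have := (hdiff n p).hasFDerivAt.isBigO_sub
      rw [h0 n (by omega)] at this
      simpa using this.norm_right
    | succ j ih =>
      intro hj
      obtain ⟨C, hC0, hC⟩ := (ih (by omega)).exists_nonneg
      rw [Asymptotics.isBigOWith_iff] at hC
      obtain ⟨r, hr, hball⟩ := Metric.eventually_nhds_iff_ball.1 hC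
      refine Asymptotics.IsBigO.of_bound C ?_
      filter_upwards [Metric.ball_mem_nhds p hr] with z hz
      have hz' : ‖z - p‖ < r := by simpa [dist_eq_norm] using hz
      have hmv := Convex.norm_image_sub_le_of_norm_fderiv_le (𝕜 := ℂ)
        (f := iteratedFDeriv ℂ (n - (j + 1)) F) (C := C * ‖z - p‖ ^ (j + 1))
        (s := Metric.closedBall p ‖z - p‖) (x := p) (y := z)
        (fun x _ => hdiff _ x) (by
          intro x hx
          have hx' : ‖x - p‖ ≤ ‖z - p‖ := by simpa [dist_eq_norm] using hx
          rw [norm_fderiv_iteratedFDeriv, show n - (j + 1) + 1 = n - j by omega]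
          refine (hball x (by simpa [dist_eq_norm] using hx'.trans_lt hz')).trans ?_
          rw [norm_pow, norm_norm]
          gcongr)
        (convex_closedBall _ _) (by simp) (by simp [dist_eq_norm])
      rw [h0 _ (by omega), sub_zero] at hmv
      rw [norm_pow, norm_norm, pow_succ, ← mul_assoc]
      exact hmv
  have := key n le_rfl
  rw [Nat.sub_self] at this
  refine Asymptotics.IsBigO.trans ?_ this
  exact Asymptotics.IsBigO.of_bound 1 (by simp)

theorem iteratedFDeriv_sub_pow_eq_zero (q : Fin 2 → ℂ) (i : Fin 2) {k n : ℕ} (hk : k < n) :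
    iteratedFDeriv ℂ k (fun z : Fin 2 → ℂ => (z i - q i) ^ n) q = 0 := by
  have h1 : (fun z : Fin 2 → ℂ => (z i - q i) ^ n) = fun z =>
      ((fun t : ℂ => t ^ n) ∘ (ContinuousLinearMap.proj (R := ℂ) (φ := fun _ : Fin 2 => ℂ) i))
        (z - q) := by
    ext z; simp
  rw [h1, iteratedFDeriv_comp_sub,
    ContinuousLinearMap.iteratedFDeriv_comp_right (i := k) _ (n := k) (by fun_prop) _ le_rfl]
  have h2 : iteratedFDeriv ℂ k (fun t : ℂ => t ^ n) 0 = 0 := by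
    rw [← norm_eq_zero, norm_iteratedFDeriv_eq_norm_iteratedDeriv, iteratedDeriv_eq_iterate,
      iter_deriv_pow, zero_pow (by omega)]
    simp
  simp only [map_zero, sub_self, h2]
  ext; simp

/-- Under Assumption (II) at `q`, near `q` the function space separates `q` from other points
by functions vanishing at `q`. -/
theorem eventually_exists_eq_zero_ne_zero {V : Type*} (ι : V → (Fin 2 → ℂ) → ℂ)
    (hent : ∀ h : V, Differentiable ℂ (ι h)) (q : Fin 2 → ℂ)
    (hII : {n : ℕ | ∀ h : (Fin 2 → ℂ) → ℂ, Differentiable ℂ h →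
        (∀ k < n, iteratedFDeriv ℂ k h q = 0) →
        ∃ v : V, ∀ k < n + 1,
          iteratedFDeriv ℂ k (fun z => ι v z - h z) q = 0}.Infinite) :
    ∀ᶠ q' in 𝓝[≠] q, ∃ v, ι v q = 0 ∧ ι v q' ≠ 0 := by
  obtain ⟨n, hn, hn0⟩ := hII.exists_gt 0
  have hd : ∀ i : Fin 2, Differentiable ℂ fun z : Fin 2 → ℂ => (z i - q i) ^ n := fun i => by
    fun_prop
  choose v hv using fun i : Fin 2 => hn _ (hd i) fun k hk => iteratedFDeriv_sub_pow_eq_zero q i hk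
  have hv0 : ∀ i, ι (v i) q = 0 := fun i => by
    have := hv i 0 (by omega)
    have h2 := congrArg (fun m => m 0) this
    simpa [iteratedFDeriv_zero_apply, zero_pow hn0.ne'] using h2
  have hO : ∀ i, ∃ C : ℝ, 0 ≤ C ∧ ∀ᶠ z in 𝓝 q,
      ‖ι (v i) z - (z i - q i) ^ n‖ ≤ C * ‖z - q‖ ^ (n + 1) := fun i => by
    obtain ⟨C, hC0, hC⟩ :=
      (isBigO_pow_of_iteratedFDeriv_eq_zero ((hent (v i)).sub (hd i)) (hv i)).exists_nonneg
    rw [Asymptotics.isBigOWith_iff] at hC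
    exact ⟨C, hC0, by simpa using hC⟩
  choose C hC0 hC using hO
  have hsmall : ∀ᶠ z in 𝓝 q, (C 0 + C 1) * ‖z - q‖ < 1 := by
    have hc : Continuous fun z => (C 0 + C 1) * ‖z - q‖ := by fun_prop
    exact hc.continuousAt.eventually_lt continuousAt_const (by simp)
  filter_upwards [self_mem_nhdsWithin, nhdsWithin_le_nhds (hC 0), nhdsWithin_le_nhds (hC 1),
    nhdsWithin_le_nhds hsmall] with z hz h0 h1 hs
  by_contra! hcon
  rw [hcon _ (hv0 0), zero_sub, norm_neg, norm_pow] at h0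
  rw [hcon _ (hv0 1), zero_sub, norm_neg, norm_pow] at h1
  have hpos : 0 < ‖z - q‖ := norm_pos_iff.2 (sub_ne_zero.2 hz)
  have hle : ‖z - q‖ ^ n ≤ (C 0 + C 1) * ‖z - q‖ ^ (n + 1) := by
    obtain ⟨i, hi⟩ : ∃ i, ‖z - q‖ = ‖(z - q) i‖ := by
      by_contra! h
      have := (pi_norm_lt_iff hpos).2 fun i => (norm_le_pi_norm (z - q) i).lt_of_ne (h i).symm
      exact this.false
    have hp : 0 ≤ ‖z - q‖ ^ (n + 1) := by positivity
    rw [hi] at hp ⊢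
    rw [hi] at h0 h1
    fin_cases i
    · exact h0.trans (mul_le_mul_of_nonneg_right (by linarith [hC0 1]) hp)
    · exact h1.trans (mul_le_mul_of_nonneg_right (by linarith [hC0 0]) hp)
  have : 0 < ‖z - q‖ ^ n := by positivity
  rw [pow_succ] at hle
  nlinarith

/-- The determinant of two vectors of `ℂ²`. -/
def planeDet (a b : Fin 2 → ℂ) : ℂ := a 0 * b 1 - a 1 * b 0

theorem planeDet_smul_smul (s t : ℂ) (a b : Fin 2 → ℂ) :
    planeDet (s • a) (t • b) = s * t * planeDet a b := by
  simp [planeDet]; ring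

theorem planeDet_self (a : Fin 2 → ℂ) : planeDet a a = 0 := by simp [planeDet]; ring

theorem continuous_planeDet : Continuous fun p : (Fin 2 → ℂ) × (Fin 2 → ℂ) =>
    planeDet p.1 p.2 := by
  unfold planeDet; fun_prop

theorem exists_eq_smul_of_planeDet_eq_zero {a b : Fin 2 → ℂ} (ha : a ≠ 0)
    (h : planeDet a b = 0) : ∃ s : ℂ, b = s • a := by
  unfold planeDet at h
  by_cases h0 : a 0 = 0
  · have h1 : a 1 ≠ 0 := fun h1 => ha (by ext i; fin_cases i <;> simp [h0, h1])
    refine ⟨b 1 / a 1, ?_⟩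
    ext i; fin_cases i
    · simp only [h0, zero_mul, zero_sub, neg_eq_zero, mul_eq_zero, h1, false_or] at h
      simp [h0, h]
    · simp [h1]
  · refine ⟨b 0 / a 0, ?_⟩
    ext i; fin_cases i
    · simp [h0]
    · simp; field_simp; linear_combination h

theorem exists_planeDet_ne_zero {c : Fin 2 → ℂ} (hc : c ≠ 0) : ∃ k, planeDet k c ≠ 0 := by
  by_contra! h
  refine hc ?_
  ext i; fin_cases i
  · simpa [planeDet] using h ![0, 1]
  · simpa [planeDet] using h ![1, 0]

theorem eq_smul_add_smul_of_planeDet_ne_zero {c v : Fin 2 → ℂ} (h : planeDet c v ≠ 0)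
    (z : Fin 2 → ℂ) :
    z = (planeDet z v / planeDet c v) • c + (planeDet c z / planeDet c v) • v := by
  ext i
  simp only [Pi.add_apply, Pi.smul_apply, smul_eq_mul]
  field_simp
  unfold planeDet
  fin_cases i <;> simp <;> ring

/-- A finite expansion `f = ∑ j ≤ d, F j` of a map of `ℂ²` into holomorphic maps `F j`
homogeneous of degree `j`. -/
structure HasHomogeneousExpansion (f : (Fin 2 → ℂ) → Fin 2 → ℂ) (d : ℕ)
    (F : ℕ → (Fin 2 → ℂ) → Fin 2 → ℂ) : Prop where
  differentiable : ∀ j, Differentiable ℂ (F j)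
  map_smul : ∀ j (t : ℂ) z, F j (t • z) = t ^ j • F j z
  eq_sum : ∀ z, f z = ∑ j ∈ Finset.range (d + 1), F j z

theorem eval_smul_of_isHomogeneous {p : MvPolynomial (Fin 2) ℂ} {n : ℕ} (hp : p.IsHomogeneous n)
    (t : ℂ) (z : Fin 2 → ℂ) :
    MvPolynomial.eval (t • z) p = t ^ n * MvPolynomial.eval z p := by
  rw [MvPolynomial.eval_eq, MvPolynomial.eval_eq, Finset.mul_sum]
  refine Finset.sum_congr rfl fun m hm => ?_
  have h1 : m.degree = n := by
    have := hp (MvPolynomial.mem_support_iff.1 hm)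
    rwa [Finsupp.degree_eq_weight_one]
  simp only [Pi.smul_apply, smul_eq_mul, mul_pow, Finset.prod_mul_distrib]
  rw [Finset.prod_pow_eq_pow_sum, show ∑ i ∈ m.support, m i = n from h1]
  ring

theorem differentiable_mvPolynomial_eval (p : MvPolynomial (Fin 2) ℂ) :
    Differentiable ℂ fun z : Fin 2 → ℂ => MvPolynomial.eval z p := by
  induction p using MvPolynomial.induction_on with
  | C a => simp
  | add p q hp hq => simp only [map_add]; exact hp.fun_add hq
  | mul_X p i hp =>
    have : Differentiable ℂ fun z : Fin 2 → ℂ => z i := by fun_prop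
    simp only [map_mul, MvPolynomial.eval_X]
    exact hp.fun_mul this

theorem exists_hasHomogeneousExpansion {f : (Fin 2 → ℂ) → Fin 2 → ℂ}
    (P : Fin 2 → MvPolynomial (Fin 2) ℂ) (hf : ∀ z i, f z i = MvPolynomial.eval z (P i)) :
    ∃ d F, HasHomogeneousExpansion f d F ∧ (d = 0 ∨ ∃ w, F d w ≠ 0) := by
  set F : ℕ → (Fin 2 → ℂ) → Fin 2 → ℂ := fun j z i =>
    MvPolynomial.eval z (MvPolynomial.homogeneousComponent j (P i)) with hF
  have hex : ∃ d, ∀ z, f z = ∑ j ∈ Finset.range (d + 1), F j z := by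
    refine ⟨max (P 0).totalDegree (P 1).totalDegree, fun z => ?_⟩
    ext i
    rw [hf, Finset.sum_apply]
    simp only [hF]
    rw [← map_sum]
    congr 1
    conv_lhs => rw [← MvPolynomial.sum_homogeneousComponent (P i)]
    refine Finset.sum_subset ?_ ?_
    · intro j hj
      rw [Finset.mem_range] at hj ⊢
      refine hj.trans_le ?_
      fin_cases i <;> simp
    · intro j _ hj
      rw [Finset.mem_range, not_lt] at hj
      exact MvPolynomial.homogeneousComponent_eq_zero _ _ (by omega)
  classical
  have hmin := fun m => Nat.find_min hex (m := m)
  refine ⟨Nat.find hex, F, ⟨fun j => ?_, fun j t z => ?_, Nat.find_spec hex⟩, ?_⟩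
  · exact differentiable_pi.2 fun i => differentiable_mvPolynomial_eval _
  · ext i
    exact eval_smul_of_isHomogeneous (MvPolynomial.homogeneousComponent_isHomogeneous j (P i)) t z
  · by_contra! h
    obtain ⟨h0, h1⟩ := h
    obtain ⟨m, hm⟩ := Nat.exists_eq_succ_of_ne_zero h0
    refine hmin m (by omega) fun z => ?_
    have := Nat.find_spec hex z
    have h2 := h1 z
    rw [hm] at this h2
    rw [Finset.sum_range_succ, h2, add_zero] at this
    exact this

namespace HasHomogeneousExpansion

variable {f g : (Fin 2 → ℂ) → Fin 2 → ℂ} {d e : ℕ} {F G : ℕ → (Fin 2 → ℂ) → Fin 2 → ℂ}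

theorem exists_affine (hF : HasHomogeneousExpansion f d F) (hd : d ≤ 1) :
    ∃ (A : (Fin 2 → ℂ) →ₗ[ℂ] (Fin 2 → ℂ)) (b : Fin 2 → ℂ), ∀ z, f z = A z + b := by
  have h0 : ∀ z, F 0 z = F 0 0 := fun z => by simpa using (hF.map_smul 0 0 z).symm
  have h1 : ∀ z, F 1 z = fderiv ℂ (F 1) 0 z := fun z => by
    have ha : HasDerivAt (fun t : ℂ => F 1 (t • z)) (fderiv ℂ (F 1) 0 z) 0 := by
      have h2 : HasDerivAt (fun t : ℂ => t • z) z 0 := by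
        simpa using (hasDerivAt_id (0 : ℂ)).smul_const z
      have h3 : HasFDerivAt (F 1) (fderiv ℂ (F 1) 0) ((0 : ℂ) • z) := by
        rw [zero_smul]; exact (hF.differentiable 1 0).hasFDerivAt
      exact h3.comp_hasDerivAt 0 h2
    have hb : HasDerivAt (fun t : ℂ => F 1 (t • z)) (F 1 z) 0 := by
      simp only [hF.map_smul, pow_one]
      simpa using (hasDerivAt_id (0 : ℂ)).smul_const (F 1 z)
    exact hb.unique ha
  interval_cases d
  · refine ⟨0, F 0 0, fun z => ?_⟩
    simp [hF.eq_sum, h0 z]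
  · refine ⟨(fderiv ℂ (F 1) 0).toLinearMap, F 0 0, fun z => ?_⟩
    rw [hF.eq_sum, Finset.sum_range_succ, Finset.sum_range_one, h0 z, h1 z, add_comm]
    rfl

end HasHomogeneousExpansion

/-- The homogenization of an expansion of degree `d`. -/
def homogenization (d : ℕ) (F : ℕ → (Fin 2 → ℂ) → Fin 2 → ℂ) (σ : ℂ) (w : Fin 2 → ℂ) :
    Fin 2 → ℂ := ∑ j ∈ Finset.range (d + 1), σ ^ (d - j) • F j w

namespace HasHomogeneousExpansion

variable {f g : (Fin 2 → ℂ) → Fin 2 → ℂ} {d e : ℕ} {F G : ℕ → (Fin 2 → ℂ) → Fin 2 → ℂ}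

theorem continuous_homogenization (hF : HasHomogeneousExpansion f d F) :
    Continuous fun p : ℂ × (Fin 2 → ℂ) => homogenization d F p.1 p.2 := by
  unfold homogenization
  refine continuous_finsetSum _ fun j _ => ?_
  have := (hF.differentiable j).continuous
  fun_prop

theorem differentiable_homogenization (hF : HasHomogeneousExpansion f d F) (σ : ℂ) :
    Differentiable ℂ (homogenization d F σ) := by
  unfold homogenization
  refine Differentiable.fun_sum fun j _ => ?_
  exact (hF.differentiable j).fun_const_smul (σ ^ (d - j))

theorem homogenization_zero (w : Fin 2 → ℂ) : homogenization d F 0 w = F d w := by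
  rw [homogenization, Finset.sum_range_succ, Finset.sum_eq_zero]
  · simp
  · intro j hj
    rw [Finset.mem_range] at hj
    rw [zero_pow (by omega), zero_smul]

theorem apply_inv_smul (hF : HasHomogeneousExpansion f d F) {σ : ℂ} (hσ : σ ≠ 0)
    (w : Fin 2 → ℂ) : f (σ⁻¹ • w) = (σ ^ d)⁻¹ • homogenization d F σ w := by
  rw [hF.eq_sum, homogenization, Finset.smul_sum]
  refine Finset.sum_congr rfl fun j hj => ?_
  rw [hF.map_smul, smul_smul]
  congr 1
  have : j ≤ d := by rw [Finset.mem_range] at hj; omega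
  rw [pow_sub₀ _ hσ this, inv_mul_cancel_left₀ (pow_ne_zero d hσ), inv_pow]

theorem leading_comp_leading (hF : HasHomogeneousExpansion f d F)
    (hG : HasHomogeneousExpansion g e G) (hgf : ∀ z, g (f z) = z) (hde : 1 < d * e)
    (w : Fin 2 → ℂ) : G e (F d w) = 0 := by
  have hd : d ≠ 0 := by rintro rfl; simp at hde
  have h1 : ∀ σ : ℂ, σ ≠ 0 →
      homogenization e G (σ ^ d) (homogenization d F σ w) = σ ^ (d * e - 1) • w := by
    intro σ hσ
    have h2 := hgf (σ⁻¹ • w)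
    rw [hF.apply_inv_smul hσ, hG.apply_inv_smul (pow_ne_zero d hσ), inv_smul_eq_iff₀
      (pow_ne_zero _ (pow_ne_zero d hσ))] at h2
    rw [h2, smul_smul, ← pow_mul]
    congr 1
    rw [pow_sub₀ _ hσ (by omega), pow_one]
  have hc1 : Continuous fun σ : ℂ =>
      homogenization e G (σ ^ d) (homogenization d F σ w) :=
    hG.continuous_homogenization.comp ((continuous_pow d).prodMk
      (hF.continuous_homogenization.comp (continuous_id.prodMk continuous_const)))
  have hc2 : Continuous fun σ : ℂ => σ ^ (d * e - 1) • w := by fun_prop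
  have h3 := Continuous.ext_on (dense_compl_singleton (0 : ℂ)) hc1 hc2 (fun σ hσ => h1 σ hσ)
  have h4 := congrFun h3 0
  simpa [zero_pow hd, homogenization_zero, show d * e - 1 ≠ 0 by omega] using h4

end HasHomogeneousExpansion

/-- A homogeneous holomorphic function not vanishing at `v` has isolated zeros on lines with
direction `v`. -/
theorem eventually_ne_zero_of_homogeneous {k : (Fin 2 → ℂ) → ℂ} (hk : Differentiable ℂ k) {d : ℕ}
    (hhom : ∀ (t : ℂ) z, k (t • z) = t ^ d * k z) {v : Fin 2 → ℂ} (hv : k v ≠ 0)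
    (w : Fin 2 → ℂ) : ∀ᶠ τ in 𝓝[≠] (0 : ℂ), k (w + τ • v) ≠ 0 := by
  have hφ : Differentiable ℂ fun τ : ℂ => k (w + τ • v) := by fun_prop
  rcases (hφ.analyticAt 0).eventually_eq_zero_or_eventually_ne_zero with h | h
  · exfalso
    have h0 : ∀ τ : ℂ, k (w + τ • v) = 0 := fun τ => by
      have := AnalyticOnNhd.eq_of_eventuallyEq (z₀ := 0) (𝕜 := ℂ)
        (fun z _ => hφ.analyticAt z : AnalyticOnNhd ℂ _ univ)
        (fun z _ => analyticAt_const : AnalyticOnNhd ℂ (fun _ => (0 : ℂ)) univ) h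
      exact congrFun this τ
    have hc1 : Continuous fun τ : ℂ => k (τ • w + v) :=
      hk.continuous.comp (by fun_prop)
    have h3 := Continuous.ext_on (dense_compl_singleton (0 : ℂ)) hc1
      (continuous_const (y := (0 : ℂ))) (fun τ hτ => by
        have hτ : τ ≠ 0 := hτ
        have : τ • w + v = τ • (w + τ⁻¹ • v) := by rw [smul_add, smul_inv_smul₀ hτ]
        simp only [this, hhom, h0, mul_zero])
    exact hv (by simpa using congrFun h3 0)
  · exact h

theorem exists_leading_form {F : (Fin 2 → ℂ) → Fin 2 → ℂ} {G : (Fin 2 → ℂ) → Fin 2 → ℂ} {d e : ℕ}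
    (hF : Differentiable ℂ F) (hFhom : ∀ (t : ℂ) z, F (t • z) = t ^ d • F z)
    (hG : Differentiable ℂ G) (hGhom : ∀ (t : ℂ) z, G (t • z) = t ^ e • G z)
    (hGF : ∀ w, G (F w) = 0) (hF0 : ∃ w, F w ≠ 0) (hG0 : ∃ w, G w ≠ 0) :
    ∃ (c : Fin 2 → ℂ) (h : (Fin 2 → ℂ) → ℂ), c ≠ 0 ∧ Differentiable ℂ h ∧
      (∀ (t : ℂ) z, h (t • z) = t ^ d * h z) ∧ (∀ w, F w = h w • c) ∧ ∃ w, h w ≠ 0 := by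
  obtain ⟨w₀, hw₀⟩ := hF0
  obtain ⟨v, hv⟩ := hG0
  obtain ⟨i, hi⟩ := Function.ne_iff.1 hv
  set c := F w₀ with hc
  set k : (Fin 2 → ℂ) → ℂ := fun z => G z i with hkdef
  have hk : Differentiable ℂ k := differentiable_pi.1 hG i
  have hkhom : ∀ (t : ℂ) z, k (t • z) = t ^ e * k z := fun t z => by simp [hkdef, hGhom]
  have hkF : ∀ w, k (F w) = 0 := fun w => by simp [hkdef, hGF]
  have hkv : k v ≠ 0 := hi
  have hcv : planeDet c v ≠ 0 := fun h => by
    obtain ⟨s, rfl⟩ := exists_eq_smul_of_planeDet_eq_zero hw₀ h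
    rw [hkhom, hkF, mul_zero] at hkv
    exact hkv rfl
  have hnear : ∀ᶠ z in 𝓝 c, k z = 0 → planeDet c z = 0 := by
    have hiso := eventually_nhdsWithin_iff.1 (eventually_ne_zero_of_homogeneous hk hkhom hkv c)
    have h1 : Continuous fun z : Fin 2 → ℂ => planeDet z v := by unfold planeDet; fun_prop
    have h2 : Continuous fun z : Fin 2 → ℂ => planeDet c z := by unfold planeDet; fun_prop
    have h3 : Tendsto (fun z => planeDet c z / planeDet z v) (𝓝 c) (𝓝 0) := by
      have := (h2.tendsto c).div (h1.tendsto c) hcv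
      rwa [planeDet_self, zero_div] at this
    filter_upwards [h3.eventually hiso, h1.continuousAt.eventually_ne hcv] with z hz hz1 hkz
    by_contra hne
    refine hz (div_ne_zero hne hz1) ?_
    have h4 : z = (planeDet z v / planeDet c v) • (c + (planeDet c z / planeDet z v) • v) := by
      conv_lhs => rw [eq_smul_add_smul_of_planeDet_ne_zero hcv z]
      rw [smul_add, smul_smul]
      congr 2
      field_simp
    have h5 := hkz
    rw [h4, hkhom] at h5
    exact (mul_eq_zero.1 h5).resolve_left (pow_ne_zero _ (div_ne_zero hz1 hcv))
  have hzero : ∀ w, planeDet c (F w) = 0 := by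
    intro w
    have hψ : Differentiable ℂ fun t : ℂ => planeDet c (F (w₀ + t • (w - w₀))) := by
      have : Differentiable ℂ fun t : ℂ => F (w₀ + t • (w - w₀)) := by fun_prop
      have h0 := differentiable_pi.1 this 0
      have h1 := differentiable_pi.1 this 1
      unfold planeDet
      fun_prop
    have hev : (fun t : ℂ => planeDet c (F (w₀ + t • (w - w₀)))) =ᶠ[𝓝 0] fun _ => 0 := by
      have hcont : Tendsto (fun t : ℂ => F (w₀ + t • (w - w₀))) (𝓝 0) (𝓝 c) := by
        have : Continuous fun t : ℂ => F (w₀ + t • (w - w₀)) := hF.continuous.comp (by fun_prop)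
        simpa using this.tendsto 0
      filter_upwards [hcont.eventually hnear] with t ht using ht (hkF _)
    have := AnalyticOnNhd.eq_of_eventuallyEq (z₀ := 0) (𝕜 := ℂ)
        (fun z _ => hψ.analyticAt z : AnalyticOnNhd ℂ _ univ)
        (fun z _ => analyticAt_const : AnalyticOnNhd ℂ (fun _ => (0 : ℂ)) univ) hev
    simpa using congrFun this 1
  obtain ⟨l, hl⟩ := Function.ne_iff.1 hw₀
  have hrep : ∀ w, F w = (F w l / c l) • c := fun w => by
    obtain ⟨s, hs⟩ := exists_eq_smul_of_planeDet_eq_zero hw₀ (hzero w)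
    rw [hs, Pi.smul_apply, smul_eq_mul, mul_div_cancel_right₀ _ hl]
  refine ⟨c, fun w => F w l / c l, hw₀, ?_, ?_, hrep, w₀, ?_⟩
  · have := differentiable_pi.1 hF l
    fun_prop
  · intro t z
    simp [hFhom, mul_div_assoc]
  · exact div_ne_zero hl hl

/-- Zeros of a continuous family of entire functions persist. -/
theorem eventually_exists_zero_of_isolated_zero {ψ : ℂ → ℂ → ℂ}
    (hc : Continuous fun p : ℂ × ℂ => ψ p.1 p.2) (hd : ∀ σ, Differentiable ℂ (ψ σ))
    (h0 : ψ 0 0 = 0) (hne : ∀ᶠ ρ in 𝓝[≠] 0, ψ 0 ρ ≠ 0) {ε : ℝ} (hε : 0 < ε) :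
    ∀ᶠ σ in 𝓝 0, ∃ ρ, ‖ρ‖ ≤ ε ∧ ψ σ ρ = 0 := by
  obtain ⟨r₀, hr₀, hball⟩ := Metric.eventually_nhds_iff_ball.1 (eventually_nhdsWithin_iff.1 hne)
  obtain ⟨r, hr, hrr₀, hrε⟩ : ∃ r, 0 < r ∧ r < r₀ ∧ r ≤ ε :=
    ⟨min (r₀ / 2) ε, by positivity, (min_le_left _ _).trans_lt (by linarith), min_le_right _ _⟩
  have hS : ∀ ρ ∈ Metric.sphere (0 : ℂ) r, 0 < ‖ψ 0 ρ‖ := fun ρ hρ => by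
    have hρ' : ‖ρ‖ = r := by simpa using hρ
    refine norm_pos_iff.2 (hball ρ (by simpa [hρ'] using hrr₀) ?_)
    rintro rfl
    simp [hr.ne] at hρ'
  obtain ⟨m, hm, hmS⟩ : ∃ m, 0 < m ∧ ∀ ρ ∈ Metric.sphere (0 : ℂ) r, m < ‖ψ 0 ρ‖ := by
    have hc0 : Continuous fun ρ => ‖ψ 0 ρ‖ :=
      (hc.comp (continuous_const.prodMk continuous_id)).norm
    obtain ⟨x, hx, hmin⟩ := (isCompact_sphere (0 : ℂ) r).exists_isMinOn
      (NormedSpace.sphere_nonempty.2 hr.le) hc0.continuousOn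
    exact ⟨‖ψ 0 x‖ / 2, half_pos (hS x hx), fun ρ hρ => 
      (half_lt_self (hS x hx)).trans_le (hmin hρ)⟩
  have h1 : ∀ᶠ σ in 𝓝 (0 : ℂ), ∀ ρ ∈ Metric.sphere (0 : ℂ) r, m < ‖ψ σ ρ‖ := by
    refine (isCompact_sphere (0 : ℂ) r).eventually_forall_of_forall_eventually fun ρ hρ => ?_
    exact continuous_const.continuousAt.eventually_lt hc.norm.continuousAt (hmS ρ hρ)
  have h2 : ∀ᶠ σ in 𝓝 (0 : ℂ), ‖ψ σ 0‖ < m := by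
    have : Continuous fun σ => ‖ψ σ 0‖ := (hc.comp (continuous_id.prodMk continuous_const)).norm
    exact this.continuousAt.eventually_lt continuous_const.continuousAt (by simpa [h0] using hm)
  filter_upwards [h1, h2] with σ hσ1 hσ2
  by_contra! hcon
  have hnz : ∀ ρ ∈ Metric.closedBall (0 : ℂ) r, ψ σ ρ ≠ 0 := fun ρ hρ =>
    hcon ρ ((by simpa using hρ : ‖ρ‖ ≤ r).trans hrε)
  have hmax := Complex.norm_le_of_forall_mem_frontier_norm_le (U := Metric.ball (0 : ℂ) r)
    (f := fun ρ => (ψ σ ρ)⁻¹) (C := m⁻¹) (z := 0) Metric.isBounded_ball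
    (DifferentiableOn.diffContOnCl (by
      rw [closure_ball _ hr.ne']
      exact (hd σ).differentiableOn.inv hnz)) (by
      intro ρ hρ
      rw [frontier_ball _ hr.ne'] at hρ
      rw [norm_inv]
      exact inv_anti₀ hm (hσ1 ρ hρ).le) (subset_closure (by simpa using hr))
  rw [norm_inv] at hmax
  have h3 : 0 < ‖ψ σ 0‖ := norm_pos_iff.2 (hnz 0 (by simpa using hr.le))
  exact absurd ((inv_le_inv₀ h3 hm).1 hmax) (not_le.2 hσ2)

/-- The restriction of an injective polynomial map to a line through the origin is asymptotic
to a monomial. -/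
theorem HasHomogeneousExpansion.exists_asymptotic_direction {f g : (Fin 2 → ℂ) → Fin 2 → ℂ}
    {e : ℕ} {G : ℕ → (Fin 2 → ℂ) → Fin 2 → ℂ} (hG : HasHomogeneousExpansion g e G)
    (hfg : ∀ z, f (g z) = z) {k : Fin 2 → ℂ} (hk0 : k ≠ 0) :
    ∃ (J : ℕ) (b : Fin 2 → ℂ), b ≠ 0 ∧ ∃ R : ℂ → Fin 2 → ℂ, Continuous R ∧ R 0 = b ∧
      ∀ t : ℂ, t ≠ 0 → g (t • k) = t ^ J • R t⁻¹ := by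
  classical
  have hex : ∃ J, 1 ≤ J ∧ J ≤ e ∧ G J k ≠ 0 := by
    by_contra! hcon
    have hconst : ∀ t : ℂ, g (t • k) = G 0 k := fun t => by
      rw [hG.eq_sum, Finset.sum_eq_single 0]
      · rw [hG.map_smul]; simp
      · intro j hj hj0
        rw [Finset.mem_range] at hj
        rw [hG.map_smul, hcon j (by omega) (by omega), smul_zero]
      · simp
    have h1 := hconst 1
    rw [← hconst 0] at h1
    have h2 := congrArg f h1
    rw [hfg, hfg, zero_smul, one_smul] at h2
    exact hk0 h2
  set J := Nat.findGreatest (fun J => 1 ≤ J ∧ G J k ≠ 0) e with hJdef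
  obtain ⟨J', hJ'1, hJ'e, hJ'0⟩ := hex
  have hJs : 1 ≤ J ∧ G J k ≠ 0 :=
    Nat.findGreatest_spec (P := fun J => 1 ≤ J ∧ G J k ≠ 0) hJ'e ⟨hJ'1, hJ'0⟩
  have hJe : J ≤ e := Nat.findGreatest_le e
  have hgt : ∀ j, J < j → j ≤ e → G j k = 0 := fun j hj hje => by
    have := Nat.findGreatest_is_greatest (P := fun J => 1 ≤ J ∧ G J k ≠ 0) hj hje
    by_contra h0
    exact this ⟨by omega, h0⟩
  refine ⟨J, G J k, hJs.2, fun s => ∑ j ∈ Finset.range (J + 1), s ^ (J - j) • G j k,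
    by fun_prop, ?_, fun t ht => ?_⟩
  · simp only
    rw [Finset.sum_range_succ, Finset.sum_eq_zero]
    · simp
    · intro j hj
      rw [Finset.mem_range] at hj
      rw [zero_pow (by omega), zero_smul]
  · rw [hG.eq_sum, Finset.smul_sum]
    symm
    refine (Finset.sum_congr rfl fun j hj => ?_).trans
      (Finset.sum_subset (Finset.range_mono (by omega)) ?_)
    · rw [Finset.mem_range] at hj
      rw [hG.map_smul, smul_smul]
      congr 1
      rw [inv_pow, ← div_eq_mul_inv, div_eq_iff (pow_ne_zero _ ht), ← pow_add]
      congr 1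
      omega
    · intro j hj hj'
      rw [Finset.mem_range] at hj hj'
      rw [hG.map_smul, hgt j (by omega) (by omega), smul_zero]

theorem HasHomogeneousExpansion.exists_zeros_subset_line {f g : (Fin 2 → ℂ) → Fin 2 → ℂ}
    {d e : ℕ} {F G : ℕ → (Fin 2 → ℂ) → Fin 2 → ℂ}
    (hF : HasHomogeneousExpansion f d F) (hG : HasHomogeneousExpansion g e G)
    (hgf : ∀ z, g (f z) = z) (hfg : ∀ z, f (g z) = z) {c : Fin 2 → ℂ}
    {h : (Fin 2 → ℂ) → ℂ} (hc : c ≠ 0) (hh : Differentiable ℂ h)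
    (hhom : ∀ (t : ℂ) z, h (t • z) = t ^ d * h z) (hFd : ∀ w, F d w = h w • c)
    (hh0 : ∃ w, h w ≠ 0) : ∃ b : Fin 2 → ℂ, b ≠ 0 ∧ ∀ w, h w = 0 → planeDet b w = 0 := by
  obtain ⟨k, hk⟩ := exists_planeDet_ne_zero hc
  have hk0 : k ≠ 0 := by rintro rfl; simp [planeDet] at hk
  obtain ⟨v, hv⟩ := hh0
  have hgk : Continuous fun t : ℂ => g (t • k) := by
    simp only [hG.eq_sum]
    refine continuous_finsetSum _ fun j _ => ?_
    exact (hG.differentiable j).continuous.comp (by fun_prop)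
  obtain ⟨J, b, hb, R, hRc, hR0, hR⟩ := hG.exists_asymptotic_direction hfg hk0
  refine ⟨b, hb, fun w hw => ?_⟩
  by_cases hw0 : w = 0
  · simp [planeDet, hw0]
  by_contra hdet
  -- directions near those of `b` and `w` are independent
  have hopen : ∀ᶠ p in 𝓝 (0 : ℂ) ×ˢ 𝓝 (0 : ℂ), planeDet (R p.1) (w + p.2 • v) ≠ 0 := by
    have hcont : Continuous fun p : ℂ × ℂ => planeDet (R p.1) (w + p.2 • v) :=
      continuous_planeDet.comp ((hRc.comp continuous_fst).prodMk (by fun_prop))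
    have := hcont.continuousAt (x := ((0 : ℂ), (0 : ℂ)))
    rw [← nhds_prod_eq]
    exact this.eventually_ne (by simpa [hR0] using hdet)
  obtain ⟨p1, hp1, p2, hp2, hp⟩ := eventually_prod_iff.1 hopen
  obtain ⟨r1, hr1, hb1⟩ := Metric.eventually_nhds_iff_ball.1 hp1
  obtain ⟨r2, hr2, hb2⟩ := Metric.eventually_nhds_iff_ball.1
    (hp2.and ((by fun_prop : Continuous fun ρ : ℂ => w + ρ • v).continuousAt.eventually_ne
      (y := 0) (x := 0) (by simpa using hw0)))
  obtain ⟨B, hB⟩ := (isCompact_closedBall (0 : ℂ) r1⁻¹).exists_bound_of_continuousOn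
    hgk.continuousOn
  obtain ⟨δ, hδ, hwδ⟩ : ∃ δ > 0, ∀ ρ : ℂ, ‖ρ‖ ≤ r2 / 2 → δ ≤ ‖w + ρ • v‖ := by
    obtain ⟨x, hx, hmin⟩ := (isCompact_closedBall (0 : ℂ) (r2 / 2)).exists_isMinOn
      (Metric.nonempty_closedBall.2 (by positivity))
      (by fun_prop : Continuous fun ρ : ℂ => ‖w + ρ • v‖).continuousOn
    have hx' : ‖x‖ ≤ r2 / 2 := by simpa using hx
    refine ⟨‖w + x • v‖, norm_pos_iff.2 (hb2 x (by simpa using hx'.trans_lt (by linarith))).2,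
      fun ρ hρ => hmin (by simpa using hρ)⟩
  have hψc : Continuous fun p : ℂ × ℂ => planeDet k (homogenization d F p.1 (w + p.2 • v)) := by
    have h1 : Continuous fun p : ℂ × ℂ => (p.1, w + p.2 • v) := by fun_prop
    have h2 := hF.continuous_homogenization.comp h1
    exact continuous_planeDet.comp (continuous_const.prodMk h2)
  have hψd : ∀ σ, Differentiable ℂ fun ρ : ℂ =>
      planeDet k (homogenization d F σ (w + ρ • v)) := fun σ => by
    have h1 : Differentiable ℂ fun ρ : ℂ => w + ρ • v := by fun_prop
    have h2 := differentiable_pi.1 ((hF.differentiable_homogenization σ).comp h1)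
    have h3 := h2 0
    have h4 := h2 1
    simp only [Function.comp_apply] at h3 h4
    unfold planeDet
    fun_prop
  have hzeros := eventually_exists_zero_of_isolated_zero
    (ψ := fun σ ρ => planeDet k (homogenization d F σ (w + ρ • v))) hψc hψd
    (by simp [homogenization_zero, hFd, hw, planeDet])
    (by
      filter_upwards [eventually_ne_zero_of_homogeneous hh hhom hv w] with ρ hρ
      rw [homogenization_zero, hFd]
      have := planeDet_smul_smul 1 (h (w + ρ • v)) k c
      rw [one_smul, one_mul] at this
      rw [this]
      exact mul_ne_zero hρ hk) (half_pos hr2)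
  have hσsmall : ∀ᶠ σ in 𝓝[≠] (0 : ℂ), B < ‖σ‖⁻¹ * δ := by
    have : Tendsto (fun σ : ℂ => ‖σ‖⁻¹ * δ) (𝓝[≠] 0) atTop :=
      (tendsto_inv_nhdsGT_zero.comp tendsto_norm_nhdsNE_zero).atTop_mul_const hδ
    exact this.eventually_gt_atTop B
  obtain ⟨σ, ⟨⟨ρ, hρ, hzero⟩, hσB⟩, hσ0⟩ :=
    (((hzeros.filter_mono nhdsWithin_le_nhds).and hσsmall).and self_mem_nhdsWithin).exists
  have hσ0 : σ ≠ 0 := hσ0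
  have hfz := hF.apply_inv_smul hσ0 (w + ρ • v)
  obtain ⟨t, ht⟩ := exists_eq_smul_of_planeDet_eq_zero hk0 hzero
  rw [ht, smul_smul] at hfz
  set s := (σ ^ d)⁻¹ * t
  have hz : σ⁻¹ • (w + ρ • v) = g (s • k) := by rw [← hfz, hgf]
  have hs : r1⁻¹ < ‖s‖ := by
    by_contra! hle
    have h1 := hB s (by simpa using hle)
    rw [← hz, norm_smul, norm_inv] at h1
    have := mul_le_mul_of_nonneg_left (hwδ ρ hρ) (inv_nonneg.2 (norm_nonneg σ))
    linarith
  have hs0 : s ≠ 0 := by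
    rintro h0
    rw [h0, norm_zero] at hs
    exact absurd hs (not_lt.2 (inv_nonneg.2 hr1.le))
  rw [hR s hs0] at hz
  have hfin := hp (x := s⁻¹) (y := ρ) (hb1 _ (by
    simpa using inv_lt_of_inv_lt₀ hr1 hs))
    (hb2 _ (by simpa using hρ.trans_lt (by linarith))).1
  refine hfin ?_
  have h2 : w + ρ • v = (σ * s ^ J) • R s⁻¹ := by
    rw [mul_smul, ← hz, smul_inv_smul₀ hσ0]
  have := planeDet_smul_smul 1 (σ * s ^ J) (R s⁻¹) (R s⁻¹)
  simp only [h2]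
  rw [one_smul, planeDet_self, mul_zero] at this
  exact this

/-- The linear coordinates `X, Y` on `ℂ²` attached to the basis `p, q`. -/
structure IsCoordinatePair (X Y : (Fin 2 → ℂ) →L[ℂ] ℂ) (p q : Fin 2 → ℂ) : Prop where
  eq_add : ∀ z, z = X z • p + Y z • q
  apply_fst : X p = 1
  apply_snd : X q = 0
  snd_apply_fst : Y p = 0
  snd_apply_snd : Y q = 1

theorem IsCoordinatePair.symm {X Y : (Fin 2 → ℂ) →L[ℂ] ℂ} {p q : Fin 2 → ℂ}
    (h : IsCoordinatePair X Y p q) : IsCoordinatePair Y X q p :=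
  ⟨fun z => by rw [add_comm]; exact h.eq_add z, h.snd_apply_snd, h.snd_apply_fst, h.apply_snd,
    h.apply_fst⟩

theorem exists_isCoordinatePair {p q : Fin 2 → ℂ} (h : planeDet p q ≠ 0) :
    ∃ X Y, IsCoordinatePair X Y p q := by
  have hX : IsLinearMap ℂ fun z => planeDet z q / planeDet p q :=
    ⟨fun a b => by simp only [planeDet, Pi.add_apply]; ring,
      fun s a => by simp only [planeDet, Pi.smul_apply, smul_eq_mul]; ring⟩
  have hY : IsLinearMap ℂ fun z => planeDet p z / planeDet p q :=
    ⟨fun a b => by simp only [planeDet, Pi.add_apply]; ring,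
      fun s a => by simp only [planeDet, Pi.smul_apply, smul_eq_mul]; ring⟩
  refine ⟨LinearMap.toContinuousLinearMap hX.mk', LinearMap.toContinuousLinearMap hY.mk',
    eq_smul_add_smul_of_planeDet_ne_zero h, ?_, ?_, ?_, ?_⟩
  · exact div_self h
  · change planeDet q q / _ = 0
    rw [planeDet_self, zero_div]
  · change planeDet p p / _ = 0
    rw [planeDet_self, zero_div]
  · exact div_self h

theorem IsCoordinatePair.isCompact {X Y : (Fin 2 → ℂ) →L[ℂ] ℂ} {p q : Fin 2 → ℂ}
    (h : IsCoordinatePair X Y p q) {A B : Set ℂ} (hA : IsCompact A) (hB : IsCompact B) :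
    IsCompact {z | X z ∈ A ∧ Y z ∈ B} := by
  have : {z | X z ∈ A ∧ Y z ∈ B} = (fun s : ℂ × ℂ => s.1 • p + s.2 • q) '' (A ×ˢ B) := by
    ext z
    constructor
    · rintro ⟨h1, h2⟩
      exact ⟨(X z, Y z), ⟨h1, h2⟩, (h.eq_add z).symm⟩
    · rintro ⟨⟨s, t⟩, ⟨hs, ht⟩, rfl⟩
      simpa [h.apply_fst, h.apply_snd, h.snd_apply_fst, h.snd_apply_snd] using And.intro hs ht
  rw [this]
  exact (hA.prod hB).image (by fun_prop)

/-- A polynomial map expands a cone around its direction at infinity. -/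
theorem HasHomogeneousExpansion.exists_cone {f : (Fin 2 → ℂ) → Fin 2 → ℂ} {d : ℕ}
    {F : ℕ → (Fin 2 → ℂ) → Fin 2 → ℂ} (hF : HasHomogeneousExpansion f d F) (hd : 2 ≤ d)
    {X Y : (Fin 2 → ℂ) →L[ℂ] ℂ} {p q c : Fin 2 → ℂ} (hXY : IsCoordinatePair X Y p q)
    {h : (Fin 2 → ℂ) → ℂ} (hFd : ∀ w, F d w = h w • c) (hXc : X c ≠ 0)
    (hYc : Y c = 0) (hzero : ∀ w, X w ≠ 0 → h w ≠ 0) :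
    ∃ κ > 0, ∃ R₀ : ℝ, ∀ z, R₀ ≤ ‖X z‖ → ‖Y z‖ ≤ ‖X z‖ →
      κ * ‖X z‖ ^ 2 ≤ ‖X (f z)‖ ∧ ‖Y (f z)‖ ≤ ‖X (f z)‖ := by
  set S : Set (Fin 2 → ℂ) := {z | X z ∈ Metric.sphere 0 1 ∧ Y z ∈ Metric.closedBall 0 1} with hS
  have hSc : IsCompact S := hXY.isCompact (isCompact_sphere 0 1) (isCompact_closedBall 0 1)
  have hpos : ∀ w ∈ S, 0 < ‖X (F d w)‖ := fun w hw => by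
    rw [hFd, _root_.map_smul, smul_eq_mul]
    refine norm_pos_iff.2 (mul_ne_zero (hzero w fun h0 => ?_) hXc)
    have := hw.1
    rw [h0] at this
    simp at this
  obtain ⟨m, hm, hmS⟩ : ∃ m, 0 < m ∧ ∀ w ∈ S, m < ‖X (F d w)‖ := by
    have hc0 : Continuous fun w => ‖X (F d w)‖ :=
      (X.continuous.comp (hF.differentiable d).continuous).norm
    have hne : S.Nonempty := ⟨p, by simp [hS, hXY.apply_fst, hXY.snd_apply_fst]⟩
    obtain ⟨x, hx, hmin⟩ := hSc.exists_isMinOn hne hc0.continuousOn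
    exact ⟨‖X (F d x)‖ / 2, half_pos (hpos x hx), fun w hw =>
      (half_lt_self (hpos x hx)).trans_le (hmin hw)⟩
  have hΦ := hF.continuous_homogenization
  have hev : ∀ᶠ σ in 𝓝 (0 : ℂ), ∀ w ∈ S,
      m < ‖X (homogenization d F σ w)‖ ∧ ‖Y (homogenization d F σ w)‖ < m := by
    refine hSc.eventually_forall_of_forall_eventually fun w hw => ?_
    have h1 : Continuous fun s : ℂ × (Fin 2 → ℂ) => ‖X (homogenization d F s.1 s.2)‖ :=
      (X.continuous.comp hΦ).norm
    have h2 : Continuous fun s : ℂ × (Fin 2 → ℂ) => ‖Y (homogenization d F s.1 s.2)‖ :=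
      (Y.continuous.comp hΦ).norm
    refine (continuous_const.continuousAt.eventually_lt h1.continuousAt ?_).and
      (h2.continuousAt.eventually_lt continuous_const.continuousAt ?_)
    · simpa [homogenization_zero] using hmS w hw
    · simpa [homogenization_zero, hFd, hYc] using hm
  obtain ⟨δ, hδ, hball⟩ := Metric.eventually_nhds_iff_ball.1 hev
  refine ⟨m, hm, max 1 (2 * δ⁻¹), fun z hz hYz => ?_⟩
  have hx1 : 1 ≤ ‖X z‖ := (le_max_left _ _).trans hz
  have hx2 : 2 * δ⁻¹ ≤ ‖X z‖ := (le_max_right _ _).trans hz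
  have hx0 : 0 < ‖X z‖ := by linarith
  set σ : ℂ := ((‖X z‖⁻¹ : ℝ) : ℂ) with hσ
  have hσn : ‖σ‖ = ‖X z‖⁻¹ := by
    rw [hσ, Complex.norm_real, Real.norm_eq_abs, abs_of_pos (inv_pos.2 hx0)]
  have hσ0 : σ ≠ 0 := norm_pos_iff.1 (by rw [hσn]; positivity)
  have hσδ : ‖σ‖ < δ := by
    rw [hσn, inv_lt_comm₀ hx0 hδ]
    have := inv_pos.2 hδ
    linarith
  have hwS : σ • z ∈ S := by
    constructor
    · rw [_root_.map_smul, smul_eq_mul, mem_sphere_zero_iff_norm, norm_mul, hσn,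
        inv_mul_cancel₀ hx0.ne']
    · rw [_root_.map_smul, smul_eq_mul, mem_closedBall_zero_iff, norm_mul, hσn, inv_mul_le_one₀ hx0]
      exact hYz
  obtain ⟨h1, h2⟩ := hball σ (by simpa using hσδ) _ hwS
  have hf := hF.apply_inv_smul hσ0 (σ • z)
  rw [inv_smul_smul₀ hσ0] at hf
  have hsc : ‖(σ ^ d)⁻¹‖ = ‖X z‖ ^ d := by rw [norm_inv, norm_pow, hσn, inv_pow, inv_inv]
  rw [hf, _root_.map_smul, _root_.map_smul, smul_eq_mul, smul_eq_mul, norm_mul, norm_mul, hsc]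
  have hpow : ‖X z‖ ^ 2 ≤ ‖X z‖ ^ d := pow_le_pow_right₀ hx1 hd
  constructor
  · rw [mul_comm]
    exact mul_le_mul hpow h1.le hm.le (by positivity)
  · exact mul_le_mul_of_nonneg_left (h2.trans h1).le (by positivity)

/-- A holomorphic map `φ` of `ℂ²` with left inverse `ψ` such that `φ` expands the cone
`|Y| ≤ |X|` and `ψ` expands the cone `|X| ≤ |Y|` outside a bidisc of radius `R`. -/
structure IsConeExpanding (φ ψ : (Fin 2 → ℂ) → Fin 2 → ℂ) (X Y : (Fin 2 → ℂ) →L[ℂ] ℂ)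
    (p q : Fin 2 → ℂ) (κ R : ℝ) : Prop where
  coords : IsCoordinatePair X Y p q
  left_inv : ∀ z, ψ (φ z) = z
  differentiable : Differentiable ℂ φ
  kappa_pos : 0 < κ
  one_le : 1 ≤ R
  two_le : 2 ≤ κ * R
  cone_fst : ∀ z, R ≤ ‖X z‖ → ‖Y z‖ ≤ ‖X z‖ →
    κ * ‖X z‖ ^ 2 ≤ ‖X (φ z)‖ ∧ ‖Y (φ z)‖ ≤ ‖X (φ z)‖
  cone_snd : ∀ z, R ≤ ‖Y z‖ → ‖X z‖ ≤ ‖Y z‖ →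
    κ * ‖Y z‖ ^ 2 ≤ ‖Y (ψ z)‖ ∧ ‖X (ψ z)‖ ≤ ‖Y (ψ z)‖

namespace IsConeExpanding

variable {φ ψ : (Fin 2 → ℂ) → Fin 2 → ℂ} {X Y : (Fin 2 → ℂ) →L[ℂ] ℂ} {p q : Fin 2 → ℂ} {κ R : ℝ}

theorem two_mul_le (h : IsConeExpanding φ ψ X Y p q κ R) {t : ℝ} (ht : R ≤ t) :
    2 * t ≤ κ * t ^ 2 := by
  have h1 := mul_le_mul_of_nonneg_left ht h.kappa_pos.le
  have h2 := h.two_le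
  have h3 := h.one_le
  nlinarith

theorem iterate_mem_cone (h : IsConeExpanding φ ψ X Y p q κ R) {z : Fin 2 → ℂ}
    (hz : R ≤ ‖X z‖) (hYz : ‖Y z‖ ≤ ‖X z‖) (n : ℕ) :
    ‖X z‖ ≤ ‖X (φ^[n] z)‖ ∧ ‖Y (φ^[n] z)‖ ≤ ‖X (φ^[n] z)‖ := by
  induction n with
  | zero => exact ⟨le_rfl, hYz⟩
  | succ n ih =>
    rw [Function.iterate_succ_apply']
    obtain ⟨h1, h2⟩ := h.cone_fst _ (hz.trans ih.1) ih.2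
    have h3 := h.two_mul_le (hz.trans ih.1)
    exact ⟨by linarith [norm_nonneg (X z), ih.1], h2⟩

theorem two_pow_le_norm (h : IsConeExpanding φ ψ X Y p q κ R) {z : Fin 2 → ℂ}
    (hz : R ≤ ‖X z‖) (hYz : ‖Y z‖ ≤ ‖X z‖) (n : ℕ) :
    (2 : ℝ) ^ 2 ^ n ≤ κ * ‖X (φ^[n] z)‖ := by
  induction n with
  | zero =>
    simpa using h.two_le.trans (mul_le_mul_of_nonneg_left hz h.kappa_pos.le)
  | succ n ih =>
    obtain ⟨h1, h2⟩ := h.iterate_mem_cone hz hYz n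
    have h3 := (h.cone_fst _ (hz.trans h1) h2).1
    rw [Function.iterate_succ_apply']
    calc (2 : ℝ) ^ 2 ^ (n + 1) = ((2 : ℝ) ^ 2 ^ n) ^ 2 := by rw [← pow_mul, ← pow_succ]
      _ ≤ (κ * ‖X (φ^[n] z)‖) ^ 2 := pow_le_pow_left₀ (by positivity) ih 2
      _ = κ * (κ * ‖X (φ^[n] z)‖ ^ 2) := by ring
      _ ≤ _ := mul_le_mul_of_nonneg_left h3 h.kappa_pos.le

theorem iterate_notMem_cone (h : IsConeExpanding φ ψ X Y p q κ R) (x : ℂ) (n : ℕ) :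
    ¬ (R ≤ ‖Y (φ^[n] (x • p))‖ ∧ ‖X (φ^[n] (x • p))‖ ≤ ‖Y (φ^[n] (x • p))‖) := by
  have hR := h.one_le
  induction n with
  | zero =>
    rintro ⟨h1, -⟩
    simp [h.coords.snd_apply_fst] at h1
    linarith
  | succ n ih =>
    rintro ⟨h1, h2⟩
    refine ih ?_
    obtain ⟨h3, h4⟩ := h.cone_snd _ h1 h2
    rw [Function.iterate_succ_apply', h.left_inv] at h3 h4
    have h5 := h.two_mul_le h1
    rw [Function.iterate_succ_apply'] at h1 h5
    exact ⟨by linarith, h4⟩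

theorem iterate_mem_bidisc (h : IsConeExpanding φ ψ X Y p q κ R) {x : ℂ} {k n : ℕ} (hk : k ≤ n)
    (hx : ‖X (φ^[n] (x • p))‖ ≤ R) :
    ‖X (φ^[k] (x • p))‖ ≤ R ∧ ‖Y (φ^[k] (x • p))‖ ≤ R := by
  have hA := h.iterate_notMem_cone x k
  have hB : ‖X (φ^[k] (x • p))‖ ≤ R := by
    by_contra! hlt
    rcases le_total ‖Y (φ^[k] (x • p))‖ ‖X (φ^[k] (x • p))‖ with hle | hle
    · have := (h.iterate_mem_cone hlt.le hle (n - k)).1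
      rw [← Function.iterate_add_apply, Nat.sub_add_cancel hk] at this
      linarith
    · exact hA ⟨hlt.le.trans hle, hle⟩
  refine ⟨hB, ?_⟩
  by_contra! hlt
  exact hA ⟨hlt.le, hB.trans hlt.le⟩

theorem differentiable_iterate (h : IsConeExpanding φ ψ X Y p q κ R) (n : ℕ) :
    Differentiable ℂ fun x : ℂ => φ^[n] (x • p) := by
  have : Differentiable ℂ φ^[n] := h.differentiable.iterate n
  fun_prop

theorem two_pow_le_of_le (h : IsConeExpanding φ ψ X Y p q κ R) {x : ℂ} (hx : R ≤ ‖x‖) (n : ℕ) :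
    (2 : ℝ) ^ 2 ^ n ≤ κ * ‖X (φ^[n] (x • p))‖ :=
  h.two_pow_le_norm (z := x • p) (by simpa [h.coords.apply_fst] using hx)
    (by simp [h.coords.apply_fst, h.coords.snd_apply_fst]) n

theorem norm_le_of_le (h : IsConeExpanding φ ψ X Y p q κ R) {x : ℂ} (hx : R ≤ ‖x‖) (n : ℕ) :
    ‖x‖ ≤ ‖X (φ^[n] (x • p))‖ := by
  have := (h.iterate_mem_cone (z := x • p) (by simpa [h.coords.apply_fst] using hx)
    (by simp [h.coords.apply_fst, h.coords.snd_apply_fst]) n).1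
  simpa [h.coords.apply_fst] using this

theorem exists_apply_eq (h : IsConeExpanding φ ψ X Y p q κ R) (n : ℕ) (y : ℂ) :
    ∃ x : ℂ, X (φ^[n] (x • p)) = y := by
  by_contra! hne
  have hR := h.one_le
  have hd : Differentiable ℂ fun x : ℂ => X (φ^[n] (x • p)) - y := by
    have := h.differentiable_iterate n
    fun_prop
  have hd' : Differentiable ℂ fun x : ℂ => (X (φ^[n] (x • p)) - y)⁻¹ :=
    hd.fun_inv fun x => sub_ne_zero.2 (hne x)
  have hpos : 0 < ‖X (φ^[n] ((0 : ℂ) • p)) - y‖ := norm_pos_iff.2 (sub_ne_zero.2 (hne 0))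
  set M := ‖X (φ^[n] ((0 : ℂ) • p)) - y‖
  set r := R + ‖y‖ + M with hr
  have hr0 : 0 < r := by positivity
  have hmax := Complex.norm_le_of_forall_mem_frontier_norm_le (U := Metric.ball (0 : ℂ) r)
    (f := fun x : ℂ => (X (φ^[n] (x • p)) - y)⁻¹) (C := (R + M)⁻¹) (z := 0) Metric.isBounded_ball
    hd'.diffContOnCl (by
      intro x hx
      rw [frontier_ball _ hr0.ne', mem_sphere_zero_iff_norm] at hx
      rw [norm_inv]
      refine inv_anti₀ (by positivity) ?_
      have h1 := h.norm_le_of_le (x := x) (by rw [hx, hr]; linarith [norm_nonneg y]) n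
      have h2 := norm_sub_norm_le (X (φ^[n] (x • p))) y
      linarith) (subset_closure (by simpa using hr0))
  rw [norm_inv] at hmax
  have := (inv_le_inv₀ hpos (by positivity)).1 hmax
  change R + M ≤ M at this
  linarith

end IsConeExpanding

theorem eventually_mul_pow_lt_two_pow_two_pow (A a : ℝ) :
    ∀ᶠ m : ℕ in atTop, A * a ^ m < (2 : ℝ) ^ 2 ^ m := by
  obtain ⟨L, hL⟩ := pow_unbounded_of_one_lt (max |A| |a|) (one_lt_two : (1 : ℝ) < 2)
  have hA : |A| ≤ 2 ^ L := (le_max_left _ _).trans hL.le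
  have ha : |a| ≤ 2 ^ L := (le_max_right _ _).trans hL.le
  have h1 : Tendsto (fun m : ℕ => (m : ℝ) ^ 1 / 2 ^ m) atTop (𝓝 0) :=
    tendsto_pow_const_div_const_pow_of_one_lt 1 one_lt_two
  have h2 : Tendsto (fun m : ℕ => (L : ℝ) * ((m : ℝ) ^ 1 / 2 ^ m) + (L : ℝ) * (1 / 2) ^ m) atTop
      (𝓝 0) := by
    have h3 := tendsto_pow_atTop_nhds_zero_of_lt_one (r := (1 / 2 : ℝ)) (by norm_num) (by norm_num)
    simpa using (h1.const_mul (L : ℝ)).add (h3.const_mul (L : ℝ))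
  filter_upwards [h2.eventually_lt_const one_pos] with m hm
  have hlt : L * (m + 1) < 2 ^ m := by
    have : ((L * (m + 1) : ℕ) : ℝ) < ((2 ^ m : ℕ) : ℝ) := by
      push_cast
      have h4 : (0 : ℝ) < 2 ^ m := by positivity
      rw [div_pow, one_pow, pow_one, mul_div_assoc', mul_div_assoc', ← add_div, div_lt_one h4] at hm
      linarith
    exact_mod_cast this
  calc A * a ^ m ≤ |A| * |a| ^ m := by
        rw [← abs_pow, ← abs_mul]; exact le_abs_self _
    _ ≤ 2 ^ L * (2 ^ L) ^ m := by gcongr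
    _ = 2 ^ (L * (m + 1)) := by rw [← pow_mul, ← pow_add]; ring_nf
    _ < 2 ^ 2 ^ m := pow_lt_pow_right₀ one_lt_two hlt

theorem norm_mul_sub_mul_sq_le {s : Type*} [Fintype s] (a b : EuclideanSpace ℂ s) (i j : s) :
    ‖a i * b j - a j * b i‖ ^ 2 ≤ 4 * (‖a‖ ^ 2 * ‖b‖ ^ 2 - ‖inner ℂ a b‖ ^ 2) := by
  by_cases ha : a = 0
  · simp [ha]
  have hpos : 0 < ‖a‖ := norm_pos_iff.2 ha
  set c : EuclideanSpace ℂ s := ((‖a‖ ^ 2 : ℝ) : ℂ) • b - inner ℂ a b • a with hc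
  have hcn : ‖c‖ ^ 2 = ‖a‖ ^ 2 * (‖a‖ ^ 2 * ‖b‖ ^ 2 - ‖inner ℂ a b‖ ^ 2) := by
    have hin : inner ℂ (((‖a‖ ^ 2 : ℝ) : ℂ) • b) (inner ℂ a b • a) =
        ((‖a‖ ^ 2 * ‖inner ℂ a b‖ ^ 2 : ℝ) : ℂ) := by
      rw [inner_smul_left, inner_smul_right, Complex.conj_ofReal, ← inner_conj_symm b a,
        Complex.mul_conj']
      push_cast
      ring
    rw [hc, norm_sub_sq (𝕜 := ℂ), hin, norm_smul, norm_smul, Complex.norm_real, Real.norm_eq_abs,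
      abs_of_nonneg (by positivity), RCLike.re_eq_complex_re, Complex.ofReal_re]
    ring
  have hid : ((‖a‖ ^ 2 : ℝ) : ℂ) * (a i * b j - a j * b i) = a i * c j - a j * c i := by
    simp only [hc, PiLp.sub_apply, PiLp.smul_apply, smul_eq_mul]
    ring
  have hle : ‖a‖ ^ 2 * ‖a i * b j - a j * b i‖ ≤ 2 * ‖a‖ * ‖c‖ := by
    have h1 := congrArg norm hid
    rw [norm_mul, Complex.norm_real, Real.norm_eq_abs, abs_of_nonneg (by positivity)] at h1
    rw [h1]
    refine (norm_sub_le _ _).trans ?_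
    rw [norm_mul, norm_mul]
    have h2 : ∀ k l, ‖a k‖ * ‖c l‖ ≤ ‖a‖ * ‖c‖ := fun k l =>
      mul_le_mul (PiLp.norm_apply_le a k) (PiLp.norm_apply_le c l) (norm_nonneg _) (norm_nonneg _)
    linarith [h2 i j, h2 j i]
  have hsq := pow_le_pow_left₀ (by positivity) hle 2
  rw [mul_pow, mul_pow, mul_pow, hcn] at hsq
  have h4 : 0 < (‖a‖ ^ 2) ^ 2 := by positivity
  refine le_of_mul_le_mul_left ?_ h4
  linarith

/-- A maximum principle for `s ^ N / (P - y)` on the set where `r < |P - y| < ρ`. -/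
theorem norm_pow_le_of_forall_norm_sub_eq {s P : ℂ → ℂ} (hs : Differentiable ℂ s)
    (hP : Differentiable ℂ P) {y x : ℂ} {r ρ D L B : ℝ} (N : ℕ) (hr : 0 < r)
    (hbdd : Bornology.IsBounded {x | ‖P x - y‖ < ρ}) (hx1 : r < ‖P x - y‖)
    (hx2 : ‖P x - y‖ < ρ) (hxD : ‖P x - y‖ ≤ D)
    (hL : ∀ x, ‖P x - y‖ = r → ‖s x‖ ≤ L) (hB : ∀ x, ‖P x - y‖ = ρ → ‖s x‖ ≤ B) :
    ‖s x‖ ^ N ≤ D * max (L ^ N / r) (B ^ N / ρ) := by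
  have hrρ : r < ρ := hx1.trans hx2
  have hc : Continuous fun x => ‖P x - y‖ := (hP.continuous.sub continuous_const).norm
  set U : Set ℂ := (fun x => ‖P x - y‖) ⁻¹' Ioo r ρ with hU
  have hcl : ∀ x ∈ closure U, r ≤ ‖P x - y‖ := fun x hx => by
    have h1 := hc.closure_preimage_subset _ hx
    rw [closure_Ioo hrρ.ne] at h1
    exact h1.1
  have hmax := Complex.norm_le_of_forall_mem_frontier_norm_le (U := U)
    (f := fun x => s x ^ N / (P x - y)) (C := max (L ^ N / r) (B ^ N / ρ)) (z := x)
    (hbdd.subset fun x hx => hx.2)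
    (DifferentiableOn.diffContOnCl (by
      refine DifferentiableOn.fun_div (hs.pow N).differentiableOn
        (hP.sub_const y).differentiableOn fun x hx => ?_
      exact norm_pos_iff.1 (hr.trans_le (hcl x hx)))) (by
      intro x hx
      have h1 := hc.frontier_preimage_subset _ hx
      rw [frontier_Ioo hrρ] at h1
      rw [norm_div, norm_pow]
      rcases h1 with h1 | h1
      · have h1 : ‖P x - y‖ = r := h1
        rw [h1]
        exact le_max_of_le_left (by gcongr; exact hL x h1)
      · have h1 : ‖P x - y‖ = ρ := h1
        rw [h1]
        have := hr.trans hrρ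
        exact le_max_of_le_right (by gcongr; exact hB x h1))
    (subset_closure ⟨hx1, hx2⟩)
  have hpos := hr.trans hx1
  rw [norm_div, norm_pow, div_le_iff₀ hpos] at hmax
  have h0 : 0 ≤ max (L ^ N / r) (B ^ N / ρ) :=
    nonneg_of_mul_nonneg_left ((by positivity : (0 : ℝ) ≤ ‖s x‖ ^ N).trans hmax) hpos
  rw [mul_comm]
  exact hmax.trans (mul_le_mul_of_nonneg_left hxD h0)

theorem apply_pow_eq_prod_mul {V : Type*} [NormedAddCommGroup V] [NormedSpace ℂ V]
    {ι : V →ₗ[ℂ] (Fin 2 → ℂ) → ℂ} {T : V →L[ℂ] V} {u : (Fin 2 → ℂ) → ℂ}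
    {φ : (Fin 2 → ℂ) → Fin 2 → ℂ} (hT : ∀ v z, ι (T v) z = u z * ι v (φ z)) (m : ℕ) (v : V)
    (z : Fin 2 → ℂ) :
    ι ((T ^ m) v) z = (∏ k ∈ Finset.range m, u (φ^[k] z)) * ι v (φ^[m] z) := by
  induction m generalizing v with
  | zero => simp
  | succ m ih =>
    rw [pow_succ, mul_apply_eq_comp, ih, hT, Finset.prod_range_succ,
      Function.iterate_succ_apply', mul_assoc]

theorem norm_pow_apply_le_s8 {V : Type*} [NormedAddCommGroup V] [NormedSpace ℂ V] (T : V →L[ℂ] V)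
    (m : ℕ) (v : V) : ‖(T ^ m) v‖ ≤ ‖T‖ ^ m * ‖v‖ := by
  induction m generalizing v with
  | zero => simp
  | succ m ih =>
    rw [pow_succ, mul_apply_eq_comp, pow_succ, mul_assoc]
    exact (ih _).trans (mul_le_mul_of_nonneg_left (T.le_opNorm v) (by positivity))

/-- The vector of values at `z` of finitely many elements of a function space. -/
noncomputable def evalVec {V : Type*} (ι : V → (Fin 2 → ℂ) → ℂ) (S : Finset V) (z : Fin 2 → ℂ) :
    EuclideanSpace ℂ S := WithLp.toLp 2 fun v => ι v z

theorem continuous_evalVec {V : Type*} {ι : V → (Fin 2 → ℂ) → ℂ} (hent : ∀ v, Continuous (ι v))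
    (S : Finset V) : Continuous (evalVec ι S) := by
  unfold evalVec
  exact (PiLp.continuous_toLp 2 _).comp (continuous_pi fun v => hent v)

/-- The element of `V` representing the inner product against the values at `z`. -/
noncomputable def dualVec {V : Type*} [NormedAddCommGroup V] [NormedSpace ℂ V]
    (ι : V → (Fin 2 → ℂ) → ℂ) (S : Finset V) (z : Fin 2 → ℂ) : V :=
  ∑ v : S, (starRingEnd ℂ) (ι v z) • (v : V)

theorem apply_dualVec {V : Type*} [NormedAddCommGroup V] [NormedSpace ℂ V]
    (ι : V →ₗ[ℂ] (Fin 2 → ℂ) → ℂ) (S : Finset V) (z y : Fin 2 → ℂ) :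
    ι (dualVec ι S z) y = inner ℂ (evalVec ι S z) (evalVec ι S y) := by
  simp only [dualVec, map_sum, map_smul, Finset.sum_apply, Pi.smul_apply, smul_eq_mul, evalVec,
    PiLp.inner_apply, RCLike.inner_apply]
  exact Finset.sum_congr rfl fun v _ => mul_comm _ _

theorem norm_dualVec_le {V : Type*} [NormedAddCommGroup V] [NormedSpace ℂ V]
    (ι : V → (Fin 2 → ℂ) → ℂ) (S : Finset V) (z : Fin 2 → ℂ) :
    ‖dualVec ι S z‖ ≤ ‖evalVec ι S z‖ * ∑ v : S, ‖(v : V)‖ := by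
  rw [dualVec, Finset.mul_sum]
  refine (norm_sum_le _ _).trans (Finset.sum_le_sum fun v _ => ?_)
  rw [norm_smul, RCLike.norm_conj]
  exact mul_le_mul_of_nonneg_right (PiLp.norm_apply_le (evalVec ι S z) v) (norm_nonneg _)

theorem exists_sq_bound {ε : ℝ} (hε : 0 < ε) (n : ℝ) :
    ∃ θ : ℝ, 0 < θ ∧ θ < 1 ∧ 4 * (1 - θ ^ 2) * n ≤ ε ^ 2 := by
  have h1 : Continuous fun θ : ℝ => 4 * (1 - θ ^ 2) * n := by fun_prop
  have h2 : ∀ᶠ θ in 𝓝[<] (1 : ℝ), 4 * (1 - θ ^ 2) * n < ε ^ 2 :=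
    (h1.continuousAt.eventually_lt continuousAt_const
      (by simpa using pow_pos hε 2)).filter_mono nhdsWithin_le_nhds
  obtain ⟨θ, h3, h4, h5⟩ := ((h2.and (Ioo_mem_nhdsLT (zero_lt_one : (0 : ℝ) < 1))).exists)
  exact ⟨θ, h4, h5, h3.le⟩

namespace IsConeExpanding

variable {V : Type*} [NormedAddCommGroup V] [NormedSpace ℂ V]
  {φ ψ : (Fin 2 → ℂ) → Fin 2 → ℂ} {X Y : (Fin 2 → ℂ) →L[ℂ] ℂ} {p q : Fin 2 → ℂ} {κ R : ℝ}
  {ι : V →ₗ[ℂ] (Fin 2 → ℂ) → ℂ} {T : V →L[ℂ] V} {u : (Fin 2 → ℂ) → ℂ}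

theorem exists_pow_le_norm_prod (h : IsConeExpanding φ ψ X Y p q κ R) (hu : Continuous u)
    (hu0 : ∀ z, u z ≠ 0) : ∃ δ > 0, ∀ (m : ℕ) (x : ℂ), ‖X (φ^[m] (x • p))‖ ≤ R →
      δ ^ m ≤ ‖∏ k ∈ Finset.range m, u (φ^[k] (x • p))‖ := by
  have hR := h.one_le
  have hK := h.coords.isCompact (isCompact_closedBall (0 : ℂ) R) (isCompact_closedBall (0 : ℂ) R)
  obtain ⟨w, hw, hmin⟩ := hK.exists_isMinOn
    ⟨0, by simp; linarith⟩ hu.norm.continuousOn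
  refine ⟨‖u w‖, norm_pos_iff.2 (hu0 w), fun m x hx => ?_⟩
  rw [norm_prod]
  calc ‖u w‖ ^ m = ∏ k ∈ Finset.range m, ‖u w‖ := by simp
    _ ≤ _ := by
      refine Finset.prod_le_prod (fun _ _ => norm_nonneg _) fun k hk => hmin ?_
      have := h.iterate_mem_bidisc (Finset.mem_range.1 hk).le hx
      simpa using this

theorem exists_norm_apply_le (h : IsConeExpanding φ ψ X Y p q κ R)
    (hbd : ∀ K : Set (Fin 2 → ℂ), IsCompact K →
      ∃ C : ℝ, 0 ≤ C ∧ ∀ v : V, ∀ z ∈ K, ‖ι v z‖ ≤ C * ‖v‖) (T : V →L[ℂ] V) :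
    ∃ C : ℝ, 0 ≤ C ∧ ∀ (m : ℕ) (v : V) (x : ℂ), κ * ‖X (φ^[m] (x • p))‖ < 2 ^ 2 ^ m →
      ‖ι ((T ^ m) v) (x • p)‖ ≤ C * (‖T‖ ^ m * ‖v‖) := by
  have hK : IsCompact ((fun x : ℂ => x • p) '' Metric.closedBall 0 R) :=
    (isCompact_closedBall (0 : ℂ) R).image (by fun_prop)
  obtain ⟨C, hC0, hC⟩ := hbd _ hK
  refine ⟨C, hC0, fun m v x hx => ?_⟩
  have hxR : ‖x‖ ≤ R := by
    by_contra! hlt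
    exact absurd hx (not_lt.2 (h.two_pow_le_of_le hlt.le m))
  refine (hC _ _ ⟨x, by simpa using hxR, rfl⟩).trans ?_
  exact mul_le_mul_of_nonneg_left (norm_pow_apply_le_s8 T m v) hC0

set_option maxHeartbeats 800000 in
/-- Approximate collinearity of evaluation functionals over a disc of `X`-values. -/
theorem exists_approx_collinear (h : IsConeExpanding φ ψ X Y p q κ R)
    (hent : ∀ v : V, Differentiable ℂ (ι v))
    (hbd : ∀ K : Set (Fin 2 → ℂ), IsCompact K →
      ∃ C : ℝ, 0 ≤ C ∧ ∀ v : V, ∀ z ∈ K, ‖ι v z‖ ≤ C * ‖v‖)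
    (hu : Continuous u) (hu0 : ∀ z, u z ≠ 0) (hT : ∀ v z, ι (T v) z = u z * ι v (φ z))
    {y₀ : ℂ} {r₀ : ℝ} (hr₀ : 0 < r₀) (hsub : ∀ y ∈ Metric.closedBall y₀ r₀, ‖y‖ ≤ R)
    {S : Finset V}
    (hS : ∀ z, X z ∈ Metric.closedBall y₀ r₀ → Y z ∈ Metric.closedBall 0 R → ∃ v ∈ S, ι v z ≠ 0)
    {ε : ℝ} (hε : 0 < ε) :
    ∃ z₀, (X z₀ ∈ Metric.closedBall y₀ r₀ ∧ Y z₀ ∈ Metric.closedBall 0 R) ∧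
      ∀ y ∈ Metric.closedBall y₀ (r₀ / 2), ∃ z,
        (X z ∈ Metric.closedBall y₀ r₀ ∧ Y z ∈ Metric.closedBall 0 R) ∧ ‖X z - y‖ ≤ ε ∧
        ∀ v ∈ S, ∀ w ∈ S, ‖ι v z₀ * ι w z - ι w z₀ * ι v z‖ ≤ ε := by
  have hR := h.one_le
  have hκ := h.kappa_pos
  set K : Set (Fin 2 → ℂ) := {z | X z ∈ Metric.closedBall y₀ r₀ ∧ Y z ∈ Metric.closedBall 0 R}
    with hKdef
  have hKc : IsCompact K :=
    h.coords.isCompact (isCompact_closedBall _ _) (isCompact_closedBall _ _)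
  have ha : Continuous (evalVec ι S) := continuous_evalVec (fun v => (hent v).continuous) S
  have hapos : ∀ z ∈ K, 0 < ‖evalVec ι S z‖ := fun z hz => by
    obtain ⟨v, hv, hne⟩ := hS z hz.1 hz.2
    refine norm_pos_iff.2 fun h0 => hne ?_
    simpa [evalVec] using congrArg (fun a : EuclideanSpace ℂ S => a ⟨v, hv⟩) h0
  have hKne : K.Nonempty := ⟨y₀ • p, by
    simp [hKdef, h.coords.apply_fst, h.coords.snd_apply_fst, hr₀.le]; linarith⟩
  obtain ⟨z₁, hz₁, hmin⟩ := hKc.exists_isMinOn hKne ha.norm.continuousOn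
  obtain ⟨z₂, hz₂, hmax⟩ := hKc.exists_isMaxOn hKne ha.norm.continuousOn
  set n₀ := ‖evalVec ι S z₁‖ with hn₀
  set n₁ := ‖evalVec ι S z₂‖ with hn₁
  have hn₀pos : 0 < n₀ := hapos z₁ hz₁
  obtain ⟨θ, hθ0, hθ1, hθ⟩ := exists_sq_bound hε (n₁ ^ 2 * n₁ ^ 2)
  set r := min ε (r₀ / 2) with hr
  have hrpos : 0 < r := lt_min hε (half_pos hr₀)
  obtain ⟨N, hN⟩ := exists_pow_lt_of_lt_one (by positivity : 0 < r / (2 * r₀)) hθ1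
  obtain ⟨δ, hδ, hprod⟩ := h.exists_pow_le_norm_prod hu hu0
  obtain ⟨C, hC0, hC⟩ := h.exists_norm_apply_le hbd T
  set A := n₁ * ∑ v : S, ‖(v : V)‖ with hA
  have hA0 : 0 ≤ A := by positivity
  obtain ⟨m, hm1, hm2⟩ := ((eventually_mul_pow_lt_two_pow_two_pow
    (4 * κ * (r₀ * ((C * A) ^ N / (n₀ ^ 2) ^ N))) ((‖T‖ / δ) ^ N)).and
    (eventually_mul_pow_lt_two_pow_two_pow (4 * κ * (R + 2 * r₀)) 1)).exists
  rw [one_pow, mul_one] at hm2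
  set ρ : ℝ := 2 ^ 2 ^ m / (2 * κ) with hρ
  have hρ' : (2 : ℝ) ^ 2 ^ m = 2 * κ * ρ := by rw [hρ]; field_simp
  rw [hρ'] at hm1 hm2
  have hρR : 2 * (R + 2 * r₀) < ρ := by
    have : 2 * κ * (2 * (R + 2 * r₀)) < 2 * κ * ρ := by linarith
    exact lt_of_mul_lt_mul_left this (by positivity)
  have hρpos : 0 < ρ := by linarith
  set P : ℂ → ℂ := fun x => X (φ^[m] (x • p)) with hP
  have hPd : Differentiable ℂ P := by
    have := h.differentiable_iterate m
    fun_prop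
  set U : ℂ → ℂ := fun x => ∏ k ∈ Finset.range m, u (φ^[k] (x • p)) with hUdef
  have hUc : Continuous U := by
    refine continuous_finsetProd _ fun k _ => ?_
    exact hu.comp (h.differentiable_iterate k).continuous
  have hU0 : ∀ x, U x ≠ 0 := fun x => Finset.prod_ne_zero_iff.2 fun k _ => hu0 _
  have hlt : ∀ x, ‖P x‖ < 2 * ρ → κ * ‖P x‖ < 2 ^ 2 ^ m := fun x hx => by
    rw [hρ']; nlinarith
  have hbdd : ∀ c < 2 * ρ, ∀ y : ℂ, ‖y‖ ≤ 2 * ρ - c →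
      Bornology.IsBounded {x | ‖P x - y‖ < c} := fun c hc y hy => by
    refine (Metric.isBounded_closedBall (x := (0 : ℂ)) (r := R)).subset fun x hx => ?_
    have hx : ‖P x - y‖ < c := hx
    rw [mem_closedBall_zero_iff]
    by_contra! hcon
    refine absurd (hlt x ?_) (not_lt.2 (h.two_pow_le_of_le hcon.le m))
    have := norm_sub_norm_le (P x) y
    linarith
  have hQK : ∀ x, P x ∈ Metric.closedBall y₀ r₀ → φ^[m] (x • p) ∈ K := fun x hx =>
    ⟨hx, by simpa using (h.iterate_mem_bidisc le_rfl (hsub _ hx)).2⟩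
  have hy₀ : ‖y₀‖ ≤ R := hsub _ (by simp [hr₀.le])
  have hcompact : IsCompact (P ⁻¹' Metric.closedBall y₀ r₀) := by
    refine Metric.isCompact_of_isClosed_isBounded
      (Metric.isClosed_closedBall.preimage hPd.continuous) ?_
    refine (hbdd (r₀ + 1) (by linarith) y₀ (by linarith)).subset fun x hx => ?_
    have hx : ‖P x - y₀‖ ≤ r₀ := by simpa [dist_eq_norm] using hx
    exact hx.trans_lt (by linarith)
  obtain ⟨x', hx'⟩ := h.exists_apply_eq m y₀
  obtain ⟨x₀, hx₀, hx₀max⟩ := hcompact.exists_isMaxOn (f := fun x => ‖U x‖ *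
    ‖evalVec ι S (φ^[m] (x • p))‖) ⟨x', by simp [hP, hx', hr₀.le]⟩
    (hUc.norm.mul (ha.comp (h.differentiable_iterate m).continuous).norm).continuousOn
  set z₀ := φ^[m] (x₀ • p) with hz₀
  have hz₀K : z₀ ∈ K := hQK x₀ hx₀
  refine ⟨z₀, hz₀K, fun y hy => ?_⟩
  set a₀ := evalVec ι S z₀ with ha₀
  have ha₀pos : 0 < ‖a₀‖ := hapos z₀ hz₀K
  set s : ℂ → ℂ := fun x => ι ((T ^ m) (dualVec ι S z₀)) (x • p) with hs
  have hsd : Differentiable ℂ s := by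
    have := hent ((T ^ m) (dualVec ι S z₀))
    fun_prop
  have hsval : ∀ x, s x = U x * inner ℂ a₀ (evalVec ι S (φ^[m] (x • p))) := fun x => by
    rw [hs]
    simp only
    rw [apply_pow_eq_prod_mul hT, apply_dualVec]
  set M := ‖s x₀‖ with hM
  have hMval : M = ‖U x₀‖ * ‖a₀‖ * ‖a₀‖ := by
    rw [hM, hsval, norm_mul, ← hz₀, ← ha₀, inner_self_eq_norm_sq_to_K, norm_pow, RCLike.norm_ofReal,
      abs_of_pos ha₀pos]
    ring
  have hMpos : 0 < M := by
    rw [hMval]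
    have := norm_pos_iff.2 (hU0 x₀)
    positivity
  have hMlow : δ ^ m * n₀ ^ 2 ≤ M := by
    rw [hMval, mul_assoc, ← sq]
    have h1 := hprod m x₀ (hsub _ hx₀)
    have h2 : n₀ ≤ ‖a₀‖ := hmin hz₀K
    gcongr
  have hyy₀ : ‖y - y₀‖ ≤ r₀ / 2 := by simpa [dist_eq_norm] using hy
  have hyR : ‖y‖ ≤ R := hsub _ (Metric.closedBall_subset_closedBall (by linarith) hy)
  obtain ⟨x₁, hx₁y, hx₁M⟩ : ∃ x₁, ‖P x₁ - y‖ ≤ r ∧ θ * M < ‖s x₁‖ := by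
    by_contra! hcon
    have hPx₀ : ‖P x₀ - y₀‖ ≤ r₀ := by simpa [dist_eq_norm] using hx₀
    have hD : ‖P x₀ - y‖ ≤ 2 * r₀ := by
      calc ‖P x₀ - y‖ = ‖(P x₀ - y₀) - (y - y₀)‖ := by congr 1; ring
        _ ≤ ‖P x₀ - y₀‖ + ‖y - y₀‖ := norm_sub_le _ _
        _ ≤ 2 * r₀ := by linarith
    have hB : ∀ x, ‖P x - y‖ = ρ → ‖s x‖ ≤ C * (‖T‖ ^ m * A) := fun x hx => by
      have h1 := norm_sub_norm_le (P x) y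
      refine (hC m _ x (hlt x (by linarith))).trans ?_
      have h2 : ‖dualVec ι S z₀‖ ≤ A := (norm_dualVec_le ι S z₀).trans
        (mul_le_mul_of_nonneg_right (hmax hz₀K) (by positivity))
      gcongr
    have hfar : r < ‖P x₀ - y‖ := by
      by_contra! hle
      have h1 := hcon x₀ hle
      have h2 : θ * M < 1 * M := mul_lt_mul_of_pos_right hθ1 hMpos
      rw [one_mul] at h2
      exact absurd h1 (not_le.2 h2)
    have hmm := norm_pow_le_of_forall_norm_sub_eq hsd hPd N hrpos
      (hbdd ρ (by linarith) y (by linarith)) hfar (by linarith) hD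
      (fun x hx => hcon x hx.le) hB
    refine absurd hmm (not_le.2 ?_)
    rw [← hM, mul_max_of_nonneg _ _ (by positivity)]
    refine max_lt ?_ ?_
    · rw [lt_div_iff₀ (by positivity)] at hN
      rw [mul_pow, mul_div_assoc', div_lt_iff₀ hrpos]
      have := mul_lt_mul_of_pos_right hN (pow_pos hMpos N)
      linarith
    · rw [mul_div_assoc', div_lt_iff₀ hρpos]
      have h1 : (δ ^ m * n₀ ^ 2) ^ N ≤ M ^ N := pow_le_pow_left₀ (by positivity) hMlow N
      refine lt_of_lt_of_le ?_ (mul_le_mul_of_nonneg_right h1 hρpos.le)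
      have h2 : 2 * κ * (2 * r₀ * (C * (‖T‖ ^ m * A)) ^ N / (δ ^ m * n₀ ^ 2) ^ N) <
          2 * κ * ρ := by
        refine lt_of_eq_of_lt ?_ hm1
        rw [div_pow, div_pow, mul_pow, mul_pow, mul_pow, mul_pow, ← pow_mul, ← pow_mul, ← pow_mul,
          ← pow_mul, mul_comm N m]
        field_simp
        ring
      have h3 := lt_of_mul_lt_mul_left h2 (by positivity)
      rw [div_lt_iff₀ (by positivity)] at h3
      linarith
  have hx₁K : P x₁ ∈ Metric.closedBall y₀ r₀ := by
    rw [mem_closedBall_iff_norm]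
    calc ‖P x₁ - y₀‖ = ‖(P x₁ - y) + (y - y₀)‖ := by congr 1; ring
      _ ≤ ‖P x₁ - y‖ + ‖y - y₀‖ := norm_add_le _ _
      _ ≤ r₀ := by
        have := min_le_right ε (r₀ / 2)
        linarith
  set z := φ^[m] (x₁ • p) with hz
  have hzK : z ∈ K := hQK x₁ hx₁K
  refine ⟨z, hzK, hx₁y.trans (min_le_left _ _), fun v hv w hw => ?_⟩
  set a := evalVec ι S z with ha'
  have hU1 : 0 < ‖U x₁‖ := norm_pos_iff.2 (hU0 x₁)
  have hinner : θ * (‖a₀‖ * ‖a‖) ≤ ‖inner ℂ a₀ a‖ := by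
    rw [hsval, norm_mul, hMval] at hx₁M
    have h1 : ‖U x₁‖ * ‖a‖ ≤ ‖U x₀‖ * ‖a₀‖ := hx₀max hx₁K
    refine le_of_mul_le_mul_left ?_ hU1
    calc ‖U x₁‖ * (θ * (‖a₀‖ * ‖a‖)) = θ * ((‖U x₁‖ * ‖a‖) * ‖a₀‖) := by ring
      _ ≤ θ * ((‖U x₀‖ * ‖a₀‖) * ‖a₀‖) := by gcongr
      _ ≤ _ := hx₁M.le
  have hlag := norm_mul_sub_mul_sq_le a₀ a ⟨v, hv⟩ ⟨w, hw⟩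
  refine (sq_le_sq₀ (norm_nonneg _) hε.le).1 ?_
  have h1 : (θ * (‖a₀‖ * ‖a‖)) ^ 2 ≤ ‖inner ℂ a₀ a‖ ^ 2 :=
    pow_le_pow_left₀ (by positivity) hinner 2
  have h2 : ‖a₀‖ ≤ n₁ := hmax hz₀K
  have h3 : ‖a‖ ≤ n₁ := hmax hzK
  have h4 : ‖a₀‖ ^ 2 * ‖a‖ ^ 2 ≤ n₁ ^ 2 * n₁ ^ 2 := by gcongr
  have h5 : 0 ≤ 4 * (1 - θ ^ 2) :=
    mul_nonneg zero_le_four (sub_nonneg.2 (pow_le_one₀ hθ0.le hθ1.le))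
  have h6 := mul_le_mul_of_nonneg_left h4 h5
  rw [mul_pow, mul_pow] at h1
  refine hlag.trans ?_
  linarith

end IsConeExpanding

theorem IsCompact.finite_inter_of_eventually_notMem {E : Type*} [TopologicalSpace E] {K B : Set E}
    (hK : IsCompact K) (hB : ∀ q ∈ K, ∀ᶠ q' in 𝓝[≠] q, q' ∉ B) : (K ∩ B).Finite := by
  by_contra hinf
  obtain ⟨x, hxK, hx⟩ :=
    Set.Infinite.exists_accPt_of_subset_isCompact hinf hK inter_subset_left
  rw [accPt_iff_frequently_nhdsNE] at hx
  obtain ⟨y, hy, hy'⟩ := (hx.and_eventually (hB x hxK)).exists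
  exact hy' hy.2

/-- Pairs of points, one over each point of a parameter set, whose evaluation functionals are
approximately collinear to that of a base point converge to exactly collinear ones. -/
theorem exists_collinear_of_forall_approx {V E : Type*} [TopologicalSpace E]
    {ev : V → E → ℂ} (hev : ∀ v, Continuous (ev v)) {K : Set E} (hK : IsCompact K)
    {X : E → ℂ} (hX : Continuous X) {D : Set ℂ} {S₀ : Finset V}
    (happrox : ∀ S : Finset V, S₀ ⊆ S → ∀ ε > 0, ∃ z₀ ∈ K, ∀ y ∈ D, ∃ z ∈ K, ‖X z - y‖ ≤ ε ∧
      ∀ v ∈ S, ∀ w ∈ S, ‖ev v z₀ * ev w z - ev w z₀ * ev v z‖ ≤ ε) :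
    ∃ z₀ ∈ K, ∀ y ∈ D, ∃ z ∈ K, X z = y ∧ ∀ v w, ev v z₀ * ev w z = ev w z₀ * ev v z := by
  classical
  have hpos : ∀ n : ℕ, 0 < 1 / ((n : ℝ) + 1) := fun n => Nat.one_div_pos_of_nat
  choose Z hZK B hB using fun i : Finset V × ℕ =>
    happrox (i.1 ∪ S₀) Finset.subset_union_right _ (hpos i.2)
  set 𝒰 : Ultrafilter (Finset V × ℕ) := Ultrafilter.of atTop with h𝒰
  have hle : (𝒰 : Filter (Finset V × ℕ)) ≤ atTop := Ultrafilter.of_le _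
  have hzero : Tendsto (fun i : Finset V × ℕ => 1 / ((i.2 : ℝ) + 1)) 𝒰 (𝓝 0) := by
    have h1 : Tendsto (fun i : Finset V × ℕ => i.2) 𝒰 atTop := by
      refine Tendsto.mono_left ?_ hle
      rw [← prod_atTop_atTop_eq]
      exact tendsto_snd
    exact tendsto_one_div_add_atTop_nhds_zero_nat.comp h1
  obtain ⟨z₀, hz₀K, hz₀⟩ := hK.ultrafilter_le_nhds (𝒰.map Z)
    (le_principal_iff.2 (eventually_map.2 (Eventually.of_forall hZK)))
  have hz₀ : Tendsto Z 𝒰 (𝓝 z₀) := hz₀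
  refine ⟨z₀, hz₀K, fun y hy => ?_⟩
  have hBK : ∀ i, B i y hy ∈ K := fun i => (hB i y hy).1
  obtain ⟨z, hzK, hz⟩ := hK.ultrafilter_le_nhds (𝒰.map fun i => B i y hy)
    (le_principal_iff.2 (eventually_map.2 (Eventually.of_forall hBK)))
  have hz : Tendsto (fun i => B i y hy) 𝒰 (𝓝 z) := hz
  refine ⟨z, hzK, ?_, fun v w => ?_⟩
  · have h1 : Tendsto (fun i => ‖X (B i y hy) - y‖) 𝒰 (𝓝 ‖X z - y‖) :=
      (((hX.tendsto z).comp hz).sub_const y).norm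
    have h2 := le_of_tendsto_of_tendsto' h1 hzero fun i => (hB i y hy).2.1
    exact sub_eq_zero.1 (norm_le_zero_iff.1 h2)
  · have h1 : Tendsto (fun i => ‖ev v (Z i) * ev w (B i y hy) - ev w (Z i) * ev v (B i y hy)‖) 𝒰
        (𝓝 ‖ev v z₀ * ev w z - ev w z₀ * ev v z‖) :=
      ((((hev v).tendsto z₀).comp hz₀).mul (((hev w).tendsto z).comp hz)).sub
        ((((hev w).tendsto z₀).comp hz₀).mul (((hev v).tendsto z).comp hz)) |>.norm
    have h2 : ∀ᶠ i : Finset V × ℕ in 𝒰, ({v, w}, 0) ≤ i := hle (eventually_ge_atTop _)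
    have h3 := le_of_tendsto_of_tendsto h1 hzero (h2.mono fun i hi => by
      have hi1 : {v, w} ⊆ i.1 := hi.1
      exact (hB i y hy).2.2 v (Finset.mem_union_left _ (hi1 (by simp))) w
        (Finset.mem_union_left _ (hi1 (by simp))))
    exact sub_eq_zero.1 (norm_le_zero_iff.1 h3)

/-- A cone expanding map carries no bounded nonvanishing weighted composition operator on a space
of entire functions separating nearby points. -/
theorem IsConeExpanding.not_separating {V : Type*} [NormedAddCommGroup V] [NormedSpace ℂ V]
    {φ ψ : (Fin 2 → ℂ) → Fin 2 → ℂ} {X Y : (Fin 2 → ℂ) →L[ℂ] ℂ} {p q : Fin 2 → ℂ} {κ R : ℝ}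
    {ι : V →ₗ[ℂ] (Fin 2 → ℂ) → ℂ} {T : V →L[ℂ] V} {u : (Fin 2 → ℂ) → ℂ}
    (h : IsConeExpanding φ ψ X Y p q κ R) (hent : ∀ v : V, Differentiable ℂ (ι v))
    (hbd : ∀ K : Set (Fin 2 → ℂ), IsCompact K →
      ∃ C : ℝ, 0 ≤ C ∧ ∀ v : V, ∀ z ∈ K, ‖ι v z‖ ≤ C * ‖v‖)
    (hu : Continuous u) (hu0 : ∀ z, u z ≠ 0) (hT : ∀ v z, ι (T v) z = u z * ι v (φ z)) :
    ¬ ∀ a, ∀ᶠ a' in 𝓝[≠] a, ∃ v, ι v a = 0 ∧ ι v a' ≠ 0 := by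
  intro hsep
  have hR := h.one_le
  have hc : ∀ v, Continuous (ι v) := fun v => (hent v).continuous
  have hfin := (h.coords.isCompact (isCompact_closedBall (0 : ℂ) R)
    (isCompact_closedBall (0 : ℂ) R)).finite_inter_of_eventually_notMem (B := {a | ∀ v, ι v a = 0})
    fun a _ => (hsep a).mono fun a' ⟨v, _, hv⟩ hall => hv (hall v)
  have hfinX := hfin.image X
  obtain ⟨y₀, hy₀⟩ := ((infinite_of_mem_nhds (0 : ℂ)
    (Metric.ball_mem_nhds 0 (by linarith : 0 < R))).sdiff hfinX).nonempty
  obtain ⟨r₀, hr₀, hball⟩ := Metric.nhds_basis_closedBall.mem_iff.1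
    ((Metric.isOpen_ball.sdiff hfinX.isClosed).mem_nhds hy₀)
  have hsub : ∀ y ∈ Metric.closedBall y₀ r₀, ‖y‖ ≤ R := fun y hy => by
    simpa using (mem_ball_zero_iff.1 (hball hy).1).le
  set K : Set (Fin 2 → ℂ) := {z | X z ∈ Metric.closedBall y₀ r₀ ∧ Y z ∈ Metric.closedBall 0 R}
    with hKdef
  have hK : IsCompact K := h.coords.isCompact (isCompact_closedBall _ _) (isCompact_closedBall _ _)
  have hbase : ∀ z ∈ K, ∃ v, ι v z ≠ 0 := fun z hz => by
    by_contra! hall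
    exact (hball hz.1).2 ⟨z, ⟨⟨by simpa using hsub _ hz.1, hz.2⟩, hall⟩, rfl⟩
  obtain ⟨S₀, hS₀⟩ := hK.elim_finite_subcover (fun v => {z | ι v z ≠ 0})
    (fun v => isOpen_ne_fun (hc v) continuous_const) fun z hz => by
      simpa using hbase z hz
  obtain ⟨z₀, hz₀K, hz₀⟩ := exists_collinear_of_forall_approx hc hK X.continuous (S₀ := S₀)
    (D := Metric.closedBall y₀ (r₀ / 2)) fun S hS ε hε =>
      h.exists_approx_collinear hent hbd hu hu0 hT hr₀ hsub (fun z hz hz' => by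
        obtain ⟨v, hv, hne⟩ := mem_iUnion₂.1 (hS₀ (show z ∈ K from ⟨hz, hz'⟩))
        exact ⟨v, hS hv, hne⟩) hε
  set A := {z ∈ K | ∀ v w, ι v z₀ * ι w z = ι w z₀ * ι v z} with hA
  have hAinf : A.Infinite := by
    refine Set.Infinite.of_image X ((infinite_of_mem_nhds y₀
      (Metric.closedBall_mem_nhds y₀ (half_pos hr₀))).mono fun y hy => ?_)
    obtain ⟨z, hzK, hzy, hz⟩ := hz₀ y hy
    exact ⟨z, ⟨hzK, hz⟩, hzy⟩
  obtain ⟨a, haK, ha⟩ := hAinf.exists_accPt_of_subset_isCompact hK fun z hz => hz.1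
  have hacl : a ∈ closure A := by
    rw [accPt_iff_frequently_nhdsNE] at ha
    exact mem_closure_iff_frequently.2 (ha.filter_mono nhdsWithin_le_nhds)
  have hac : ∀ v w, ι v z₀ * ι w a = ι w z₀ * ι v a := fun v w => by
    have hcl : IsClosed {z | ι v z₀ * ι w z = ι w z₀ * ι v z} :=
      isClosed_eq (continuous_const.mul (hc w)) (continuous_const.mul (hc v))
    exact hcl.closure_subset_iff.2 (fun z hz => hz.2 v w) hacl
  rw [accPt_iff_frequently_nhdsNE] at ha
  obtain ⟨a', ha'A, v, hva, hva'⟩ := (ha.and_eventually (hsep a)).exists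
  obtain ⟨w, hw⟩ := hbase a haK
  obtain ⟨w', hw'⟩ := hbase z₀ hz₀K
  have hv₀ : ι v z₀ = 0 := by
    have := hac v w
    rw [hva, mul_zero] at this
    exact (mul_eq_zero.1 this).resolve_right hw
  have := ha'A.2 v w'
  rw [hv₀, zero_mul] at this
  exact (mul_ne_zero hw' hva') this.symm

theorem exists_eval_mulVec_sub {g : (Fin 2 → ℂ) → Fin 2 → ℂ} {Q : Fin 2 → MvPolynomial (Fin 2) ℂ}
    (hg : ∀ z i, g z i = MvPolynomial.eval z (Q i)) (B : Matrix (Fin 2) (Fin 2) ℂ)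
    (b : Fin 2 → ℂ) : ∃ Q' : Fin 2 → MvPolynomial (Fin 2) ℂ,
      ∀ z i, g (B.mulVec (z - b)) i = MvPolynomial.eval z (Q' i) := by
  refine ⟨fun i => MvPolynomial.bind₁ (fun j => ∑ k, MvPolynomial.C (B j k) *
    (MvPolynomial.X k - MvPolynomial.C (b k))) (Q i), fun z i => ?_⟩
  rw [hg, ← MvPolynomial.coe_aeval_eq_eval z, RingHom.coe_coe, MvPolynomial.aeval_bind₁,
    ← MvPolynomial.coe_aeval_eq_eval (B.mulVec (z - b)), RingHom.coe_coe]
  congr 2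
  ext j
  simp [Matrix.mulVec, dotProduct]

theorem exists_affine_of_inverse {f g : (Fin 2 → ℂ) → Fin 2 → ℂ} (hgf : ∀ z, g (f z) = z)
    (hfg : ∀ z, f (g z) = z)
    (hg : ∃ (A : (Fin 2 → ℂ) →ₗ[ℂ] (Fin 2 → ℂ)) (b : Fin 2 → ℂ), ∀ z, g z = A z + b) :
    ∃ (A : (Fin 2 → ℂ) →ₗ[ℂ] (Fin 2 → ℂ)) (b : Fin 2 → ℂ), ∀ z, f z = A z + b := by
  obtain ⟨A, b, hA⟩ := hg
  have hinj : Function.Injective A := fun z z' h => by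
    rw [← hfg z, ← hfg z', hA, hA, h]
  set e := LinearEquiv.ofInjectiveEndo A hinj with he
  refine ⟨e.symm, -e.symm b, fun z => ?_⟩
  have h1 : e (f z) = z - b := by
    rw [eq_sub_iff_add_eq, he, LinearEquiv.coe_ofInjectiveEndo, ← hA, hgf]
  rw [LinearEquiv.coe_coe, ← sub_eq_add_neg, ← map_sub, ← h1, e.symm_apply_apply]

theorem exists_mem_planeDet_mulVec_ne_zero {G : Set (Matrix (Fin 2) (Fin 2) ℂ)}
    (hG : Submodule.span ℂ G = ⊤) {b c : Fin 2 → ℂ} (hb : b ≠ 0) (hc : c ≠ 0) :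
    ∃ A ∈ G, planeDet b (A.mulVec c) ≠ 0 := by
  by_contra! hcon
  have hall : ∀ A : Matrix (Fin 2) (Fin 2) ℂ, planeDet b (A.mulVec c) = 0 := fun A => by
    have hA : A ∈ Submodule.span ℂ G := hG ▸ Submodule.mem_top
    induction hA using Submodule.span_induction with
    | mem A hA => exact hcon A hA
    | zero => simp [planeDet]
    | add A B _ _ hA hB =>
      rw [Matrix.add_mulVec]
      simp only [planeDet, Pi.add_apply] at hA hB ⊢
      linear_combination hA + hB
    | smul s A _ hA =>
      rw [Matrix.smul_mulVec]
      have := planeDet_smul_smul 1 s b (A.mulVec c)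
      rwa [one_smul, hA, mul_zero] at this
  obtain ⟨k, hk⟩ := exists_planeDet_ne_zero hb
  obtain ⟨i, hi⟩ := Function.ne_iff.1 hc
  have := hall (Matrix.vecMulVec k (Pi.single i (c i)⁻¹))
  rw [Matrix.vecMulVec_mulVec, single_dotProduct, inv_mul_cancel₀ hi] at this
  simp only [MulOpposite.op_one, one_smul] at this
  refine hk ?_
  unfold planeDet at this ⊢
  linear_combination -this

namespace HasHomogeneousExpansion

variable {f g : (Fin 2 → ℂ) → Fin 2 → ℂ} {d e : ℕ} {F G : ℕ → (Fin 2 → ℂ) → Fin 2 → ℂ}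

theorem mulVec_add (hF : HasHomogeneousExpansion f d F) (A : Matrix (Fin 2) (Fin 2) ℂ)
    (b : Fin 2 → ℂ) : HasHomogeneousExpansion (fun z => A.mulVec (f z) + b) d
      fun j z => A.mulVec (F j z) + if j = 0 then b else 0 where
  differentiable j := by
    have h1 : Differentiable ℂ (LinearMap.toContinuousLinearMap A.mulVecLin) :=
      ContinuousLinearMap.differentiable _
    exact (h1.comp (hF.differentiable j)).add_const _
  map_smul j t z := by
    rw [hF.map_smul, Matrix.mulVec_smul, smul_add]
    split_ifs with hj
    · simp [hj]
    · simp
  eq_sum z := by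
    rw [hF.eq_sum, Finset.sum_add_distrib, Matrix.mulVec_sum]
    simp

theorem exists_leading_zeros_subset_line (hF : HasHomogeneousExpansion f d F)
    (hG : HasHomogeneousExpansion g e G) (hgf : ∀ z, g (f z) = z) (hfg : ∀ z, f (g z) = z)
    (hde : 1 < d * e) (hF0 : ∃ w, F d w ≠ 0) (hG0 : ∃ w, G e w ≠ 0) :
    ∃ (c : Fin 2 → ℂ) (h : (Fin 2 → ℂ) → ℂ) (b : Fin 2 → ℂ), c ≠ 0 ∧ b ≠ 0 ∧
      (∀ (t : ℂ) z, h (t • z) = t ^ d * h z) ∧ (∀ w, F d w = h w • c) ∧ (∃ w, h w ≠ 0) ∧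
      ∀ w, h w = 0 → planeDet b w = 0 := by
  obtain ⟨c, h, hc, hh, hhom, hFd, hh0⟩ := exists_leading_form (hF.differentiable d)
    (hF.map_smul d) (hG.differentiable e) (hG.map_smul e)
    (hF.leading_comp_leading hG hgf hde) hF0 hG0
  obtain ⟨b, hb, hzero⟩ := hF.exists_zeros_subset_line hG hgf hfg hc hh hhom hFd hh0
  exact ⟨c, h, b, hc, hb, hhom, hFd, hh0, hzero⟩

/-- A polynomial automorphism whose direction at infinity differs from its indeterminacy direction
is cone expanding. -/
theorem exists_isConeExpanding (hF : HasHomogeneousExpansion f d F)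
    (hG : HasHomogeneousExpansion g e G) (hgf : ∀ z, g (f z) = z) (hfg : ∀ z, f (g z) = z)
    (hd : 2 ≤ d) (he : 2 ≤ e) (hG0 : ∃ w, G e w ≠ 0) {b c : Fin 2 → ℂ} {h : (Fin 2 → ℂ) → ℂ}
    (hc : c ≠ 0) (hb : b ≠ 0) (hhom : ∀ (t : ℂ) z, h (t • z) = t ^ d * h z)
    (hFd : ∀ w, F d w = h w • c) (hh0 : ∃ w, h w ≠ 0) (hzero : ∀ w, h w = 0 → planeDet b w = 0)
    (hbc : planeDet b c ≠ 0) : ∃ X Y κ R, IsConeExpanding f g X Y c b κ R := by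
  have hde : 1 < d * e := by nlinarith
  obtain ⟨w₀, hw₀⟩ := hh0
  obtain ⟨c', h', b', hc', hb', hhom', hGe, ⟨w₁, hw₁⟩, hzero'⟩ :=
    hG.exists_leading_zeros_subset_line hF hfg hgf (by rwa [mul_comm]) hG0
      ⟨w₀, by rw [hFd]; exact smul_ne_zero hw₀ hc⟩
  have hhc' : h c' = 0 := by
    have := hG.leading_comp_leading hF hfg (by rwa [mul_comm]) w₁
    rw [hFd, hGe, hhom] at this
    simpa [hc, hw₁] using this
  have hh'c : h' c = 0 := by
    have := hF.leading_comp_leading hG hgf hde w₀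
    rw [hFd, hGe, hhom'] at this
    simpa [hc', hw₀] using this
  obtain ⟨s, hs⟩ := exists_eq_smul_of_planeDet_eq_zero hb (hzero c' hhc')
  obtain ⟨s', hs'⟩ := exists_eq_smul_of_planeDet_eq_zero hb' (hzero' c hh'c)
  have hs0 : s ≠ 0 := fun h0 => hc' (by rw [hs, h0, zero_smul])
  have hs'0 : s' ≠ 0 := fun h0 => hc (by rw [hs', h0, zero_smul])
  have hcb : planeDet c b ≠ 0 := by
    unfold planeDet at hbc ⊢
    contrapose hbc
    linear_combination -hbc
  obtain ⟨X, Y, hXY⟩ := exists_isCoordinatePair hcb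
  obtain ⟨κ₁, hκ₁, R₁, h₁⟩ := hF.exists_cone hd hXY hFd (by simp [hXY.apply_fst])
    hXY.snd_apply_fst fun w hw h0 => hw (by
      obtain ⟨t, rfl⟩ := exists_eq_smul_of_planeDet_eq_zero hb (hzero w h0)
      simp [hXY.apply_snd])
  obtain ⟨κ₂, hκ₂, R₂, h₂⟩ := hG.exists_cone he hXY.symm hGe
    (by simp [hs, hXY.snd_apply_snd, hs0]) (by simp [hs, hXY.apply_snd]) fun w hw h0 => hw (by
      obtain ⟨t, rfl⟩ := exists_eq_smul_of_planeDet_eq_zero hb' (hzero' w h0)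
      have : Y b' = 0 := by
        have := hXY.snd_apply_fst
        rw [hs', _root_.map_smul, smul_eq_mul] at this
        exact (mul_eq_zero.1 this).resolve_left hs'0
      simp [this])
  have hκ : 0 < min κ₁ κ₂ := lt_min hκ₁ hκ₂
  set R := max (max R₁ R₂) (max 1 (2 / min κ₁ κ₂)) with hR
  refine ⟨X, Y, min κ₁ κ₂, R, hXY, hgf, ?_, hκ, (le_max_left _ _).trans (le_max_right _ _),
    ?_, fun z hz hz' => ?_, fun z hz hz' => ?_⟩
  · have : f = fun z => ∑ j ∈ Finset.range (d + 1), F j z := funext hF.eq_sum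
    rw [this]
    exact Differentiable.fun_sum fun j _ => hF.differentiable j
  · have h1 : 2 / min κ₁ κ₂ ≤ R := (le_max_right _ _).trans (le_max_right _ _)
    rwa [div_le_iff₀' hκ] at h1
  · obtain ⟨h3, h4⟩ := h₁ z (((le_max_left _ _).trans (le_max_left _ _)).trans hz) hz'
    exact ⟨(mul_le_mul_of_nonneg_right (min_le_left _ _) (by positivity)).trans h3, h4⟩
  · obtain ⟨h3, h4⟩ := h₂ z (((le_max_right _ _).trans (le_max_left _ _)).trans hz) hz'
    exact ⟨(mul_le_mul_of_nonneg_right (min_le_right _ _) (by positivity)).trans h3, h4⟩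

end HasHomogeneousExpansion

end

/-- weighted rigidity for polynomial automorphisms of ℂ². Under Assumption
(II) at every point and the span condition on `G₂(V)`, if a polynomial automorphism `f`
of ℂ² admits a bounded weighted composition operator `uC_f` with nonvanishing weight `u`,
then `f` is affine. -/
theorem polynomial_automorphism_weighted_rigidity
    {V : Type*} [NormedAddCommGroup V] [NormedSpace ℂ V] [CompleteSpace V]
    (ι : V →ₗ[ℂ] ((Fin 2 → ℂ) → ℂ)) (hinj : Function.Injective ι)
    (hent : ∀ h : V, Differentiable ℂ (ι h))
    (hbd : ∀ K : Set (Fin 2 → ℂ), IsCompact K →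
      ∃ C : ℝ, 0 ≤ C ∧ ∀ h : V, ∀ z ∈ K, ‖ι h z‖ ≤ C * ‖h‖)
    (hII : ∀ p : Fin 2 → ℂ,
      {n : ℕ | ∀ h : (Fin 2 → ℂ) → ℂ, Differentiable ℂ h →
        (∀ k < n, iteratedFDeriv ℂ k h p = 0) →
        ∃ v : V, ∀ k < n + 1,
          iteratedFDeriv ℂ k (fun z => ι v z - h z) p = 0}.Infinite)
    (hspan : Submodule.span ℂ
      {A : Matrix (Fin 2) (Fin 2) ℂ | IsUnit A ∧
        ∃ (b : Fin 2 → ℂ) (w : (Fin 2 → ℂ) → ℂ), Differentiable ℂ w ∧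
          ∃ T : V →L[ℂ] V, ∀ h : V,
            ι (T h) = fun z => Complex.exp (w z) * ι h (A.mulVec z + b)} = ⊤)
    (f : (Fin 2 → ℂ) → (Fin 2 → ℂ))
    (g : (Fin 2 → ℂ) → (Fin 2 → ℂ))
    (hgf : ∀ z, g (f z) = z) (hfg : ∀ z, f (g z) = z)
    (hfpoly : ∃ P : Fin 2 → MvPolynomial (Fin 2) ℂ,
      ∀ z i, f z i = MvPolynomial.eval z (P i))
    (hgpoly : ∃ Q : Fin 2 → MvPolynomial (Fin 2) ℂ,
      ∀ z i, g z i = MvPolynomial.eval z (Q i))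
    (u : (Fin 2 → ℂ) → ℂ) (hu : Differentiable ℂ u) (hu0 : ∀ z, u z ≠ 0)
    (T : V →L[ℂ] V) (hT : ∀ h : V, ι (T h) = fun z => u z * ι h (f z)) :
    ∃ (A : (Fin 2 → ℂ) →ₗ[ℂ] (Fin 2 → ℂ)) (b : Fin 2 → ℂ), ∀ z, f z = A z + b := by
  obtain ⟨P, hP⟩ := hfpoly
  obtain ⟨Q, hQ⟩ := hgpoly
  obtain ⟨d, F, hF, hF0⟩ := exists_hasHomogeneousExpansion P hP
  obtain ⟨e, G, hG, hG0⟩ := exists_hasHomogeneousExpansion Q hQ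
  by_cases hd : d ≤ 1
  · exact hF.exists_affine hd
  by_cases he : e ≤ 1
  · exact exists_affine_of_inverse hgf hfg (hG.exists_affine he)
  rw [not_le] at hd he
  obtain ⟨c, h, b, hc, hb, hhom, hFd, hh0, hzero⟩ := hF.exists_leading_zeros_subset_line hG hgf hfg
    (by nlinarith) (hF0.resolve_left (by omega)) (hG0.resolve_left (by omega))
  obtain ⟨A, ⟨hA, a, w, hw, L, hL⟩, hAc⟩ := exists_mem_planeDet_mulVec_ne_zero hspan hb hc
  have hA' : IsUnit A.det := (Matrix.isUnit_iff_isUnit_det A).1 hA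
  obtain ⟨Q', hQ'⟩ := exists_eval_mulVec_sub hQ A⁻¹ a
  obtain ⟨e', G', hG', hG'0⟩ := exists_hasHomogeneousExpansion
    (f := fun z => g (A⁻¹.mulVec (z - a))) Q' hQ'
  by_cases he' : e' ≤ 1
  · obtain ⟨B, a', hB⟩ := hG'.exists_affine he'
    refine exists_affine_of_inverse hgf hfg ⟨B ∘ₗ A.mulVecLin, B a + a', fun z => ?_⟩
    have := hB (A.mulVec z + a)
    rw [add_sub_cancel_right, Matrix.mulVec_mulVec, Matrix.nonsing_inv_mul A hA',
      Matrix.one_mulVec] at this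
    rw [this, map_add, add_assoc]
    rfl
  rw [not_le] at he'
  obtain ⟨X, Y, κ, R, hcone⟩ := (hF.mulVec_add A a).exists_isConeExpanding hG'
    (fun z => by
      rw [add_sub_cancel_right, Matrix.mulVec_mulVec, Matrix.nonsing_inv_mul A hA',
        Matrix.one_mulVec, hgf])
    (fun z => by
      rw [hfg, Matrix.mulVec_mulVec, Matrix.mul_nonsing_inv A hA', Matrix.one_mulVec,
        sub_add_cancel])
    hd he' (hG'0.resolve_left (by omega)) (c := A.mulVec c)
    (by rintro h0; simp [h0, planeDet] at hAc) hb hhom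
    (fun z => by
      rw [if_neg (by omega), add_zero, hFd, Matrix.mulVec_smul]) hh0 hzero hAc
  have hfd : Differentiable ℂ f := by
    have : f = fun z => ∑ j ∈ Finset.range (d + 1), F j z := funext hF.eq_sum
    rw [this]
    exact Differentiable.fun_sum fun j _ => hF.differentiable j
  refine absurd (fun q => eventually_exists_eq_zero_ne_zero (fun v => ι v) hent q (hII q))
    (hcone.not_separating (T := T ∘L L) (u := fun z => u z * Complex.exp (w (f z))) hent hbd
      (hu.continuous.mul (Complex.continuous_exp.comp (hw.continuous.comp hfd.continuous)))
      (fun z => mul_ne_zero (hu0 z) (Complex.exp_ne_zero _)) fun v z => ?_)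
  rw [ContinuousLinearMap.comp_apply, hT, hL, mul_assoc]
end
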